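/- arXiv:math/0204122 — 4 statements merged into one kernel-verified Lean document; each statement's English description precedes it below -/
import Mathlib

section
/- If a metric continuum X contains a non-degenerate subcontinuum H which is hereditarily decomposable, hereditarily unicoherent, and atriodic, then H is chainable. -/
open Metric Set Function

def IsSubcontinuum {X : Type*} [TopologicalSpace X] (A : Set X) : Prop :=
  IsCompact A ∧ IsConnected A

def Chainable (X : Type*) [MetricSpace X] : Prop :=
  ∀ ε : ℝ, 0 < ε → ∃ n : ℕ, ∃ C : Fin (n + 1) → Set X,
    (∀ i, IsOpen (C i)) ∧ (⋃ i, C i) = Set.univ ∧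
    (∀ i, Metric.diam (C i) < ε) ∧
    (∀ i j, (C i ∩ C j).Nonempty ↔ |(i : ℤ) - (j : ℤ)| ≤ 1)

def SetUnicoherent {X : Type*} [TopologicalSpace X] (H : Set X) : Prop :=
  ∀ A B : Set X, IsSubcontinuum A → IsSubcontinuum B → A ∪ B = H → IsConnected (A ∩ B)

def Unicoherent (X : Type*) [TopologicalSpace X] : Prop :=
  ∀ A B : Set X, IsSubcontinuum A → IsSubcontinuum B → A ∪ B = Set.univ → IsConnected (A ∩ B)

def SetDecomposable {X : Type*} [TopologicalSpace X] (H : Set X) : Prop :=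
  ∃ A B : Set X, IsSubcontinuum A ∧ IsSubcontinuum B ∧ A ⊂ H ∧ B ⊂ H ∧ A ∪ B = H

def IsTriod {X : Type*} [TopologicalSpace X] (T : Set X) : Prop :=
  IsSubcontinuum T ∧ ∃ Z : Set X, IsSubcontinuum Z ∧ Z ⊆ T ∧
    ∃ x ∈ T \ Z, ∃ y ∈ T \ Z, ∃ z ∈ T \ Z,
      connectedComponentIn (T \ Z) x ≠ connectedComponentIn (T \ Z) y ∧
      connectedComponentIn (T \ Z) x ≠ connectedComponentIn (T \ Z) z ∧
      connectedComponentIn (T \ Z) y ≠ connectedComponentIn (T \ Z) z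

def AlmostChainable (M : Type*) [MetricSpace M] : Prop :=
  ∀ ε : ℝ, 0 < ε → ∃ (G : Set (Set M)) (n : ℕ) (L : Fin (n + 1) → Set M),
    (∀ U ∈ G, IsOpen U ∧ Metric.diam U < ε) ∧ ⋃₀ G = Set.univ ∧
    (∀ i, L i ∈ G) ∧
    (∀ i j, (L i ∩ L j).Nonempty ↔ |(i : ℤ) - (j : ℤ)| ≤ 1) ∧
    (∀ i : Fin (n + 1), (i : ℕ) < n → ∀ U ∈ G, U ∉ Set.range L → L i ∩ U = ∅) ∧
    (∀ x : M, ∃ i, ∃ y ∈ L i, dist x y ≤ ε)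

def InverseLimit (Y : ℕ → Type*) [∀ n, TopologicalSpace (Y n)]
    (f : ∀ n, Y (n + 1) → Y n) : Set (∀ n, Y n) :=
  {x | ∀ n, f n (x (n + 1)) = x n}

def IsPolyhedron (Y : Type*) [TopologicalSpace Y] : Prop :=
  ∃ (n : ℕ) (S : Finset (Finset (EuclideanSpace ℝ (Fin n)))),
    Nonempty (Y ≃ₜ ↥(⋃ s ∈ S, convexHull ℝ (s : Set (EuclideanSpace ℝ (Fin n)))))

def IsGraphSet {n : ℕ} (K : Set (EuclideanSpace ℝ (Fin n))) : Prop :=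
  (∃ S : Finset (Finset (EuclideanSpace ℝ (Fin n))), (∀ s ∈ S, s.card ≤ 2) ∧
      K = ⋃ s ∈ S, convexHull ℝ (s : Set (EuclideanSpace ℝ (Fin n)))) ∧
  IsConnected K ∧ K.Nontrivial

def IsTreeSet {n : ℕ} (K : Set (EuclideanSpace ℝ (Fin n))) : Prop :=
  IsGraphSet K ∧ ∀ A : Set (EuclideanSpace ℝ (Fin n)), A ⊆ K → ¬ Nonempty (A ≃ₜ Circle)

def IsBranchPoint (Y : Type*) [TopologicalSpace Y] (x : Y) : Prop :=
  ¬ ∀ V ∈ nhds x, ∃ U ∈ nhds x,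
    U ⊆ V ∧ IsOpen U ∧ (frontier U).Finite ∧ (frontier U).ncard ≤ 2

def KJunctioned (X : Type*) [TopologicalSpace X] (k : ℕ) : Prop :=
  ∃ (m : ℕ → ℕ) (G : ∀ n : ℕ, Set (EuclideanSpace ℝ (Fin (m n))))
    (f : ∀ n : ℕ, ↥(G (n + 1)) → ↥(G n)),
    (∀ n, IsGraphSet (G n)) ∧
    (∀ n, {x : ↥(G n) | IsBranchPoint (↥(G n)) x}.Finite ∧
      {x : ↥(G n) | IsBranchPoint (↥(G n)) x}.ncard ≤ k) ∧
    (∀ n, Continuous (f n) ∧ Function.Surjective (f n)) ∧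
    Nonempty (X ≃ₜ ↥(InverseLimit (fun n => ↥(G n)) f))

def TreeLike (X : Type*) [MetricSpace X] : Prop :=
  ∀ ε : ℝ, 0 < ε → ∃ (m : ℕ) (T : Set (EuclideanSpace ℝ (Fin m))), IsTreeSet T ∧
    ∃ f : X → ↥T, Continuous f ∧ Function.Surjective f ∧ ∀ t, Metric.diam (f ⁻¹' {t}) < ε

noncomputable def Span (X : Type*) [MetricSpace X] : ℝ :=
  sSup {σ : ℝ | 0 ≤ σ ∧ ∃ Z : Set (X × X), IsSubcontinuum Z ∧
    Prod.fst '' Z = Prod.snd '' Z ∧ ∀ p ∈ Z, σ ≤ dist p.1 p.2}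

namespace Bing

section basic
variable {X : Type*} [MetricSpace X]

theorem pre_split {s P Q : Set X} (hs : IsPreconnected s) (hP : IsClosed P) (hQ : IsClosed Q)
    (h : s ⊆ P ∪ Q) (hd : ∀ x ∈ s, x ∈ P → x ∈ Q → False) : s ⊆ P ∨ s ⊆ Q := by
  rw [isPreconnected_iff_subset_of_disjoint_closed] at hs
  refine hs P Q hP hQ h ?_
  ext x
  simp only [mem_inter_iff, mem_empty_iff_false, iff_false]
  rintro ⟨h1, h2, h3⟩
  exact hd x h1 h2 h3

theorem chain_subset_open {S : Set (Set X)} (hne : S.Nonempty) (hc : IsChain (· ⊆ ·) S)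
    (hcomp : ∀ s ∈ S, IsCompact s) {V : Set X} (hV : IsOpen V) (h : ⋂₀ S ⊆ V) :
    ∃ s ∈ S, s ⊆ V := by
  have : Nonempty S := hne.to_subtype
  have := exists_subset_nhds_of_isCompact' (V := fun s : S => (s : Set X)) (U := V) ?_
    (fun s => hcomp s s.2) (fun s => (hcomp s s.2).isClosed) ?_
  · obtain ⟨s, hs⟩ := this
    exact ⟨s, s.2, hs⟩
  · intro a b
    rcases hc.total a.2 b.2 with h | h
    · exact ⟨a, le_rfl, h⟩
    · exact ⟨b, h, le_rfl⟩
  · intro x hx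
    refine hV.mem_nhds (h ?_)
    rw [sInter_eq_iInter]; exact hx

theorem chain_inter {S : Set (Set X)} (hne : S.Nonempty) (hc : IsChain (· ⊆ ·) S)
    (hcont : ∀ s ∈ S, IsSubcontinuum s) : IsSubcontinuum (⋂₀ S) := by
  have hcomp : ∀ s ∈ S, IsCompact s := fun s hs => (hcont s hs).1
  have hcl : IsClosed (⋂₀ S) := isClosed_sInter fun s hs => (hcomp s hs).isClosed
  obtain ⟨s0, hs0⟩ := hne
  have hK : IsCompact (⋂₀ S) := (hcomp s0 hs0).of_isClosed_subset hcl (sInter_subset_of_mem hs0)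
  refine ⟨hK, ?_, ?_⟩
  · by_contra h
    rw [not_nonempty_iff_eq_empty] at h
    obtain ⟨s, hs, hs'⟩ := chain_subset_open ⟨s0, hs0⟩ hc hcomp isOpen_empty h.le
    obtain ⟨x, hx⟩ := (hcont s hs).2.1
    exact hs' hx
  · rw [isPreconnected_iff_subset_of_fully_disjoint_closed hcl]
    intro u v hu hv huv hd
    obtain ⟨U, V, hU, hV, huU, hvV, hUV⟩ := normal_separation hu hv hd
    obtain ⟨s, hs, hs'⟩ := chain_subset_open ⟨s0, hs0⟩ hc hcomp (hU.union hV)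
      (huv.trans (union_subset_union huU hvV))
    rcases (hcont s hs).2.2.subset_or_subset hU hV hUV hs' with h | h
    · left
      intro x hx
      rcases huv hx with h' | h'
      · exact h'
      · exact (disjoint_left.1 hUV (h (hx s hs)) (hvV h')).elim
    · right
      intro x hx
      rcases huv hx with h' | h'
      · exact (disjoint_left.1 hUV (huU h') (h (hx s hs))).elim
      · exact h'

theorem sep {Y S T : Set X} (hY : IsCompact Y) (hS : IsClosed S) (hT : IsClosed T)
    (hSY : S ⊆ Y) (hTY : T ⊆ Y)
    (h : ∀ C ⊆ Y, IsPreconnected C → ∀ x ∈ C, ∀ y ∈ C, x ∈ S → y ∈ T → False) :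
    ∃ P Q : Set X, IsClosed P ∧ IsClosed Q ∧ Disjoint P Q ∧ P ∪ Q = Y ∧ S ⊆ P ∧ T ⊆ Q := by
  have : CompactSpace Y := isCompact_iff_compactSpace.1 hY
  let S' : Set Y := Subtype.val ⁻¹' S
  let T' : Set Y := Subtype.val ⁻¹' T
  have hS' : IsCompact S' := (hS.preimage continuous_subtype_val).isCompact
  have hT' : IsClosed T' := hT.preimage continuous_subtype_val
  have key : ∃ Z : Set Y, IsClopen Z ∧ S' ⊆ Z ∧ Disjoint Z T' := by
    refine hS'.induction_on (p := fun s => ∃ Z : Set Y, IsClopen Z ∧ s ⊆ Z ∧ Disjoint Z T') ?_ ?_ ?_ ?_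
    · exact ⟨∅, isClopen_empty, le_rfl, by simp⟩
    · rintro s t hst ⟨Z, h1, h2, h3⟩
      exact ⟨Z, h1, hst.trans h2, h3⟩
    · rintro s t ⟨Z, h1, h2, h3⟩ ⟨Z', h1', h2', h3'⟩
      exact ⟨Z ∪ Z', h1.union h1', union_subset_union h2 h2', by simp [h3, h3']⟩
    · intro x hx
      have hcomp : connectedComponent x ⊆ T'ᶜ := by
        intro y hy hyT
        refine h (Subtype.val '' connectedComponent x) ?_ ?_ x ⟨x, mem_connectedComponent, rfl⟩ y
          ⟨y, hy, rfl⟩ hx hyT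
        · rintro _ ⟨z, _, rfl⟩; exact z.2
        · exact isPreconnected_connectedComponent.image _ continuous_subtype_val.continuousOn
      rw [connectedComponent_eq_iInter_isClopen] at hcomp
      have : Nonempty {s : Set Y // IsClopen s ∧ x ∈ s} := ⟨⟨univ, isClopen_univ, mem_univ _⟩⟩
      have := exists_subset_nhds_of_isCompact' (V := fun s : {s : Set Y // IsClopen s ∧ x ∈ s} => (s : Set Y))
        (U := T'ᶜ) ?_ (fun s => s.2.1.1.isCompact) (fun s => s.2.1.1) ?_
      · obtain ⟨s, hs⟩ := this
        refine ⟨s, mem_nhdsWithin_of_mem_nhds (s.2.1.2.mem_nhds s.2.2), s, s.2.1, le_rfl, ?_⟩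
        exact disjoint_left.2 fun y hy hy' => hs hy hy'
      · intro a b
        exact ⟨⟨a.1 ∩ b.1, a.2.1.inter b.2.1, a.2.2, b.2.2⟩, inter_subset_left, inter_subset_right⟩
      · intro y hy
        exact hT'.isOpen_compl.mem_nhds (hcomp hy)
  obtain ⟨Z, hZ, hSZ, hZT⟩ := key
  have he : Topology.IsClosedEmbedding (Subtype.val : Y → X) := hY.isClosed.isClosedEmbedding_subtypeVal
  refine ⟨Subtype.val '' Z, Subtype.val '' Zᶜ, he.isClosedMap _ hZ.1, he.isClosedMap _ hZ.compl.1, ?_, ?_, ?_, ?_⟩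
  · rw [disjoint_image_iff Subtype.val_injective]
    exact disjoint_compl_right
  · rw [← image_union, union_compl_self]; simp
  · intro x hx
    exact ⟨⟨x, hSY hx⟩, hSZ hx, rfl⟩
  · intro x hx
    exact ⟨⟨x, hTY hx⟩, fun hz => disjoint_left.1 hZT hz hx, rfl⟩

/-- weak chain relative to `D` (disjointness is checked on `D`). -/
def WC (L D : Set X) (sm : Set X → Prop) (n : ℕ) (d : ℕ → Set X) : Prop :=
  (∀ i, IsOpen (d i)) ∧ (∀ x ∈ L, ∃ i < n, x ∈ d i) ∧ (∀ i < n, sm (d i)) ∧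
  (∀ i j, i + 2 ≤ j → j < n → ∀ x ∈ D, x ∈ d i → x ∉ d j)

theorem normalize {L : Set X} {sm : Set X → Prop} (hsm : ∀ s t, s ⊆ t → sm t → sm s) {n : ℕ} {d : ℕ → Set X}
    (h : WC L L sm n d) :
    ∃ d' : ℕ → Set X, WC L univ sm n d' ∧ ∀ i, d' i ⊆ d i ∧ L ∩ d i ⊆ d' i := by
  obtain ⟨h1, h2, h3, h4⟩ := h
  let d' : ℕ → Set X := fun i => d i ∩ {x | infEDist x (L ∩ d i) < infEDist x (L \ d i)}
  have hin : ∀ i, L ∩ d i ⊆ d' i := by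
    rintro i x ⟨hx, hxd⟩
    refine ⟨hxd, ?_⟩
    have e1 : infEDist x (L ∩ d i) = 0 := infEDist_zero_of_mem ⟨hx, hxd⟩
    rw [mem_ofPred_eq, e1, pos_iff_ne_zero]
    intro h0
    rw [← mem_closure_iff_infEDist_zero] at h0
    obtain ⟨y, hy, hy'⟩ := mem_closure_iff.1 h0 (d i) (h1 i) hxd
    exact hy'.2 hy
  refine ⟨d', ⟨?_, ?_, ?_, ?_⟩, fun i => ⟨inter_subset_left, hin i⟩⟩
  · intro i
    exact (h1 i).inter (isOpen_lt continuous_infEDist continuous_infEDist)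
  · intro x hx
    obtain ⟨i, hi, hxi⟩ := h2 x hx
    exact ⟨i, hi, hin i ⟨hx, hxi⟩⟩
  · intro i hi
    exact hsm _ _ inter_subset_left (h3 i hi)
  · rintro i j hij hj x - ⟨hxi, hi⟩ ⟨hxj, hj'⟩
    have a1 : infEDist x (L \ d j) ≤ infEDist x (L ∩ d i) := by
      apply infEDist_anti
      rintro y ⟨hy, hyi⟩
      exact ⟨hy, h4 i j hij hj y hy hyi⟩
    have a2 : infEDist x (L \ d i) ≤ infEDist x (L ∩ d j) := by
      apply infEDist_anti
      rintro y ⟨hy, hyj⟩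
      exact ⟨hy, fun hyi => h4 i j hij hj y hy hyi hyj⟩
    exact absurd (hi.trans_le (a2.trans (le_of_lt (lt_of_lt_of_le hj' a1)))) (lt_irrefl _)

/-- concatenation -/
theorem concat {L1 L2 D : Set X} {sm : Set X → Prop} {n m : ℕ} {d e : ℕ → Set X}
    (h1 : WC L1 D sm n d) (h2 : WC L2 D sm m e)
    (h : ∀ i < n, ∀ j < m, ∀ x ∈ D, x ∈ d i → x ∈ e j → i + 1 = n ∧ j = 0) :
    WC (L1 ∪ L2) D sm (n + m) (fun t => if t < n then d t else e (t - n)) := by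
  obtain ⟨a1, a2, a3, a4⟩ := h1
  obtain ⟨b1, b2, b3, b4⟩ := h2
  refine ⟨?_, ?_, ?_, ?_⟩
  · intro i; dsimp only; split_ifs <;> simp [*]
  · rintro x (hx | hx)
    · obtain ⟨i, hi, hxi⟩ := a2 x hx
      exact ⟨i, by omega, by simpa [hi] using hxi⟩
    · obtain ⟨i, hi, hxi⟩ := b2 x hx
      exact ⟨n + i, by omega, by simpa using hxi⟩
  · intro i hi; dsimp only; split_ifs with hc
    · exact a3 i hc
    · exact b3 _ (by omega)
  · intro i j hij hj x hx hxi hxj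
    dsimp only at hxi hxj
    split_ifs at hxi hxj with c1 c2 c2
    · exact a4 i j hij c2 x hx hxi hxj
    · have := h i c1 (j - n) (by omega) x hx hxi hxj
      omega
    · omega
    · exact b4 _ _ (by omega) (by omega) x hx hxi hxj

theorem reverse {L D : Set X} {sm : Set X → Prop} {n : ℕ} {d : ℕ → Set X}
    (h : WC L D sm n d) : WC L D sm n (fun t => d (n - 1 - t)) := by
  obtain ⟨a1, a2, a3, a4⟩ := h
  refine ⟨fun i => a1 _, ?_, ?_, ?_⟩
  · intro x hx
    obtain ⟨i, hi, hxi⟩ := a2 x hx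
    refine ⟨n - 1 - i, by omega, ?_⟩
    have : n - 1 - (n - 1 - i) = i := by omega
    simpa [this] using hxi
  · intro i hi; exact a3 _ (by omega)
  · intro i j hij hj x hx hxi hxj
    exact a4 (n - 1 - j) (n - 1 - i) (by omega) (by omega) x hx hxj hxi

end basic
end Bing

namespace Bing

section cls
variable {X : Type*} [MetricSpace X]

structure Nice (H : Set X) : Prop where
  dec : ∀ K : Set X, K ⊆ H → IsSubcontinuum K → K.Nontrivial → SetDecomposable K
  uni : ∀ K : Set X, K ⊆ H → IsSubcontinuum K → SetUnicoherent K
  atr : ∀ T : Set X, T ⊆ H → ¬ IsTriod T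

theorem cont_union {A B : Set X} (hA : IsSubcontinuum A) (hB : IsSubcontinuum B) {x : X} (h1 : x ∈ A)
    (h2 : x ∈ B) : IsSubcontinuum (A ∪ B) :=
  ⟨hA.1.union hB.1, IsConnected.union ⟨x, h1, h2⟩ hA.2 hB.2⟩

theorem cont_singleton (x : X) : IsSubcontinuum ({x} : Set X) :=
  ⟨isCompact_singleton, isConnected_singleton⟩

variable {H : Set X}

theorem Nice.inter (hN : Nice H) {A B : Set X} (hA : IsSubcontinuum A) (hB : IsSubcontinuum B)
    (hAH : A ⊆ H) (hBH : B ⊆ H) {x : X} (h1 : x ∈ A) (h2 : x ∈ B) : IsSubcontinuum (A ∩ B) :=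
  ⟨hA.1.inter hB.1, hN.uni (A ∪ B) (union_subset hAH hBH) (cont_union hA hB h1 h2) A B hA hB rfl⟩

theorem triod_aux {A B C Z T : Set X} (hA : IsClosed A) (hB : IsClosed B) (hC : IsClosed C)
    (hT : T ⊆ A ∪ (B ∪ C)) (hZ1 : A ∩ B ⊆ Z) (hZ2 : A ∩ C ⊆ Z) {a b : X}
    (haT : a ∈ T \ Z) (hbT : b ∈ T \ Z)
    (haB : a ∉ B) (haC : a ∉ C) (hbA : b ∉ A) :
    connectedComponentIn (T \ Z) a ≠ connectedComponentIn (T \ Z) b := by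
  intro h
  have hpre : IsPreconnected (connectedComponentIn (T \ Z) a) := isPreconnected_connectedComponentIn
  have hsub := connectedComponentIn_subset (T \ Z) a
  have ha := mem_connectedComponentIn haT
  have hb := mem_connectedComponentIn hbT
  rw [← h] at hb
  rcases pre_split hpre hA (hB.union hC) (fun x hx => hT (hsub hx).1) (by
    rintro x hx hxA (hx' | hx')
    · exact (hsub hx).2 (hZ1 ⟨hxA, hx'⟩)
    · exact (hsub hx).2 (hZ2 ⟨hxA, hx'⟩)) with h' | h'
  · exact hbA (h' hb)
  · rcases h' ha with h'' | h''
    · exact haB h''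
    · exact haC h''

theorem Nice.tri (hN : Nice H) {A B C : Set X} (hA : IsSubcontinuum A) (hB : IsSubcontinuum B)
    (hC : IsSubcontinuum C) (hAH : A ⊆ H) (hBH : B ⊆ H) (hCH : C ⊆ H) {x : X} (xA : x ∈ A) (xB : x ∈ B)
    (xC : x ∈ C) {a b c : X} (aA : a ∈ A) (aB : a ∉ B) (aC : a ∉ C) (bA : b ∉ A) (bB : b ∈ B) (bC : b ∉ C)
    (cA : c ∉ A) (cB : c ∉ B) (cC : c ∈ C) : False := by
  refine hN.atr (A ∪ (B ∪ C)) (union_subset hAH (union_subset hBH hCH))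
    ⟨cont_union hA (cont_union hB hC xB xC) xA (Or.inl xB), (A ∩ B) ∪ ((B ∩ C) ∪ (A ∩ C)), ?_, ?_, a, ?_, b, ?_, c, ?_,
      ?_, ?_, ?_⟩
  · exact cont_union (hN.inter hA hB hAH hBH xA xB) (cont_union (hN.inter hB hC hBH hCH xB xC)
      (hN.inter hA hC hAH hCH xA xC) (x := x) ⟨xB, xC⟩ ⟨xA, xC⟩) (x := x) ⟨xA, xB⟩ (Or.inl ⟨xB, xC⟩)
  · rintro y (h | h | h)
    · exact Or.inl h.1
    · exact Or.inr (Or.inl h.1)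
    · exact Or.inl h.1
  · simp [*]
  · simp [*]
  · simp [*]
  · refine triod_aux hA.1.isClosed hB.1.isClosed hC.1.isClosed le_rfl ?_ ?_ ?_ ?_ aB aC bA
    · exact subset_union_left
    · exact fun y hy => Or.inr (Or.inr hy)
    · simp [*]
    · simp [*]
  · refine triod_aux hA.1.isClosed hB.1.isClosed hC.1.isClosed le_rfl ?_ ?_ ?_ ?_ aB aC cA
    · exact subset_union_left
    · exact fun y hy => Or.inr (Or.inr hy)
    · simp [*]
    · simp [*]
  · refine triod_aux hB.1.isClosed hA.1.isClosed hC.1.isClosed ?_ ?_ ?_ ?_ ?_ bA bC cB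
    · rintro y (h | h | h) <;> simp [h]
    · exact fun y hy => Or.inl hy.symm
    · exact fun y hy => Or.inr (Or.inl hy)
    · simp [*]
    · simp [*]

def Nest (B M : Set X) : Prop := ∀ F G : Set X, IsSubcontinuum F → IsSubcontinuum G → B ⊆ F → B ⊆ G →
  F ⊆ M → G ⊆ M → F ⊆ G ∨ G ⊆ F

def EndP (p : X) (M : Set X) : Prop := p ∈ M ∧ Nest {p} M

def ST (D M : Set X) : Prop := IsSubcontinuum D ∧ D ⊆ M ∧ ∀ F G : Set X, IsSubcontinuum F → IsSubcontinuum G →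
  F ⊆ M → G ⊆ M → (F ∩ D).Nonempty → (G ∩ D).Nonempty → ¬ F ⊆ D → F ⊆ G ∨ G ⊆ F

theorem EndP.mono {p : X} {M N : Set X} (h : EndP p M) (hN : N ⊆ M) (hp : p ∈ N) : EndP p N :=
  ⟨hp, fun F G hF hG h1 h2 h3 h4 => h.2 F G hF hG h1 h2 (h3.trans hN) (h4.trans hN)⟩

theorem EndP.nest {p : X} {M F G : Set X} (h : EndP p M) (hF : IsSubcontinuum F) (hG : IsSubcontinuum G)
    (h1 : p ∈ F) (h2 : p ∈ G) (h3 : F ⊆ M) (h4 : G ⊆ M) : F ⊆ G ∨ G ⊆ F :=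
  h.2 F G hF hG (by simpa) (by simpa) h3 h4

theorem ST.trans {D' D M : Set X} (h' : ST D' D) (h : ST D M) : ST D' M := by
  refine ⟨h'.1, h'.2.1.trans h.2.1, ?_⟩
  intro F G hF hG hFM hGM hFD hGD hn
  have hFD' := hFD.mono (inter_subset_inter_right F h'.2.1)
  have hGD' := hGD.mono (inter_subset_inter_right G h'.2.1)
  by_cases c1 : F ⊆ D
  · by_cases c2 : G ⊆ D
    · exact h'.2.2 F G hF hG c1 c2 hFD hGD hn
    · exact (h.2.2 G F hG hF hGM hFM hGD' hFD' c2).symm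
  · exact h.2.2 F G hF hG hFM hGM hFD' hGD' c1

theorem ST.endP {p : X} {M : Set X} (h : ST {p} M) : EndP p M := by
  refine ⟨h.2.1 rfl, fun F G hF hG h1 h2 h3 h4 => ?_⟩
  by_cases c : F ⊆ {p}
  · exact Or.inl (c.trans h2)
  · exact h.2.2 F G hF hG h3 h4 ⟨p, h1 rfl, rfl⟩ ⟨p, h2 rfl, rfl⟩ c

theorem piece_aux {M N u v P Q : Set X} (hM : IsSubcontinuum M) (hN : IsSubcontinuum N) (hNM : N ⊆ M)
    (hu : IsClosed u) (hv : IsClosed v) (huv : Disjoint u v) (hR : closure (M \ N) ⊆ u ∪ v)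
    (hP : IsClosed P) (hQ : IsClosed Q) (hPQ : Disjoint P Q)
    (hc : N ∪ (closure (M \ N) ∩ u) ⊆ P ∪ Q) (hNP : N ⊆ P) : N ∪ (closure (M \ N) ∩ u) ⊆ P := by
  have hRc : IsClosed (closure (M \ N)) := isClosed_closure
  have := pre_split hM.2.2 (P := N ∪ ((closure (M \ N) ∩ u ∩ P) ∪ (closure (M \ N) ∩ v)))
    (Q := closure (M \ N) ∩ u ∩ Q) (hN.1.isClosed.union (((hRc.inter hu).inter hP).union (hRc.inter hv)))
    ((hRc.inter hu).inter hQ) ?_ ?_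
  · rcases this with h | h
    · rintro x (hx | hx)
      · exact hNP hx
      · rcases hc (Or.inr hx) with h' | h'
        · exact h'
        · have hxM : x ∈ M := by
            have : closure (M \ N) ⊆ M := closure_minimal sdiff_subset hM.1.isClosed
            exact this hx.1
          rcases h hxM with h1 | h1 | h1
          · exact hNP h1
          · exact h1.2
          · exact (disjoint_left.1 huv hx.2 h1.2).elim
    · obtain ⟨y, hy⟩ := hN.2.1
      exact (disjoint_left.1 hPQ (hNP hy) (h (hNM hy)).2).elim
  · intro x hx
    by_cases hxN : x ∈ N
    · exact Or.inl (Or.inl hxN)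
    · have hxR : x ∈ closure (M \ N) := subset_closure ⟨hx, hxN⟩
      rcases hR hxR with h | h
      · rcases hc (Or.inr ⟨hxR, h⟩) with h' | h'
        · exact Or.inl (Or.inr (Or.inl ⟨⟨hxR, h⟩, h'⟩))
        · exact Or.inr ⟨⟨hxR, h⟩, h'⟩
      · exact Or.inl (Or.inr (Or.inr ⟨hxR, h⟩))
  · rintro x - (h | h | h) h'
    · exact disjoint_left.1 hPQ (hNP h) h'.2
    · exact disjoint_left.1 hPQ h.2 h'.2
    · exact disjoint_left.1 huv h'.1.2 h.2

theorem piece {M N u v : Set X} (hM : IsSubcontinuum M) (hN : IsSubcontinuum N) (hNM : N ⊆ M)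
    (hu : IsClosed u) (hv : IsClosed v) (huv : Disjoint u v) (hR : closure (M \ N) ⊆ u ∪ v) :
    IsSubcontinuum (N ∪ (closure (M \ N) ∩ u)) := by
  have hRM : closure (M \ N) ⊆ M := closure_minimal sdiff_subset hM.1.isClosed
  have hcl : IsClosed (N ∪ (closure (M \ N) ∩ u)) := hN.1.isClosed.union (isClosed_closure.inter hu)
  refine ⟨hM.1.of_isClosed_subset hcl (union_subset hNM (inter_subset_left.trans hRM)), ?_, ?_⟩
  · exact hN.2.1.mono subset_union_left
  · rw [isPreconnected_iff_subset_of_fully_disjoint_closed hcl]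
    intro P Q hP hQ hc hPQ
    rcases pre_split hN.2.2 hP hQ (subset_union_left.trans hc)
      (fun x _ h1 h2 => disjoint_left.1 hPQ h1 h2) with h | h
    · exact Or.inl (piece_aux hM hN hNM hu hv huv hR hP hQ hPQ hc h)
    · exact Or.inr (piece_aux hM hN hNM hu hv huv hR hQ hP hPQ.symm (by rwa [union_comm Q P]) h)

theorem connCompl {M N B : Set X} (hM : IsSubcontinuum M) (hN : IsSubcontinuum N) (hNM : N ⊆ M) (hne : ¬ M ⊆ N)
    (hB : B ⊆ N) (hnest : Nest B M) : IsSubcontinuum (closure (M \ N)) := by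
  have hRM : closure (M \ N) ⊆ M := closure_minimal sdiff_subset hM.1.isClosed
  refine ⟨hM.1.of_isClosed_subset isClosed_closure hRM, ?_, ?_⟩
  · obtain ⟨x, hx, hx'⟩ := not_subset.1 hne
    exact ⟨x, subset_closure ⟨hx, hx'⟩⟩
  · rw [isPreconnected_iff_subset_of_fully_disjoint_closed isClosed_closure]
    intro u v hu hv hR huv
    have c1 := piece hM hN hNM hu hv huv hR
    have c2 := piece hM hN hNM hv hu huv.symm (by rwa [union_comm v u])
    rcases hnest _ _ c1 c2 (hB.trans subset_union_left) (hB.trans subset_union_left)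
      (union_subset hNM (inter_subset_left.trans hRM)) (union_subset hNM (inter_subset_left.trans hRM)) with h | h
    · right
      apply closure_minimal _ hv
      rintro x ⟨hx, hx'⟩
      have hxR : x ∈ closure (M \ N) := subset_closure ⟨hx, hx'⟩
      rcases hR hxR with h1 | h1
      · rcases h (Or.inr ⟨hxR, h1⟩) with h2 | h2
        · exact absurd h2 hx'
        · exact h2.2
      · exact h1
    · left
      apply closure_minimal _ hu
      rintro x ⟨hx, hx'⟩
      have hxR : x ∈ closure (M \ N) := subset_closure ⟨hx, hx'⟩
      rcases hR hxR with h1 | h1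
      · exact h1
      · rcases h (Or.inr ⟨hxR, h1⟩) with h2 | h2
        · exact absurd h2 hx'
        · exact h2.2

/-- proper subcontinua containing `B` -/
def PS (B M N : Set X) : Prop := IsSubcontinuum N ∧ B ⊆ N ∧ N ⊆ M ∧ ¬ M ⊆ N

theorem lemD_disj (hN : Nice H) {M B N : Set X} (hM : IsSubcontinuum M) (hMH : M ⊆ H) (hnest : Nest B M)
    (hPN : PS B M N) {z : X} (hz : ∀ N', PS B M N' → z ∈ closure (M \ N')) (hzN : z ∈ N) : False := by
  obtain ⟨hNc, hBN, hNM, hMN⟩ := hPN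
  have hR : ∀ N', PS B M N' → IsSubcontinuum (closure (M \ N')) := fun N' h =>
    connCompl hM h.1 h.2.2.1 h.2.2.2 h.2.1 hnest
  have hRM : ∀ N', closure (M \ N') ⊆ M := fun N' => closure_minimal sdiff_subset hM.1.isClosed
  have key : ∀ N₁, PS B M N₁ → N ⊆ N₁ → closure (M \ N) ⊆ closure (M \ N₁) := by
    intro N₁ h1 hNN
    have hc := cont_union hNc (hR N₁ h1) hzN (hz N₁ h1)
    apply closure_minimal _ isClosed_closure
    rintro x ⟨hx, hxN⟩
    rcases hnest _ _ hc h1.1 (hBN.trans subset_union_left) h1.2.1 (union_subset hNM (hRM N₁)) h1.2.2.1 with h | h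
    · exfalso
      apply h1.2.2.2
      intro y hy
      by_contra hy'
      exact hy' (h (Or.inr (subset_closure ⟨hy, hy'⟩)))
    · by_cases hx1 : x ∈ N₁
      · exact (h hx1).resolve_left hxN
      · exact subset_closure ⟨hx, hx1⟩
  have hnt : (closure (M \ N)).Nontrivial := by
    by_contra hh
    rw [not_nontrivial_iff] at hh
    apply hMN
    intro y hy
    by_contra hy'
    have := hh (subset_closure ⟨hy, hy'⟩) (hz N ⟨hNc, hBN, hNM, hMN⟩)
    exact hy' (this ▸ hzN)
  have aux : ∀ D₁ D₂ : Set X, IsSubcontinuum D₁ → D₁ ⊂ closure (M \ N) → IsSubcontinuum D₂ →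
      D₂ ⊂ closure (M \ N) → D₁ ∪ D₂ = closure (M \ N) → z ∈ D₁ → False := by
    intro D₁ D₂ c1 p1 c2 p2 hu hz1
    have hc := cont_union hNc c1 hzN hz1
    by_cases hMs : M ⊆ N ∪ D₁
    · apply p1.2
      apply closure_minimal _ c1.1.isClosed
      rintro x ⟨hx, hx'⟩
      exact (hMs hx).resolve_left hx'
    · have := key _ ⟨hc, hBN.trans subset_union_left, union_subset hNM (p1.1.trans (hRM N)), hMs⟩ subset_union_left
      apply p2.2
      refine this.trans (closure_minimal ?_ c2.1.isClosed)
      rintro x ⟨hx, hx'⟩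
      rw [mem_union, not_or] at hx'
      have : x ∈ D₁ ∪ D₂ := hu ▸ subset_closure ⟨hx, hx'.1⟩
      exact this.resolve_left hx'.2
  obtain ⟨D₁, D₂, c1, c2, p1, p2, hu⟩ := hN.dec _ ((hRM N).trans hMH) (hR N ⟨hNc, hBN, hNM, hMN⟩) hnt
  have : z ∈ D₁ ∪ D₂ := hu ▸ hz N ⟨hNc, hBN, hNM, hMN⟩
  rcases this with h | h
  · exact aux D₁ D₂ c1 p1 c2 p2 hu h
  · exact aux D₂ D₁ c2 p2 c1 p1 (by rwa [union_comm]) h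

theorem lemD (hN : Nice H) {M B : Set X} (hM : IsSubcontinuum M) (hMH : M ⊆ H) (hnest : Nest B M)
    (hB : PS B M B) : ∃ D : Set X, IsSubcontinuum D ∧ D ⊆ M ∧ (∀ N, PS B M N → Disjoint D N) ∧
      (∀ x ∈ M, x ∉ D → ∃ N, PS B M N ∧ x ∈ N) ∧
      (∀ O, IsOpen O → (O ∩ M).Nonempty → ∃ N, PS B M N ∧ (O ∩ N).Nonempty) ∧ ST D M := by
  have hR : ∀ N', PS B M N' → IsSubcontinuum (closure (M \ N')) := fun N' h =>
    connCompl hM h.1 h.2.2.1 h.2.2.2 h.2.1 hnest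
  have hRM : ∀ N', closure (M \ N') ⊆ M := fun N' => closure_minimal sdiff_subset hM.1.isClosed
  let S : Set (Set X) := {R | ∃ N', PS B M N' ∧ R = closure (M \ N')}
  have hSne : S.Nonempty := ⟨_, B, hB, rfl⟩
  have hSch : IsChain (· ⊆ ·) S := by
    rintro _ ⟨N1, h1, rfl⟩ _ ⟨N2, h2, rfl⟩ -
    rcases hnest N1 N2 h1.1 h2.1 h1.2.1 h2.2.1 h1.2.2.1 h2.2.2.1 with h | h
    · exact Or.inr (closure_mono (sdiff_subset_sdiff_right h))
    · exact Or.inl (closure_mono (sdiff_subset_sdiff_right h))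
  have hDc : IsSubcontinuum (⋂₀ S) := chain_inter hSne hSch (by rintro _ ⟨N', h, rfl⟩; exact hR N' h)
  have hDM : ⋂₀ S ⊆ M := (sInter_subset_of_mem (show closure (M \ B) ∈ S from ⟨B, hB, rfl⟩)).trans (hRM B)
  have hdisj : ∀ N, PS B M N → Disjoint (⋂₀ S) N := by
    intro N h
    rw [disjoint_left]
    intro z hz hzN
    exact lemD_disj hN hM hMH hnest h (fun N' h' => hz _ ⟨N', h', rfl⟩) hzN
  have hcov : ∀ x ∈ M, x ∉ ⋂₀ S → ∃ N, PS B M N ∧ x ∈ N := by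
    intro x hx hxD
    rw [mem_sInter] at hxD
    push Not at hxD
    obtain ⟨_, ⟨N', h, rfl⟩, hx'⟩ := hxD
    refine ⟨N', h, ?_⟩
    by_contra hxN
    exact hx' (subset_closure ⟨hx, hxN⟩)
  obtain ⟨b, hb⟩ := hB.1.2.1
  have hdense : ∀ O, IsOpen O → (O ∩ M).Nonempty → ∃ N, PS B M N ∧ (O ∩ N).Nonempty := by
    rintro O hO ⟨x, hxO, hxM⟩
    by_contra hcon
    push Not at hcon
    let U : Set X := ⋃₀ {N | PS B M N}
    have hUM : closure U ⊆ M := closure_minimal (sUnion_subset fun N h => h.2.2.1) hM.1.isClosed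
    have hUx : x ∉ closure U := by
      intro h
      obtain ⟨y, hy, N, hN, hyN⟩ := mem_closure_iff.1 h O hO hxO
      have := hcon N hN
      rw [eq_empty_iff_forall_notMem] at this
      exact this y ⟨hy, hyN⟩
    have hBU : B ⊆ closure U := (subset_sUnion_of_mem (t := B) hB).trans subset_closure
    have hPU : PS B M (closure U) := by
      refine ⟨⟨hM.1.of_isClosed_subset isClosed_closure hUM, ⟨b, hBU hb⟩, ?_⟩, hBU, hUM, fun h => hUx (h hxM)⟩
      apply IsPreconnected.closure
      exact isPreconnected_sUnion b _ (fun N h => h.2.1 hb) (fun N h => h.1.2.2)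
    have := pre_split hM.2.2 hDc.1.isClosed (isClosed_closure (s := U)) ?_ ?_
    · rcases this with h | h
      · exact disjoint_left.1 (hdisj B hB) (h (hB.2.2.1 hb)) hb
      · exact hUx (h hxM)
    · intro y hy
      by_cases hyD : y ∈ ⋂₀ S
      · exact Or.inl hyD
      · obtain ⟨N, h, hyN⟩ := hcov y hy hyD
        exact Or.inr (subset_closure ⟨N, h, hyN⟩)
    · intro y _ h1 h2
      exact disjoint_left.1 (hdisj _ hPU) h1 h2
  refine ⟨⋂₀ S, hDc, hDM, hdisj, hcov, hdense, hDc, hDM, ?_⟩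
  have ha : ∀ F N, IsSubcontinuum F → F ⊆ M → PS B M N → (F ∩ ⋂₀ S).Nonempty → (F ∩ N).Nonempty → M ⊆ F ∪ N := by
    rintro F N hF hFM hPN ⟨y, hyF, hyD⟩ ⟨x, hxF, hxN⟩
    by_contra hcon
    have : PS B M (F ∪ N) := ⟨cont_union hF hPN.1 hxF hxN, hPN.2.1.trans subset_union_right,
      union_subset hFM hPN.2.2.1, hcon⟩
    exact disjoint_left.1 (hdisj _ this) hyD (Or.inl hyF)
  intro F G hF hG hFM hGM hFD hGD hFn
  obtain ⟨f', hf', hf'D⟩ := not_subset.1 hFn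
  obtain ⟨N₁, hN₁, hfN₁⟩ := hcov f' (hFM hf') hf'D
  by_cases hGn : G ⊆ ⋂₀ S
  · right
    intro y hy
    exact (ha F N₁ hF hFM hN₁ hFD ⟨f', hf', hfN₁⟩ (hGM hy)).resolve_right
      (disjoint_left.1 (hdisj _ hN₁) (hGn hy))
  obtain ⟨g', hg', hg'D⟩ := not_subset.1 hGn
  obtain ⟨N₂, hN₂, hgN₂⟩ := hcov g' (hGM hg') hg'D
  obtain ⟨N, hPN, hfN, hgN⟩ : ∃ N, PS B M N ∧ f' ∈ N ∧ g' ∈ N := by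
    rcases hnest N₁ N₂ hN₁.1 hN₂.1 hN₁.2.1 hN₂.2.1 hN₁.2.2.1 hN₂.2.2.1 with h | h
    · exact ⟨N₂, hN₂, h hfN₁, hgN₂⟩
    · exact ⟨N₁, hN₁, hfN₁, h hgN₂⟩
  by_contra hcon
  rw [not_or] at hcon
  obtain ⟨f, hf, hfG⟩ := not_subset.1 hcon.1
  obtain ⟨g, hg, hgF⟩ := not_subset.1 hcon.2
  have hFN := ha F N hF hFM hPN hFD ⟨f', hf', hfN⟩
  have hGN := ha G N hG hGM hPN hGD ⟨g', hg', hgN⟩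
  have hfN' : f ∈ N := (hGN (hFM hf)).resolve_left hfG
  have hgN' : g ∈ N := (hFN (hGM hg)).resolve_left hgF
  obtain ⟨r, hr, hrN⟩ := not_subset.1 hPN.2.2.2
  have hRF : closure (M \ N) ⊆ F := closure_minimal (fun x hx => (hFN hx.1).resolve_right hx.2) hF.1.isClosed
  have hRG : closure (M \ N) ⊆ G := closure_minimal (fun x hx => (hGN hx.1).resolve_right hx.2) hG.1.isClosed
  have hrR : r ∈ closure (M \ N) := subset_closure ⟨hr, hrN⟩
  obtain ⟨z, hzR, hzN⟩ : ∃ z, z ∈ closure (M \ N) ∧ z ∈ N := by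
    by_contra hno
    push Not at hno
    have hcv : M ⊆ closure (M \ N) ∪ N := by
      intro x hx
      by_cases hxN : x ∈ N
      · exact Or.inr hxN
      · exact Or.inl (subset_closure ⟨hx, hxN⟩)
    rcases pre_split hM.2.2 (isClosed_closure (s := M \ N)) hPN.1.1.isClosed hcv (fun x _ h1 h2 => hno x h1 h2) with h | h
    · exact hno b (h (hB.2.2.1 hb)) (hPN.2.1 hb)
    · exact hrN (h hr)
  exact hN.tri (hN.inter hF hPN.1 (hFM.trans hMH) (hPN.2.2.1.trans hMH) (hRF hzR) hzN)
    (hN.inter hG hPN.1 (hGM.trans hMH) (hPN.2.2.1.trans hMH) (hRG hzR) hzN) (hR N hPN)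
    (inter_subset_left.trans (hFM.trans hMH)) (inter_subset_left.trans (hGM.trans hMH)) ((hRM N).trans hMH)
    (x := z) ⟨hRF hzR, hzN⟩ ⟨hRG hzR, hzN⟩ hzR (a := f) (b := g) (c := r)
    ⟨hf, hfN'⟩ (fun h => hfG h.1) (fun h => hfG (hRG h)) (fun h => hgF h.1) ⟨hg, hgN'⟩ (fun h => hgF (hRF h))
    (fun h => hrN h.2) (fun h => hrN h.2) hrR

theorem decomp_nest (hN : Nice H) {M A B : Set X} (hM : IsSubcontinuum M) (hMH : M ⊆ H)
    (hA : IsSubcontinuum A) (hB : IsSubcontinuum B) (hAM : A ⊂ M) (hBM : B ⊂ M) (hAB : A ∪ B = M) :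
    Nest B M := by
  intro F G hF hG hBF hBG hFM hGM
  by_contra hcon
  rw [not_or] at hcon
  obtain ⟨f, hf, hfG⟩ := not_subset.1 hcon.1
  obtain ⟨g, hg, hgF⟩ := not_subset.1 hcon.2
  obtain ⟨b, hb, hbA⟩ := not_subset.1 hAM.2
  obtain ⟨a, ha, haB⟩ := not_subset.1 hBM.2
  have hcov : ∀ x ∈ M, x ∈ A ∨ x ∈ B := fun x hx => by rw [← hAB] at hx; exact hx
  have hbB := (hcov b hb).resolve_left hbA
  have hfA := (hcov f (hFM hf)).resolve_right (fun h => hfG (hBG h))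
  have hgA := (hcov g (hGM hg)).resolve_right (fun h => hgF (hBF h))
  obtain ⟨z, hzA, hzB⟩ : ∃ z, z ∈ A ∧ z ∈ B := by
    by_contra hno
    push Not at hno
    rcases pre_split hM.2.2 hA.1.isClosed hB.1.isClosed hAB.ge (fun x _ h1 h2 => hno x h1 h2) with h | h
    · exact hbA (h hb)
    · exact haB (h ha)
  exact hN.tri (hN.inter hF hA (hFM.trans hMH) (hAM.1.trans hMH) (hBF hzB) hzA)
    (hN.inter hG hA (hGM.trans hMH) (hAM.1.trans hMH) (hBG hzB) hzA) hB
    (inter_subset_left.trans (hFM.trans hMH)) (inter_subset_left.trans (hGM.trans hMH)) (hBM.1.trans hMH)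
    (x := z) ⟨hBF hzB, hzA⟩ ⟨hBG hzB, hzA⟩ hzB (a := f) (b := g) (c := b)
    ⟨hf, hfA⟩ (fun h => hfG h.1) (fun h => hfG (hBG h)) (fun h => hgF h.1) ⟨hg, hgA⟩ (fun h => hgF (hBF h))
    (fun h => hbA h.2) (fun h => hbA h.2) hbB

theorem end1 (hN : Nice H) {M D₀ : Set X} (hMH : M ⊆ H) (hD : ST D₀ M) : ∃ p ∈ D₀, EndP p M := by
  obtain ⟨D, hDm⟩ := zorn_superset {D | ST D M ∧ D ⊆ D₀} (by
    intro c hc hch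
    rcases c.eq_empty_or_nonempty with rfl | hne
    · exact ⟨D₀, ⟨hD, le_rfl⟩, by simp⟩
    · obtain ⟨s0, hs0⟩ := hne
      refine ⟨⋂₀ c, ⟨⟨chain_inter ⟨s0, hs0⟩ hch fun s hs => (hc hs).1.1,
        (sInter_subset_of_mem hs0).trans (hc hs0).1.2.1, ?_⟩, (sInter_subset_of_mem hs0).trans (hc hs0).2⟩,
        fun s hs => sInter_subset_of_mem hs⟩
      intro F G hF hG hFM hGM hFD hGD hFn
      rw [subset_sInter_iff] at hFn
      push Not at hFn
      obtain ⟨s, hs, hFs⟩ := hFn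
      exact (hc hs).1.2.2 F G hF hG hFM hGM (hFD.mono (inter_subset_inter_right _ (sInter_subset_of_mem hs)))
        (hGD.mono (inter_subset_inter_right _ (sInter_subset_of_mem hs))) hFs)
  obtain ⟨⟨hDST, hDD⟩, hmin⟩ := hDm
  by_cases hnt : D.Nontrivial
  · exfalso
    have hDH := hDST.2.1.trans hMH
    obtain ⟨A, B, hA, hB, hAD, hBD, hAB⟩ := hN.dec D hDH hDST.1 hnt
    have hPB : PS B D B := ⟨hB, le_rfl, hBD.1, hBD.2⟩
    obtain ⟨D', h1, h2, h3, -, -, h4⟩ := lemD hN hDST.1 hDH (decomp_nest hN hDST.1 hDH hA hB hAD hBD hAB) hPB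
    have := hmin ⟨h4.trans hDST, h2.trans hDD⟩ h2
    obtain ⟨b, hb⟩ := hB.2.1
    exact disjoint_left.1 (h3 B hPB) (this (hBD.1 hb)) hb
  · rw [not_nontrivial_iff] at hnt
    obtain ⟨p, hp⟩ := hDST.1.2.1
    have : D = {p} := by
      ext x; constructor
      · intro hx; exact hnt hx hp
      · rintro rfl; exact hp
    subst this
    exact ⟨p, hDD rfl, hDST.endP⟩

theorem exists_end (hN : Nice H) {M : Set X} (hM : IsSubcontinuum M) (hMH : M ⊆ H) : ∃ p, EndP p M := by
  obtain ⟨p, -, hp⟩ := end1 hN hMH (D₀ := M) ⟨hM, le_rfl, fun F G _ _ h _ _ _ h' => absurd h h'⟩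
  exact ⟨p, hp⟩

theorem EndP.ps {a : X} {M : Set X} (h : EndP a M) (hnt : M.Nontrivial) : PS {a} M {a} :=
  ⟨cont_singleton a, le_rfl, by simpa using h.1, fun h' => (subsingleton_singleton.anti h').not_nontrivial hnt⟩

theorem end2 (hN : Nice H) {M : Set X} (hM : IsSubcontinuum M) (hMH : M ⊆ H) {a : X} (ha : EndP a M)
    (hnt : M.Nontrivial) : ∃ p, EndP p M ∧ p ≠ a ∧ ∀ N, IsSubcontinuum N → N ⊆ M → a ∈ N → p ∈ N → M ⊆ N := by
  obtain ⟨D, h1, h2, h3, -, -, h4⟩ := lemD hN hM hMH ha.2 (ha.ps hnt)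
  obtain ⟨p, hpD, hp⟩ := end1 hN hMH h4
  refine ⟨p, hp, ?_, ?_⟩
  · rintro rfl
    exact disjoint_left.1 (h3 _ (ha.ps hnt)) hpD rfl
  · intro N hNc hNM haN hpN
    by_contra hcon
    exact disjoint_left.1 (h3 N ⟨hNc, by simpa, hNM, hcon⟩) hpD hpN

end cls
end Bing

namespace Bing

section cp
variable {X : Type*} [MetricSpace X] {H : Set X}

theorem cut_aux (hN : Nice H) {K A' B' : Set X} (hK : IsSubcontinuum K) (hKH : K ⊆ H) {a q : X}
    (ha : EndP a K) (hq : EndP q K)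
    (irr : ∀ N, IsSubcontinuum N → N ⊆ K → a ∈ N → q ∈ N → K ⊆ N)
    (hA' : IsSubcontinuum A') (hB' : IsSubcontinuum B') (hAK : A' ⊂ K) (hBK : B' ⊂ K) (hAB : A' ∪ B' = K)
    (haA' : a ∈ A') :
    ∃ A B p, IsSubcontinuum A ∧ IsSubcontinuum B ∧ A ⊆ K ∧ B ⊆ K ∧ ¬ K ⊆ A ∧ ¬ K ⊆ B ∧ A ∪ B = K ∧
      EndP p A ∧ EndP p B := by
  have hqA' : q ∉ A' := fun h => hAK.2 (irr A' hA' hAK.1 haA' h)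
  have hcov : ∀ x ∈ K, x ∉ A' → x ∈ B' := fun x hx hx' => by rw [← hAB] at hx; exact hx.resolve_left hx'
  have haB' : a ∉ B' := fun h => hBK.2 (irr B' hB' hBK.1 h (hcov q hq.1 hqA'))
  have hB : IsSubcontinuum (closure (K \ A')) := connCompl hK hA' hAK.1 hAK.2 (by simpa using haA') ha.2
  have hBB' : closure (K \ A') ⊆ B' := closure_minimal (fun x hx => hcov x hx.1 hx.2) hB'.1.isClosed
  have hNB : K \ A' ⊆ closure (K \ A') := subset_closure
  set B := closure (K \ A') with hBdef
  have hBK1 : B ⊆ K := hBB'.trans hBK.1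
  have haB : a ∉ B := fun h => haB' (hBB' h)
  have hqB : q ∈ B := hNB ⟨hq.1, hqA'⟩
  have hBnt : B.Nontrivial := by
    by_contra hh
    rw [not_nontrivial_iff] at hh
    have hcv : K ⊆ A' ∪ {q} := by
      intro x hx
      by_cases hxA : x ∈ A'
      · exact Or.inl hxA
      · exact Or.inr (hh (hNB ⟨hx, hxA⟩) hqB)
    rcases pre_split hK.2.2 hA'.1.isClosed isClosed_singleton hcv
      (fun x _ h1 h2 => hqA' (by rw [← show x = q from h2]; exact h1)) with h | h
    · exact hqA' (h hq.1)
    · have : a = q := h ha.1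
      exact hqA' (this ▸ haA')
  have hqEB : EndP q B := hq.mono hBK1 hqB
  obtain ⟨DB, hDB1, hDB2, hDB3, hDB4, -, -⟩ := lemD hN hB (hBK1.trans hKH) hqEB.2 (hqEB.ps hBnt)
  have hR : IsSubcontinuum (closure (K \ B)) :=
    connCompl hK hB hBK1 (fun h => haB (h ha.1)) (by simpa using hqB) hq.2
  have haR : a ∈ closure (K \ B) := subset_closure ⟨ha.1, haB⟩
  have hRK : closure (K \ B) ⊆ K := closure_minimal sdiff_subset hK.1.isClosed
  have hRA' : closure (K \ B) ⊆ A' := closure_minimal (fun x hx => by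
    by_contra h; exact hx.2 (hNB ⟨hx.1, h⟩)) hA'.1.isClosed
  have hκ : ∀ N', PS {q} B N' → ∀ x ∈ N', x ∉ closure (K \ B) := by
    intro N' hN' x hx hxR
    have h1 := irr _ (cont_union hR hN'.1 hxR hx) (union_subset hRK (hN'.2.2.1.trans hBK1)) (Or.inl haR)
      (Or.inr (hN'.2.1 rfl))
    apply hN'.2.2.2
    refine closure_minimal ?_ hN'.1.1.isClosed
    rintro y ⟨hy, hyA⟩
    exact (h1 hy).resolve_left fun h => hyA (hRA' h)
  obtain ⟨z, hzR, hzB⟩ : ∃ z, z ∈ closure (K \ B) ∧ z ∈ B := by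
    by_contra hno
    push Not at hno
    have hcv : K ⊆ closure (K \ B) ∪ B := by
      intro x hx
      by_cases hxN : x ∈ B
      · exact Or.inr hxN
      · exact Or.inl (subset_closure ⟨hx, hxN⟩)
    rcases pre_split hK.2.2 (isClosed_closure (s := K \ B)) hB.1.isClosed hcv (fun x _ h1 h2 => hno x h1 h2) with h | h
    · exact hno q (h hq.1) hqB
    · exact haB (h ha.1)
  have hzD : z ∈ DB := by
    by_contra hz
    obtain ⟨N', h1, h2⟩ := hDB4 z hzB hz
    exact hκ N' h1 z h2 hzR
  have hA : IsSubcontinuum (closure (K \ B) ∪ DB) := cont_union hR hDB1 hzR hzD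
  have hDA : DB ⊆ closure (K \ B) ∪ DB := subset_union_right
  have haA : a ∈ closure (K \ B) ∪ DB := Or.inl haR
  have hAK2 : closure (K \ B) ∪ DB ⊆ K := union_subset hRK (hDB2.trans hBK1)
  have hg : ∀ g ∈ K, g ∉ closure (K \ B) ∪ DB → ∃ N, IsSubcontinuum N ∧ N ⊆ K ∧ q ∈ N ∧ g ∈ N ∧
      ∀ x ∈ N, x ∉ closure (K \ B) ∪ DB := by
    intro g hg hgA
    rw [mem_union, not_or] at hgA
    have hgB : g ∈ B := by
      by_contra h
      exact hgA.1 (subset_closure ⟨hg, h⟩)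
    obtain ⟨N', h1, h2⟩ := hDB4 g hgB hgA.2
    refine ⟨N', h1.1, h1.2.2.1.trans hBK1, h1.2.1 rfl, h2, ?_⟩
    rintro x hx (h | h)
    · exact hκ N' h1 x hx h
    · exact disjoint_left.1 (hDB3 N' h1) h hx
  have hqA : q ∉ closure (K \ B) ∪ DB := by
    rintro (h | h)
    · exact hκ _ (hqEB.ps hBnt) q rfl h
    · exact disjoint_left.1 (hDB3 _ (hqEB.ps hBnt)) h rfl
  generalize closure (K \ B) ∪ DB = A at hA hDA haA hAK2 hg hqA
  have hAnt : A.Nontrivial := ⟨a, haA, z, hDA hzD, fun h => haB (h ▸ hzB)⟩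
  obtain ⟨p, hpA, -, irrA⟩ := end2 hN hA (hAK2.trans hKH) (ha.mono hAK2 haA) hAnt
  have hKnt : K.Nontrivial := hAnt.mono hAK2
  have hpK : p ∈ K := hAK2 hpA.1
  let S : Set (Set X) := {F | IsSubcontinuum F ∧ F ⊆ K ∧ q ∈ F ∧ p ∈ F}
  have hKS : K ∈ S := ⟨hK, le_rfl, hq.1, hpK⟩
  have hBp : IsSubcontinuum (⋂₀ S) := chain_inter ⟨K, hKS⟩
    (fun F hF G hG _ => hq.nest hF.1 hG.1 hF.2.2.1 hG.2.2.1 hF.2.1 hG.2.1) (fun F hF => hF.1)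
  have hBpK : ⋂₀ S ⊆ K := sInter_subset_of_mem hKS
  have hqBp : q ∈ ⋂₀ S := fun F hF => hF.2.2.1
  have hpBp : p ∈ ⋂₀ S := fun F hF => hF.2.2.2
  have haBp : a ∉ ⋂₀ S := by
    obtain ⟨DK, hDK1, hDK2, hDK3, hDK4, -, -⟩ := lemD hN hK hKH hq.2 (hq.ps hKnt)
    have haPS : ∀ N', PS {q} K N' → a ∉ N' := fun N' h h' => h.2.2.2 (irr N' h.1 h.2.2.1 h' (h.2.1 rfl))
    have haD : a ∈ DK := by
      by_contra h
      obtain ⟨N', h1, h2⟩ := hDK4 a ha.1 h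
      exact haPS N' h1 h2
    by_cases hpD : p ∈ DK
    · exfalso
      have := irrA _ (hN.inter hDK1 hA (hDK2.trans hKH) (hAK2.trans hKH) haD haA) inter_subset_right ⟨haD, haA⟩
        ⟨hpD, hpA.1⟩
      exact disjoint_left.1 (hDK3 B ⟨hB, by simpa using hqB, hBK1, fun h => haB (h ha.1)⟩) (this (hDA hzD)).1 hzB
    · obtain ⟨N', h1, h2⟩ := hDK4 p hpK hpD
      exact fun h => haPS N' h1 (h N' ⟨h1.1, h1.2.2.1, h1.2.1 rfl, h2⟩)
  have aux : ∀ F G : Set X, IsSubcontinuum F → IsSubcontinuum G → p ∈ F → p ∈ G → F ⊆ ⋂₀ S → G ⊆ ⋂₀ S →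
      ∀ f g, f ∈ F → f ∉ G → g ∈ G → g ∉ F → f ∈ A → False := by
    intro F G hF hG hpF hpG hFB hGB f g hf hfG hgG hgF hfA
    have hFH := hFB.trans (hBpK.trans hKH)
    have hGH := hGB.trans (hBpK.trans hKH)
    have hgA : g ∉ A := by
      intro hgA
      rcases hpA.nest (hN.inter hF hA hFH (hAK2.trans hKH) hpF hpA.1) (hN.inter hG hA hGH (hAK2.trans hKH) hpG hpA.1)
        ⟨hpF, hpA.1⟩ ⟨hpG, hpA.1⟩ inter_subset_right inter_subset_right with h | h
      · exact hfG (h ⟨hf, hfA⟩).1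
      · exact hgF (h ⟨hgG, hgA⟩).1
    obtain ⟨N, h1, h2, h3, h4, h5⟩ := hg g (hBpK (hGB hgG)) hgA
    have hmem : N ∪ G ∈ S := ⟨cont_union h1 hG h4 hgG, union_subset h2 (hGB.trans hBpK), Or.inl h3, Or.inr hpG⟩
    rcases hFB hf _ hmem with h | h
    · exact h5 f h hfA
    · exact hfG h
  refine ⟨A, ⋂₀ S, p, hA, hBp, hAK2, hBpK, fun h => hqA (h hq.1), fun h => haBp (h ha.1), ?_, hpA, hpBp, ?_⟩
  · exact (union_subset hAK2 hBpK).antisymm (irr _ (cont_union hA hBp hpA.1 hpBp) (union_subset hAK2 hBpK)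
      (Or.inl haA) (Or.inr hqBp))
  · intro F G hF hG hpF hpG hFB hGB
    by_contra hcon
    rw [not_or] at hcon
    obtain ⟨f, hf, hfG⟩ := not_subset.1 hcon.1
    obtain ⟨g, hg, hgF⟩ := not_subset.1 hcon.2
    have hpF := hpF rfl
    have hpG := hpG rfl
    by_cases hfA : f ∈ A
    · exact aux F G hF hG hpF hpG hFB hGB f g hf hfG hg hgF hfA
    by_cases hgA : g ∈ A
    · exact aux G F hG hF hpG hpF hGB hFB g f hg hgF hf hfG hgA
    exact hN.tri hF hG hA (hFB.trans (hBpK.trans hKH)) (hGB.trans (hBpK.trans hKH)) (hAK2.trans hKH)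
      hpF hpG hpA.1 hf hfG hfA hgF hg hgA (fun h => haBp (hFB h)) (fun h => haBp (hGB h)) haA

theorem cutPoint (hN : Nice H) {K : Set X} (hK : IsSubcontinuum K) (hKH : K ⊆ H) (hnt : K.Nontrivial) :
    ∃ A B p, IsSubcontinuum A ∧ IsSubcontinuum B ∧ A ⊆ K ∧ B ⊆ K ∧ ¬ K ⊆ A ∧ ¬ K ⊆ B ∧ A ∪ B = K ∧
      EndP p A ∧ EndP p B := by
  obtain ⟨a, ha⟩ := exists_end hN hK hKH
  obtain ⟨q, hq, -, irr⟩ := end2 hN hK hKH ha hnt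
  obtain ⟨A', B', h1, h2, h3, h4, h5⟩ := hN.dec K hKH hK hnt
  have : a ∈ A' ∪ B' := h5 ▸ ha.1
  rcases this with h | h
  · exact cut_aux hN hK hKH ha hq irr h1 h2 h3 h4 h5 h
  · exact cut_aux hN hK hKH ha hq irr h2 h1 h4 h3 (by rwa [union_comm]) h

end cp
end Bing

namespace Bing

section fl
variable {X : Type*} [MetricSpace X] {H : Set X}

def sm (g : X → ℝ) (δ : ℝ) (s : Set X) : Prop := ∀ x ∈ s, ∀ y ∈ s, |g x - g y| < δ

theorem sm_mono (g : X → ℝ) (δ : ℝ) : ∀ s t : Set X, s ⊆ t → sm g δ t → sm g δ s :=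
  fun _ _ h ht x hx y hy => ht x (h hx) y (h hy)

def Chn (g : X → ℝ) (δ : ℝ) (L D : Set X) (p : X) : Prop :=
  ∃ n d, WC L D (sm g δ) n d ∧ 0 < n ∧ p ∈ d 0 ∧ ∀ i, 1 ≤ i → i < n → p ∉ d i

theorem Chn.norm {g : X → ℝ} {δ : ℝ} {L : Set X} {p : X} (hp : p ∈ L) (h : Chn g δ L L p) : Chn g δ L univ p := by
  obtain ⟨n, d, h1, h2, h3, h4⟩ := h
  obtain ⟨d', h5, h6⟩ := normalize (sm_mono g δ) h1
  exact ⟨n, d', h5, h2, (h6 0).2 ⟨hp, h3⟩, fun i hi hi' hpi => h4 i hi hi' ((h6 i).1 hpi)⟩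

theorem Chn.weak {g : X → ℝ} {δ δ' : ℝ} (hδ : δ ≤ δ') {L D : Set X} {p : X} (h : Chn g δ L D p) : Chn g δ' L D p := by
  obtain ⟨n, d, ⟨a1, a2, a3, a4⟩, h2, h3, h4⟩ := h
  exact ⟨n, d, ⟨a1, a2, fun i hi x hx y hy => (a3 i hi x hx y hy).trans_le hδ, a4⟩, h2, h3, h4⟩

theorem Ioo_abs {a b δ : ℝ} (h : b - a ≤ δ) : sm (fun x : ℝ => x) δ (Ioo a b) := by
  intro x hx y hy
  rw [abs_lt]; constructor <;> linarith [hx.1, hx.2, hy.1, hy.2]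

theorem single {L D : Set X} {P : Set X → Prop} {U : Set X} (hU : IsOpen U) (h : P U) (hL : L ⊆ U) :
    WC L D P 1 (fun _ => U) :=
  ⟨fun _ => hU, fun x hx => ⟨0, by omega, hL hx⟩, fun _ _ => h, fun i j h1 h2 => by omega⟩

theorem WC.mono {L L' D : Set X} {P : Set X → Prop} {n : ℕ} {d : ℕ → Set X} (h : WC L D P n d) (hL : L' ⊆ L) :
    WC L' D P n d := ⟨h.1, fun x hx => h.2.1 x (hL hx), h.2.2.1, h.2.2.2⟩

theorem grid {s τ : ℝ} (hτ : 0 < τ) (k : ℕ) : ∀ u : ℝ, u ≤ s + 3 * τ + k * τ → ∃ n I,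
    WC (Ioo (s - τ) u) univ (sm (fun x : ℝ => x) (4 * τ)) n I ∧ 0 < n ∧ (∀ i < n, I i ⊆ Iio u) ∧
    (∀ i, 1 ≤ i → i < n → I i ⊆ Iio (u - τ)) ∧ (∀ i, i + 1 < n → I i ⊆ Ioi (s + τ)) := by
  have base : ∀ u : ℝ, u ≤ s + 3 * τ → ∃ n I,
    WC (Ioo (s - τ) u) univ (sm (fun x : ℝ => x) (4 * τ)) n I ∧ 0 < n ∧ (∀ i < n, I i ⊆ Iio u) ∧
    (∀ i, 1 ≤ i → i < n → I i ⊆ Iio (u - τ)) ∧ (∀ i, i + 1 < n → I i ⊆ Ioi (s + τ)) := by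
    intro u hu
    exact ⟨1, _, single isOpen_Ioo (Ioo_abs (by linarith)) le_rfl, by omega, fun _ _ x hx => hx.2,
      fun i h1 h2 => by omega, fun i h => by omega⟩
  induction k with
  | zero => intro u hu; exact base u (by simpa using hu)
  | succ k ih =>
    intro u hu
    by_cases hc : u ≤ s + 3 * τ
    · exact base u hc
    push Not at hc
    obtain ⟨n, I, h1, h2, h3, h4, h5⟩ := ih (u - τ) (by push_cast at hu; linarith)
    have hs : WC (Ioo (u - 2 * τ) u) univ (sm (fun x : ℝ => x) (4 * τ)) 1 (fun _ => Ioo (u - 2 * τ) u) :=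
      single isOpen_Ioo (Ioo_abs (by linarith)) le_rfl
    have hcc := concat hs h1 (by
      intro i hi j hj x _ hxi hxj
      refine ⟨by omega, ?_⟩
      by_contra hj0
      have := h4 j (by omega) hj hxj
      have := hxi.1
      simp only [mem_Iio] at *
      linarith)
    refine ⟨_, _, hcc.mono ?_, by omega, ?_, ?_, ?_⟩
    · intro x hx
      by_cases h : u - 2 * τ < x
      · exact Or.inl ⟨h, hx.2⟩
      · exact Or.inr ⟨hx.1, by linarith⟩
    · intro i hi x hx
      try dsimp only at hx
      split_ifs at hx with c
      · exact hx.2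
      · have := h3 _ (by omega) hx
        simp only [mem_Iio] at *
        linarith
    · intro i h1 h2 x hx
      try dsimp only at hx
      rw [if_neg (by omega)] at hx
      exact h3 _ (by omega) hx
    · intro i hi x hx
      try dsimp only at hx
      split_ifs at hx with c
      · simp only [mem_Ioi]; linarith [hx.1]
      · exact h5 _ (by omega) hx

theorem grid2 {s τ m δ₁ : ℝ} (hτ : 0 < τ) (hδ : 0 < δ₁) : ∃ n I,
    WC (Ioo (s - τ) (m + τ)) univ (sm (fun x : ℝ => x) (δ₁ + 7 * τ)) n I ∧ 0 < n ∧
    (∀ i, 1 ≤ i → i < n → I i ⊆ Iio (m - 2 * τ - δ₁)) ∧ (∀ i, i + 1 < n → I i ⊆ Ioi (s + τ)) := by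
  by_cases hc : m - 2 * τ - δ₁ - τ < s + τ
  · exact ⟨1, _, single isOpen_Ioo (Ioo_abs (by linarith)) le_rfl, by omega,
      fun i h1 h2 => by omega, fun i h => by omega⟩
  push Not at hc
  obtain ⟨k, hk⟩ := exists_nat_ge ((m - 2 * τ - δ₁ - s) / τ)
  rw [div_le_iff₀ hτ] at hk
  obtain ⟨n, I, h1, h2, h3, h4, h5⟩ := grid (s := s) hτ k (m - 2 * τ - δ₁) (by linarith)
  have h1' : WC (Ioo (s - τ) (m - 2 * τ - δ₁)) univ (sm (fun x : ℝ => x) (δ₁ + 7 * τ)) n I :=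
    ⟨h1.1, h1.2.1, fun i hi x hx y hy => (h1.2.2.1 i hi x hx y hy).trans_le (by linarith), h1.2.2.2⟩
  have hs : WC (Ioo (m - 2 * τ - δ₁ - τ) (m + τ)) univ (sm (fun x : ℝ => x) (δ₁ + 7 * τ)) 1
      (fun _ => Ioo (m - 2 * τ - δ₁ - τ) (m + τ)) :=
    single isOpen_Ioo (Ioo_abs (by linarith)) le_rfl
  have hcc := concat hs h1' (by
      intro i hi j hj x _ hxi hxj
      refine ⟨by omega, ?_⟩
      by_contra hj0
      have := h4 j (by omega) hj hxj
      have := hxi.1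
      simp only [mem_Iio] at *
      linarith)
  refine ⟨_, _, hcc.mono ?_, by omega, ?_, ?_⟩
  · intro x hx
    by_cases h : m - 2 * τ - δ₁ - τ < x
    · exact Or.inl ⟨h, hx.2⟩
    · exact Or.inr ⟨hx.1, by linarith⟩
  · intro i h1 h2 x hx
    try dsimp only at hx
    rw [if_neg (by omega)] at hx
    exact h3 _ (by omega) hx
  · intro i hi x hx
    try dsimp only at hx
    split_ifs at hx with c
    · simp only [mem_Ioi]; linarith [hx.1]
    · exact h5 _ (by omega) hx

theorem gridJ {s τ A0 δ' b : ℝ} (hτ : 0 < τ) (hA : A0 < s) (hδ : s + 2 * τ - A0 ≤ δ') : ∃ n J,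
    WC (Ioc A0 b) univ (sm (fun x : ℝ => x) δ') n J ∧ 0 < n ∧ Ioc A0 s ⊆ J 0 ∧
    (∀ i, 1 ≤ i → i < n → J i ⊆ Ioi (s + τ)) := by
  obtain ⟨k, hk⟩ := exists_nat_ge ((b - s) / τ)
  rw [div_le_iff₀ hτ] at hk
  refine ⟨k + 1, fun u => Ioo (if u = 0 then A0 else s + u * τ) (s + (u + 2) * τ), ⟨fun i => isOpen_Ioo, ?_, ?_, ?_⟩,
    by omega, ?_, ?_⟩
  · have : ∀ k : ℕ, ∀ x : ℝ, A0 < x → x ≤ s + k * τ → ∃ i < k + 1,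
        x ∈ Ioo (if i = 0 then A0 else s + i * τ) (s + ((i : ℝ) + 2) * τ) := by
      intro k
      induction k with
      | zero => intro x h1 h2; refine ⟨0, by omega, ?_⟩; simp at h2 ⊢; exact ⟨h1, by linarith⟩
      | succ k ih =>
        intro x h1 h2
        by_cases hc : x ≤ s + k * τ
        · obtain ⟨i, hi, hx⟩ := ih x h1 hc
          exact ⟨i, by omega, hx⟩
        · push Not at hc
          refine ⟨k, by omega, ?_, ?_⟩
          · split_ifs <;> linarith
          · push_cast at h2; nlinarith
    intro x hx
    exact this k x hx.1 (by linarith [hx.2])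
  · intro i _
    apply Ioo_abs
    split_ifs with h
    · simp [h]; linarith
    · nlinarith
  · intro i j hij hj x _ hxi hxj
    have e1 := hxi.2
    have e2 := hxj.1
    rw [if_neg (by omega)] at e2
    have : ((i : ℝ) + 2) ≤ j := by exact_mod_cast hij
    nlinarith
  · intro x hx
    simp only [mem_Ioo, if_true]
    exact ⟨hx.1, by push_cast; linarith [hx.2]⟩
  · intro i hi _ x hx
    have e2 := hx.1
    rw [if_neg (by omega)] at e2
    have : (1 : ℝ) ≤ i := by exact_mod_cast hi
    simp only [mem_Ioi]; nlinarith

theorem least {L : Set X} {p : X} (hL : IsSubcontinuum L) (hp : EndP p L) {C : Set X} (hC : IsClosed C)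
    (hne : (L ∩ C).Nonempty) : ∃ N, IsSubcontinuum N ∧ N ⊆ L ∧ p ∈ N ∧ (∃ x ∈ N, x ∈ C) ∧
      ∀ F, IsSubcontinuum F → F ⊆ L → p ∈ F → (F ∩ C).Nonempty → N ⊆ F := by
  let S : Set (Set X) := {F | IsSubcontinuum F ∧ F ⊆ L ∧ p ∈ F ∧ (F ∩ C).Nonempty}
  have hLS : L ∈ S := ⟨hL, le_rfl, hp.1, hne⟩
  have hch : IsChain (· ⊆ ·) S := fun F hF G hG _ => hp.nest hF.1 hG.1 hF.2.2.1 hG.2.2.1 hF.2.1 hG.2.1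
  refine ⟨⋂₀ S, chain_inter ⟨L, hLS⟩ hch (fun F hF => hF.1), sInter_subset_of_mem hLS, fun F hF => hF.2.2.1, ?_,
    fun F h1 h2 h3 h4 => sInter_subset_of_mem (show F ∈ S from ⟨h1, h2, h3, h4⟩)⟩
  by_contra hcon
  push Not at hcon
  obtain ⟨F, hF, hF'⟩ := chain_subset_open ⟨L, hLS⟩ hch (fun F hF => hF.1.1) hC.isOpen_compl hcon
  obtain ⟨x, hx, hxC⟩ := hF.2.2.2
  exact hF' hx hxC

theorem preimWC {g : X → ℝ} (hg : Continuous g) {L' D U : Set X} {R : Set ℝ} {δ : ℝ} {n : ℕ} {I : ℕ → Set ℝ}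
    (h : WC R univ (sm (fun x : ℝ => x) δ) n I) (hU : IsOpen U) (hL : L' ⊆ U) (hR : ∀ x ∈ L', g x ∈ R) :
    WC L' D (sm g δ) n (fun i => U ∩ g ⁻¹' (I i)) := by
  refine ⟨fun i => hU.inter ((h.1 i).preimage hg), ?_, ?_, ?_⟩
  · intro x hx
    obtain ⟨i, hi, hxi⟩ := h.2.1 _ (hR x hx)
    exact ⟨i, hi, hL hx, hxi⟩
  · intro i hi x hx y hy
    exact h.2.2.1 i hi _ hx.2 _ hy.2
  · intro i j hij hj x _ hxi hxj
    exact h.2.2.2 i j hij hj _ trivial hxi.2 hxj.2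

theorem fl_mid {g : X → ℝ} (hg : Continuous g) {L N : Set X} {p a : X} {s τ m A0 δ₁ : ℝ}
    (hτ : 0 < τ) (hδ : 0 < δ₁) (hA : A0 < s) (hJ : s + 2 * τ - A0 ≤ δ₁ + 7 * τ)
    (hL : IsSubcontinuum L) (hp : EndP p L) (hLA : ∀ x ∈ L, A0 < g x)
    (hN : IsSubcontinuum N) (hNL : N ⊆ L) (hpN : p ∈ N) (haN : a ∈ N) (hNs : ∀ x ∈ N, s ≤ g x)
    (hNm : ∀ x ∈ N, g x ≤ m) (ha : g a = s)
    {i : ℕ} {e : ℕ → Set X} {U Pb Le : Set X}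
    (he : WC Le L (sm g (δ₁ + 7 * τ)) i e) (hU : IsOpen U) (hPb : IsClosed Pb)
    (hcov : ∀ x ∈ L, x ∈ U ∨ x ∈ Le)
    (heU : ∀ l < i, ∀ x ∈ L, x ∈ e l → x ∈ U → l + 1 = i ∧ m - 2 * τ - δ₁ < g x)
    (haP : a ∉ Pb) (heP : ∀ l < i, ∀ x ∈ L, x ∈ e l → x ∈ Pb) (hpP : p ∈ Pb)
    (hpp : (i = 0 ∧ p ∈ U ∧ m - 2 * τ - δ₁ < g p) ∨
      (0 < i ∧ p ∈ e 0 ∧ p ∉ U ∧ ∀ l, 1 ≤ l → l < i → p ∉ e l)) :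
    Chn g (δ₁ + 7 * τ) L univ p := by
  have hsm : s ≤ m := by rw [← ha]; exact hNm a haN
  let W : Set X := {x | |g x - s| < τ} ∩ Pbᶜ
  have hW : IsOpen W := (isOpen_lt (by fun_prop) continuous_const).inter hPb.isOpen_compl
  have haW : a ∈ W := ⟨by simp [ha, hτ], haP⟩
  have hpW : p ∉ W := fun h => h.2 hpP
  have hY : IsCompact (L \ W) := hL.1.diff hW
  obtain ⟨P', Q', hP', hQ', hPQ, hPQY, hpP', hTQ⟩ := sep (Y := L \ W) (S := {p})
    (T := (L \ W) ∩ (g ⁻¹' Ioo (s - τ) (m + τ))ᶜ) hY isClosed_singleton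
    (hY.isClosed.inter (isOpen_Ioo.preimage hg).isClosed_compl) (by simpa using ⟨hp.1, hpW⟩) inter_subset_left (by
      intro C hC hCp x hx y hy hxp hyT
      rw [mem_singleton_iff] at hxp; subst hxp
      have hCY : closure C ⊆ L \ W := closure_minimal hC hY.isClosed
      have hcC : IsSubcontinuum (closure C) := ⟨hY.of_isClosed_subset isClosed_closure hCY, ⟨x, subset_closure hx⟩,
        hCp.closure⟩
      rcases hp.nest hcC hN (subset_closure hx) hpN (hCY.trans sdiff_subset) hNL with h | h
      · have hyN := h (subset_closure hy)
        exact hyT.2 ⟨by linarith [hNs y hyN], by linarith [hNm y hyN]⟩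
      · exact (hCY (h haN)).2 haW)
  have hpP'1 : p ∈ P' := hpP' rfl
  have hpQ' : p ∉ Q' := disjoint_left.1 hPQ hpP'1
  have hP'g : ∀ x ∈ P', g x ∈ Ioo (s - τ) (m + τ) := by
    intro x hx
    by_contra h
    exact disjoint_left.1 hPQ hx (hTQ ⟨hPQY ▸ Or.inl hx, h⟩)
  have hLW : ∀ x ∈ L, x ∉ P' → x ∉ Q' → x ∈ W := by
    intro x hx h1 h2
    by_contra h
    have : x ∈ P' ∪ Q' := hPQY ▸ ⟨hx, h⟩
    exact this.elim h1 h2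
  obtain ⟨b, hb⟩ : ∃ b, ∀ x ∈ L, g x ≤ b := by
    obtain ⟨b, hb⟩ := (hL.1.image hg).bddAbove
    exact ⟨b, fun x hx => hb ⟨x, hx, rfl⟩⟩
  obtain ⟨nf, I, hI, hnf, hI1, hI2⟩ := grid2 (s := s) (m := m) hτ hδ
  obtain ⟨nr, J, hJc, hnr, hJ0, hJ1⟩ := gridJ (b := b) hτ hA hJ
  have cf : WC (L ∩ U ∩ Q'ᶜ ∩ (g ⁻¹' Ioo (s - τ) (m + τ))) L (sm g (δ₁ + 7 * τ)) nf
      (fun t => (U ∩ Q'ᶜ) ∩ g ⁻¹' (I t)) :=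
    preimWC hg hI (hU.inter hQ'.isOpen_compl) (fun x hx => ⟨hx.1.1.2, hx.1.2⟩) (fun x hx => hx.2)
  have cr : WC (L ∩ P'ᶜ) L (sm g (δ₁ + 7 * τ)) nr (fun t => P'ᶜ ∩ g ⁻¹' (J t)) :=
    preimWC hg hJc hP'.isOpen_compl (fun x hx => hx.2) (fun x hx => ⟨hLA x hx.1, hb x hx.1⟩)
  have ce : WC (Le ∩ Q'ᶜ) L (sm g (δ₁ + 7 * τ)) i (fun t => e t ∩ Q'ᶜ) := by
    refine ⟨fun t => (he.1 t).inter hQ'.isOpen_compl, ?_, ?_, ?_⟩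
    · rintro x ⟨hx, hx'⟩
      obtain ⟨l, hl, hxl⟩ := he.2.1 x hx
      exact ⟨l, hl, hxl, hx'⟩
    · intro l hl; exact sm_mono _ _ _ _ inter_subset_left (he.2.2.1 l hl)
    · intro l l' h1 h2 x hx h3 h4; exact he.2.2.2 l l' h1 h2 x hx h3.1 h4.1
  have cef := concat ce cf (by
    rintro l hl t ht x hx ⟨hxl, -⟩ ⟨⟨hxU, -⟩, hxI⟩
    obtain ⟨e1, e2⟩ := heU l hl x hx hxl hxU
    refine ⟨e1, ?_⟩
    by_contra h0
    have := hI1 t (by omega) ht hxI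
    simp only [mem_Iio] at this
    linarith)
  have cefr := concat cef cr (by
    rintro l hl u hu x hx hxl ⟨hxP', hxJ⟩
    try dsimp only at hxl
    split_ifs at hxl with c
    · exact ((hLW x hx hxP' hxl.2).2 (heP l c x hx hxl.1)).elim
    · have hxW := (hLW x hx hxP' hxl.1.2).1
      have hxW := abs_lt.1 (show |g x - s| < τ from hxW)
      constructor
      · by_contra h0
        have := hI2 (l - i) (by omega) hxl.2
        simp only [mem_Ioi] at this
        linarith
      · by_contra h0
        have := hJ1 u (by omega) hu hxJ
        simp only [mem_Ioi] at this
        linarith)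
  refine Chn.norm hp.1 ⟨_, _, cefr.mono ?_, by omega, ?_, ?_⟩
  · intro x hx
    by_cases hxP' : x ∈ P'
    · have hxQ' := disjoint_left.1 hPQ hxP'
      left
      rcases hcov x hx with h | h
      · exact Or.inr ⟨⟨⟨hx, h⟩, hxQ'⟩, hP'g x hxP'⟩
      · exact Or.inl ⟨h, hxQ'⟩
    · exact Or.inr ⟨hx, hxP'⟩
  · try dsimp only
    rw [if_pos (by omega)]
    rcases hpp with ⟨rfl, hpU, hpv⟩ | ⟨hi, hpe, -⟩
    · rw [if_neg (by omega)]
      refine ⟨⟨hpU, hpQ'⟩, ?_⟩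
      obtain ⟨t, ht, hpt⟩ := hI.2.1 _ (hP'g p hpP'1)
      rcases Nat.eq_zero_or_pos t with h | h
      · subst h; exact hpt
      · have := hI1 t h ht hpt
        simp only [mem_Iio] at this
        linarith
    · rw [if_pos hi]
      exact ⟨hpe, hpQ'⟩
  · intro t ht1 ht2 hpt
    try dsimp only at hpt
    split_ifs at hpt with c1 c2
    · rcases hpp with ⟨rfl, -⟩ | ⟨hi, -, -, hpe⟩
      · omega
      · exact hpe t ht1 c2 hpt.1
    · rcases hpp with ⟨rfl, hpU, hpv⟩ | ⟨hi, -, hpU, -⟩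
      · have := hI1 _ (by omega) (by omega) hpt.2
        simp only [mem_Iio] at this
        linarith
      · exact hpU hpt.1.1
    · exact hpt.1 hpP'1

end fl
end Bing

namespace Bing

section fl
variable {X : Type*} [MetricSpace X] {H : Set X}

theorem small_nhd {O : Set X} (hO : IsOpen O) {y : X} (hy : y ∈ O) : ∃ W, IsOpen W ∧ y ∈ W ∧ closure W ⊆ O := by
  obtain ⟨r, hr, h⟩ := Metric.nhds_basis_closedBall.mem_iff.1 (hO.mem_nhds hy)
  exact ⟨ball y r, isOpen_ball, mem_ball_self hr, closure_ball_subset_closedBall.trans h⟩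

theorem fl_core (hH : Nice H) {g : X → ℝ} (hg : Continuous g) {L : Set X} {p : X} {s τ A0 δ₁ : ℝ}
    (hτ : 0 < τ) (hδ : 0 < δ₁) (hA : A0 < s) (hJ : s + 2 * τ - A0 ≤ δ₁ + 7 * τ)
    (hL : IsSubcontinuum L) (hLH : L ⊆ H) (hp : EndP p L) (hLA : ∀ x ∈ L, A0 < g x)
    (hgood : ∀ N, IsSubcontinuum N → N ⊆ L → p ∈ N → (∀ x ∈ N, s ≤ g x) → Chn g δ₁ N univ p) :
    Chn g (δ₁ + 7 * τ) L univ p := by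
  by_cases c1 : ∀ x ∈ L, s ≤ g x
  · exact (hgood L hL le_rfl hp.1 c1).weak (by linarith)
  push Not at c1
  obtain ⟨x0, hx0, hx0s⟩ := c1
  by_cases c2 : g p ≤ s
  · obtain ⟨b, hb⟩ : ∃ b, ∀ x ∈ L, g x ≤ b := by
      obtain ⟨b, hb⟩ := (hL.1.image hg).bddAbove
      exact ⟨b, fun x hx => hb ⟨x, hx, rfl⟩⟩
    obtain ⟨nr, J, hJc, hnr, hJ0, hJ1⟩ := gridJ (b := b) hτ hA hJ
    refine ⟨nr, _, preimWC hg hJc isOpen_univ (subset_univ L) (fun x hx => ⟨hLA x hx, hb x hx⟩), hnr,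
      ⟨trivial, hJ0 ⟨hLA p hp.1, c2⟩⟩, ?_⟩
    intro i h1 h2 hpi
    have := hJ1 i h1 h2 hpi.2
    simp only [mem_Ioi] at this
    linarith
  push Not at c2
  obtain ⟨N, hN, hNL, hpN, ⟨a, haN, has⟩, hNmin⟩ := least hL hp (C := {x | g x ≤ s})
    (isClosed_le hg continuous_const) ⟨x0, hx0, hx0s.le⟩
  replace has : g a ≤ s := has
  have hap : a ≠ p := by rintro rfl; linarith
  have hNp : EndP p N := hp.mono hNL hpN
  have hNnt : N.Nontrivial := ⟨a, haN, p, hpN, hap⟩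
  obtain ⟨-, -, -, -, -, hdense, -⟩ := lemD hH hN (hNL.trans hLH) hNp.2 (hNp.ps hNnt)
  have hprop : ∀ F, PS {p} N F → ∀ x ∈ F, s < g x := by
    intro F hF x hx
    by_contra h
    push Not at h
    exact hF.2.2.2 (hNmin F hF.1 (hF.2.2.1.trans hNL) (hF.2.1 rfl) ⟨x, hx, h⟩)
  have hNs : ∀ x ∈ N, s ≤ g x := by
    intro x hx
    by_contra h
    push Not at h
    obtain ⟨F, hF, y, hy, hyF⟩ := hdense {x | g x < s} (isOpen_lt hg continuous_const) ⟨x, h, hx⟩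
    exact absurd (hprop F hF y hyF) (not_lt.2 (le_of_lt hy))
  have hga : g a = s := le_antisymm has (hNs a haN)
  obtain ⟨xm, hxm, hmax⟩ := hN.1.exists_isMaxOn hN.2.1 hg.continuousOn
  have hNm : ∀ x ∈ N, g x ≤ g xm := fun x hx => hmax hx
  set m := g xm with hm
  by_cases c3 : m - τ ≤ g p
  · exact fl_mid hg hτ hδ hA hJ hL hp hLA hN hNL hpN haN hNs hNm hga (i := 0) (e := fun _ => ∅) (U := univ)
      (Pb := {p}) (Le := ∅) ⟨fun _ => isOpen_empty, by simp, by omega, by omega⟩ isOpen_univ isClosed_singleton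
      (fun x _ => Or.inl trivial) (by omega) (by simpa using hap) (by omega) rfl
      (Or.inl ⟨rfl, trivial, by linarith⟩)
  push Not at c3
  obtain ⟨F, hF, xF, hxF, hxFF⟩ := hdense {x | m - τ < g x} (isOpen_lt continuous_const hg)
    ⟨xm, by simp only [mem_ofPred_eq]; linarith, hxm⟩
  obtain ⟨M, hM, hML, hpM, ⟨y, hyM, hym⟩, hMmin⟩ := least hL hp (C := {x | m - τ ≤ g x})
    (isClosed_le continuous_const hg) ⟨xm, hNL hxm, by simp only [mem_ofPred_eq]; linarith⟩
  replace hym : m - τ ≤ g y := hym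
  have hMF : M ⊆ F := hMmin F hF.1 (hF.2.2.1.trans hNL) (hF.2.1 rfl) ⟨xF, hxFF, show m - τ ≤ g xF from le_of_lt (show m - τ < g xF from hxF)⟩
  have hMs : ∀ x ∈ M, s < g x := fun x hx => hprop F hF x (hMF hx)
  have haM : a ∉ M := fun h => by linarith [hMs a h]
  have hyp : y ≠ p := by rintro rfl; linarith
  have hya : y ≠ a := by rintro rfl; exact haM hyM
  obtain ⟨W, hW, hyW, hWO⟩ := small_nhd (O := {x | m - 2 * τ < g x} ∩ ({p}ᶜ ∩ {a}ᶜ))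
    ((isOpen_lt continuous_const hg).inter (isOpen_compl_singleton.inter isOpen_compl_singleton))
    (y := y) ⟨by simp only [mem_ofPred_eq]; linarith, hyp, hya⟩
  have hWg : ∀ x ∈ closure W, m - 2 * τ < g x := fun x hx => (hWO hx).1
  have hpW : p ∉ closure W := fun h => (hWO h).2.1 rfl
  have haW : a ∉ closure W := fun h => (hWO h).2.2 rfl
  have hY : IsCompact (L \ W) := hL.1.diff hW
  have hpY : p ∈ L \ W := ⟨hp.1, fun h => hpW (subset_closure h)⟩
  -- component
  let Cy := connectedComponentIn (L \ W) p
  have hCyY : closure Cy ⊆ L \ W := closure_minimal (connectedComponentIn_subset _ _) hY.isClosed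
  have hpC : p ∈ closure Cy := subset_closure (mem_connectedComponentIn hpY)
  have hCy : IsSubcontinuum (closure Cy) := ⟨hY.of_isClosed_subset isClosed_closure hCyY, ⟨p, hpC⟩,
    isPreconnected_connectedComponentIn.closure⟩
  have hCM : closure Cy ⊆ M := by
    rcases hp.nest hCy hM hpC hpM (hCyY.trans sdiff_subset) hML with h | h
    · exact h
    · exact absurd hyW (hCyY (h hyM)).2
  obtain ⟨n, d, hd, hn, hpd, hpd'⟩ := hgood _ hCy (hCM.trans hML) hpC (fun x hx => (hMs x (hCM hx)).le)
  have hdO : IsOpen ((⋃ l ∈ Iio n, d l) ∩ {a}ᶜ) :=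
    (isOpen_biUnion fun l _ => hd.1 l).inter isOpen_compl_singleton
  obtain ⟨P, Q, hP, hQ, hPQ, hPQY, hpP, hTQ⟩ := sep (Y := L \ W) (S := {p})
    (T := (L \ W) ∩ ((⋃ l ∈ Iio n, d l) ∩ {a}ᶜ)ᶜ) hY isClosed_singleton
    (hY.isClosed.inter hdO.isClosed_compl) (by simpa using hpY) inter_subset_left (by
      intro C hC hCp x hx y hy hxp hyT
      rw [mem_singleton_iff] at hxp; subst hxp
      have hyC : y ∈ closure Cy := subset_closure (hCp.subset_connectedComponentIn hx hC hy)
      apply hyT.2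
      obtain ⟨l, hl, hyl⟩ := hd.2.1 y hyC
      exact ⟨mem_biUnion (show l ∈ Iio n from hl) hyl, fun h => haM (by rw [← show y = a from h]; exact hCM hyC)⟩)
  replace hpP : p ∈ P := hpP rfl
  have hPd : ∀ x ∈ P, (∃ l < n, x ∈ d l) ∧ x ≠ a := by
    intro x hx
    have : x ∈ (⋃ l ∈ Iio n, d l) ∩ {a}ᶜ := by
      by_contra h
      exact disjoint_left.1 hPQ hx (hTQ ⟨hPQY ▸ Or.inl hx, h⟩)
    obtain ⟨h1, h2⟩ := this
    simp only [mem_iUnion, mem_Iio, exists_prop] at h1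
    exact ⟨h1, h2⟩
  have hLW : ∀ x ∈ L, x ∉ P → x ∉ Q → x ∈ W := by
    intro x hx h1 h2
    by_contra h
    have : x ∈ P ∪ Q := hPQY ▸ ⟨hx, h⟩
    exact this.elim h1 h2
  have hex : ∃ l, l < n ∧ (d l ∩ closure W).Nonempty := by
    by_contra hcon
    push Not at hcon
    have hcv : L ⊆ P ∪ (Q ∪ closure W) := by
      intro x hx
      by_cases h1 : x ∈ P
      · exact Or.inl h1
      by_cases h2 : x ∈ Q
      · exact Or.inr (Or.inl h2)
      exact Or.inr (Or.inr (subset_closure (hLW x hx h1 h2)))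
    have hdd : ∀ x ∈ P, x ∉ closure W := by
      intro x hx hxW
      obtain ⟨⟨l, hl, hxl⟩, -⟩ := hPd x hx
      have := hcon l hl
      rw [eq_empty_iff_forall_notMem] at this
      exact this x ⟨hxl, hxW⟩
    rcases pre_split hL.2.2 hP (hQ.union isClosed_closure) hcv (by
      rintro x - h1 (h2 | h2)
      · exact disjoint_left.1 hPQ h1 h2
      · exact hdd x h1 h2) with h | h
    · exact hdd y (h (hML hyM)) (subset_closure hyW)
    · rcases h hp.1 with h2 | h2
      · exact disjoint_left.1 hPQ hpP h2
      · exact hpW h2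
  classical
  obtain ⟨i, ⟨hin, w, hwd, hwW⟩, himin⟩ : ∃ i, (i < n ∧ (d i ∩ closure W).Nonempty) ∧
      ∀ l < i, ¬ (l < n ∧ (d l ∩ closure W).Nonempty) :=
    ⟨Nat.find hex, Nat.find_spec hex, fun l hl => Nat.find_min hex hl⟩
  have hid : ∀ x ∈ d i, m - 2 * τ - δ₁ < g x := by
    intro x hx
    have h1 := abs_lt.1 (hd.2.2.1 i hin x hx w hwd)
    have h2 := hWg w hwW
    linarith [h1.1]
  have hlW : ∀ l < i, ∀ x ∈ d l, x ∉ W := fun l hl x hx hxW =>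
    himin l hl ⟨hl.trans hin, x, hx, subset_closure hxW⟩
  refine fl_mid hg hτ hδ hA hJ hL hp hLA hN hNL hpN haN hNs hNm hga (i := i) (e := fun l => d l ∩ Qᶜ)
      (U := Pᶜ ∪ ⋃ l ∈ Ico i n, d l)
      (Pb := P ∪ closure W) (Le := {x | ∃ l < i, x ∈ d l ∩ Qᶜ}) ⟨fun l => (hd.1 l).inter hQ.isOpen_compl,
        fun x hx => hx, ?_, ?_⟩ (hP.isOpen_compl.union (isOpen_biUnion fun l _ => hd.1 l)) (hP.union isClosed_closure)
      ?_ ?_ ?_ ?_ (Or.inl hpP) ?_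
  · intro l hl x hx z hz
    have := hd.2.2.1 l (by omega) x hx.1 z hz.1
    linarith
  · intro l l' h1 h2 x _ h3 h4
    exact hd.2.2.2 l l' h1 (by omega) x trivial h3.1 h4.1
  · intro x hx
    by_cases hxP : x ∈ P
    · obtain ⟨⟨l, hl, hxl⟩, -⟩ := hPd x hxP
      by_cases hli : l < i
      · exact Or.inr ⟨l, hli, hxl, disjoint_left.1 hPQ hxP⟩
      · exact Or.inl (Or.inr (mem_biUnion (show l ∈ Ico i n from ⟨by omega, hl⟩) hxl))
    · exact Or.inl (Or.inl hxP)
  · rintro l hl x hx ⟨hxl, hxQ⟩ (hxP | hxU)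
    · exact absurd (hLW x hx hxP hxQ) (hlW l hl x hxl)
    · simp only [mem_iUnion, exists_prop] at hxU
      obtain ⟨l', ⟨h1, h2⟩, hxl'⟩ := hxU
      have h3 : ¬ (l + 2 ≤ l') := fun h => hd.2.2.2 l l' h h2 x trivial hxl hxl'
      have : l' = i := by omega
      subst this
      exact ⟨by omega, hid x hxl'⟩
  · rintro (h | h)
    · exact (hPd a h).2 rfl
    · exact haW h
  · rintro l hl x hx ⟨hxl, hxQ⟩
    by_cases hxP : x ∈ P
    · exact Or.inl hxP
    · exact Or.inr (subset_closure (hLW x hx hxP hxQ))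
  · rcases Nat.eq_zero_or_pos i with h0 | h0
    · left
      subst h0
      exact ⟨rfl, Or.inr (mem_biUnion (show 0 ∈ Ico 0 n from ⟨le_rfl, hn⟩) hpd), hid p hpd⟩
    · right
      refine ⟨h0, ⟨hpd, disjoint_left.1 hPQ hpP⟩, ?_, fun l h1 h2 h3 => hpd' l h1 (by omega) h3.1⟩
      rintro (h | h)
      · exact h hpP
      · simp only [mem_iUnion, exists_prop] at h
        obtain ⟨l', ⟨h1, h2⟩, h3⟩ := h
        exact hpd' l' (by omega) h2 h3

theorem FL (hH : Nice H) (hHc : IsCompact H) {g : X → ℝ} (hg : Continuous g) {δ : ℝ} (hδ : 0 < δ) {L₀ : Set X} {p₀ : X}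
    (hL₀ : IsSubcontinuum L₀) (hL₀H : L₀ ⊆ H) (hp₀ : EndP p₀ L₀) : Chn g δ L₀ univ p₀ := by
  by_contra hbad
  let Bad : Set X → Prop := fun M => IsCompact M ∧ ∀ V, IsOpen V → M ⊆ V → ∀ δ' < δ, ∃ L p, IsSubcontinuum L ∧ L ⊆ H ∧
    L ⊆ V ∧ EndP p L ∧ ¬ Chn g δ' L univ p
  have hBH : Bad H := ⟨hHc, fun V _ hHV δ' hδ' => ⟨L₀, p₀, hL₀, hL₀H, hL₀H.trans hHV, hp₀,
    fun h => hbad (h.weak hδ'.le)⟩⟩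
  obtain ⟨M, hM⟩ := zorn_superset {M | Bad M} (by
    intro c hc hch
    rcases c.eq_empty_or_nonempty with rfl | hne
    · exact ⟨H, hBH, by simp⟩
    · obtain ⟨s0, hs0⟩ := hne
      refine ⟨⋂₀ c, ⟨?_, ?_⟩, fun s hs => sInter_subset_of_mem hs⟩
      · exact (hc hs0).1.of_isClosed_subset (isClosed_sInter fun s hs => (hc hs).1.isClosed) (sInter_subset_of_mem hs0)
      · intro V hV hcV
        obtain ⟨s, hs, hsV⟩ := chain_subset_open ⟨s0, hs0⟩ hch (fun s hs => (hc hs).1) hV hcV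
        exact (hc hs).2 V hV hsV)
  obtain ⟨⟨hMc, hMb⟩, hMmin⟩ := hM
  have hMne : M.Nonempty := by
    by_contra h
    rw [not_nonempty_iff_eq_empty] at h
    obtain ⟨L, p, -, -, h1, h2, -⟩ := hMb ∅ isOpen_empty h.le (δ - 1) (by linarith)
    exact h1 h2.1
  obtain ⟨xα, hxα, hmin⟩ := hMc.exists_isMinOn hMne hg.continuousOn
  have hα : ∀ x ∈ M, g xα ≤ g x := fun x hx => hmin hx
  set α := g xα with hαdef
  set s := α + δ / 4 with hs
  have hnb : ¬ Bad (M ∩ {x | s ≤ g x}) := by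
    intro h
    have h1 := (hMmin h inter_subset_left hxα).2
    have h2 : s ≤ α := h1
    linarith
  have hcc : IsCompact (M ∩ {x | s ≤ g x}) := hMc.inter_right (isClosed_le continuous_const hg)
  have : ∃ V₁, IsOpen V₁ ∧ M ∩ {x | s ≤ g x} ⊆ V₁ ∧ ∃ δ₁ < δ, ∀ L p, IsSubcontinuum L → L ⊆ H → L ⊆ V₁ → EndP p L →
      Chn g δ₁ L univ p := by
    by_contra hcon
    apply hnb
    refine ⟨hcc, ?_⟩
    intro V hV hMV δ' hδ'
    by_contra hcon2
    apply hcon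
    refine ⟨V, hV, hMV, δ', hδ', ?_⟩
    intro L p h1 h2 h3 h4
    by_contra h5
    exact hcon2 ⟨L, p, h1, h2, h3, h4, h5⟩
  obtain ⟨V₁, hV₁, hMV₁, δ₀, hδ₀, hgood⟩ := this
  set δ₁ := max δ₀ (δ / 2) with hδ₁
  have h1 : δ₁ < δ := max_lt hδ₀ (by linarith)
  have h2 : δ / 2 ≤ δ₁ := le_max_right _ _
  set τ := (δ - δ₁) / 20 with hτd
  have hτ : 0 < τ := by rw [hτd]; linarith
  have h20 : 20 * τ = δ - δ₁ := by rw [hτd]; ring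
  obtain ⟨L, p, hL, hLH, hLV, hp, hLbad⟩ := hMb ((V₁ ∪ {x | g x < s}) ∩ {x | α - τ < g x})
    ((hV₁.union (isOpen_lt hg continuous_const)).inter (isOpen_lt continuous_const hg)) (by
      intro x hx
      refine ⟨?_, ?_⟩
      · by_cases h : s ≤ g x
        · exact Or.inl (hMV₁ ⟨hx, h⟩)
        · exact Or.inr (not_le.1 h)
      · have := hα x hx
        show α - τ < g x
        linarith) (δ₁ + 7 * τ) (by linarith)
  apply hLbad
  refine fl_core hH hg (s := s) (A0 := α - τ) hτ (by linarith) (by linarith) (by linarith) hL hLH hp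
    (fun x hx => (hLV hx).2) ?_
  intro N hN hNL hpN hNs
  refine (hgood N p hN (hNL.trans hLH) ?_ (hp.mono hNL hpN)).weak (le_max_left _ _)
  intro x hx
  rcases (hLV (hNL hx)).1 with h | h
  · exact h
  · exact absurd h (not_lt.2 (hNs x hx))

end fl
end Bing

namespace Bing

section fin
variable {X : Type*} [MetricSpace X] {H : Set X}

def smd (ε : ℝ) (s : Set X) : Prop := ∀ x ∈ s, ∀ y ∈ s, dist x y < ε

theorem smd_mono (ε : ℝ) : ∀ s t : Set X, s ⊆ t → smd ε t → smd ε s :=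
  fun _ _ h ht x hx y hy => ht x (h hx) y (h hy)

theorem glue_aux {A : Set X} {ε : ℝ} {n : ℕ} {a : ℕ → Set X} {W Q : Set X} (ha : WC A univ (smd ε) n a)
    (hQ : IsClosed Q) :
    WC ((⋃ i ∈ Iio n, (a i ∩ (if i = 0 then univ else (closure W)ᶜ))) ∩ Qᶜ) univ (smd ε) n
      (fun i => (a i ∩ (if i = 0 then univ else (closure W)ᶜ)) ∩ Qᶜ) := by
  refine ⟨?_, ?_, ?_, ?_⟩
  · intro i
    refine ((ha.1 i).inter ?_).inter hQ.isOpen_compl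
    split_ifs
    · exact isOpen_univ
    · exact isClosed_closure.isOpen_compl
  · rintro x ⟨hx, hxQ⟩
    simp only [mem_iUnion, exists_prop] at hx
    obtain ⟨i, hi, hxi⟩ := hx
    exact ⟨i, hi, hxi, hxQ⟩
  · intro i hi
    exact smd_mono _ _ _ (inter_subset_left.trans inter_subset_left) (ha.2.2.1 i hi)
  · intro i j h1 h2 x hx h3 h4
    exact ha.2.2.2 i j h1 h2 x hx h3.1.1 h4.1.1

theorem glue (hH : Nice H) {A B : Set X} (hA : IsSubcontinuum A) (hB : IsSubcontinuum B) (hAH : A ⊆ H) (hBH : B ⊆ H)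
    {p : X} (hpA : p ∈ A) (hpB : p ∈ B) {ε : ℝ} {n m : ℕ} {a b : ℕ → Set X}
    (ha : WC A univ (smd ε) n a) (hn : 0 < n) (hpa : p ∈ a 0)
    (hb : WC B univ (smd ε) m b) (hm : 0 < m) (hpb : p ∈ b 0) :
    ∃ k c, WC (A ∪ B) (A ∪ B) (smd ε) k c := by
  obtain ⟨W, hW, hpW, hWO⟩ := small_nhd ((ha.1 0).inter (hb.1 0)) ⟨hpa, hpb⟩
  have hua : ∀ x, (∃ i < n, x ∈ a i) → x ∈ ⋃ i ∈ Iio n, (a i ∩ (if i = 0 then univ else (closure W)ᶜ)) := by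
    rintro x ⟨i, hi, hx⟩
    by_cases hxW : x ∈ closure W
    · exact mem_biUnion (show 0 ∈ Iio n from hn) ⟨(hWO hxW).1, by simp⟩
    · exact mem_biUnion (show i ∈ Iio n from hi) ⟨hx, by split_ifs; exacts [trivial, hxW]⟩
  have hub : ∀ x, (∃ i < m, x ∈ b i) → x ∈ ⋃ i ∈ Iio m, (b i ∩ (if i = 0 then univ else (closure W)ᶜ)) := by
    rintro x ⟨i, hi, hx⟩
    by_cases hxW : x ∈ closure W
    · exact mem_biUnion (show 0 ∈ Iio m from hm) ⟨(hWO hxW).2, by simp⟩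
    · exact mem_biUnion (show i ∈ Iio m from hi) ⟨hx, by split_ifs; exacts [trivial, hxW]⟩
  have hY : IsCompact ((A ∪ B) \ W) := (hA.1.union hB.1).diff hW
  have hSc : IsClosed (A ∩ (⋃ i ∈ Iio m, b i)ᶜ) :=
    hA.1.isClosed.inter (isOpen_biUnion fun i _ => hb.1 i).isClosed_compl
  have hTc : IsClosed (B ∩ (⋃ i ∈ Iio n, a i)ᶜ) :=
    hB.1.isClosed.inter (isOpen_biUnion fun i _ => ha.1 i).isClosed_compl
  obtain ⟨P, Q, hP, hQ, hPQ, hPQY, hSP, hTQ⟩ := sep hY hSc hTc (by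
      rintro x ⟨hx, hx'⟩
      exact ⟨Or.inl hx, fun hxW => hx' (mem_biUnion (show 0 ∈ Iio m from hm) (hWO (subset_closure hxW)).2)⟩) (by
      rintro x ⟨hx, hx'⟩
      exact ⟨Or.inr hx, fun hxW => hx' (mem_biUnion (show 0 ∈ Iio n from hn) (hWO (subset_closure hxW)).1)⟩) (by
      intro C hC hCp x hx y hy hxS hyT
      have hCY : closure C ⊆ (A ∪ B) \ W := closure_minimal hC hY.isClosed
      have hcC : IsSubcontinuum (closure C) := ⟨hY.of_isClosed_subset isClosed_closure hCY, ⟨x, subset_closure hx⟩,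
        hCp.closure⟩
      have hCH : closure C ⊆ H := hCY.trans (sdiff_subset.trans (union_subset hAH hBH))
      have hxB : x ∉ B := fun h => by
        obtain ⟨i, hi, hxi⟩ := hb.2.1 x h
        exact hxS.2 (mem_biUnion (show i ∈ Iio m from hi) hxi)
      have hyA : y ∉ A := fun h => by
        obtain ⟨i, hi, hxi⟩ := ha.2.1 y h
        exact hyT.2 (mem_biUnion (show i ∈ Iio n from hi) hxi)
      have hxC : x ∈ closure C := subset_closure hx
      have hyC : y ∈ closure C := subset_closure hy
      have hpC : p ∉ closure C := fun h => (hCY h).2 hpW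
      obtain ⟨z, hzC, hzA, hzB⟩ : ∃ z, z ∈ closure C ∧ z ∈ A ∧ z ∈ B := by
        by_contra hno
        push Not at hno
        rcases pre_split hcC.2.2 hA.1.isClosed hB.1.isClosed (hCY.trans sdiff_subset)
          (fun x h h1 h2 => hno x h h1 h2) with h | h
        · exact hyA (h hyC)
        · exact hxB (h hxC)
      exact hH.tri (hH.inter hcC hA hCH hAH hxC hxS.1) (hH.inter hcC hB hCH hBH hyC hyT.1)
        (hH.inter hA hB hAH hBH hpA hpB) (inter_subset_left.trans hCH) (inter_subset_left.trans hCH)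
        (inter_subset_left.trans hAH) (x := z) ⟨hzC, hzA⟩ ⟨hzC, hzB⟩ ⟨hzA, hzB⟩ (a := x) (b := y) (c := p)
        ⟨hxC, hxS.1⟩ (fun h => hxB h.2) (fun h => hxB h.2) (fun h => hyA h.2) ⟨hyC, hyT.1⟩ (fun h => hyA h.1)
        (fun h => hpC h.1) (fun h => hpC h.1) ⟨hpA, hpB⟩)
  have hLW : ∀ x ∈ A ∪ B, x ∉ P → x ∉ Q → x ∈ W := by
    intro x hx h1 h2
    by_contra h
    have : x ∈ P ∪ Q := hPQY ▸ ⟨hx, h⟩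
    exact this.elim h1 h2
  have ca := reverse (glue_aux (W := W) ha hQ)
  have cb := glue_aux (W := W) hb hP
  have ca' := (⟨ca.1, ca.2.1, ca.2.2.1, fun i j h1 h2 x _ => ca.2.2.2 i j h1 h2 x trivial⟩ : WC _ (A ∪ B) _ _ _)
  have cb' := (⟨cb.1, cb.2.1, cb.2.2.1, fun i j h1 h2 x _ => cb.2.2.2 i j h1 h2 x trivial⟩ : WC _ (A ∪ B) _ _ _)
  have cc := concat ca' cb' (by
    rintro i hi j hj x hx ⟨⟨-, hxi⟩, hxQ⟩ ⟨⟨-, hxj⟩, hxP⟩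
    have hxW := subset_closure (hLW x hx hxP hxQ)
    split_ifs at hxi hxj with c1 c2 c2
    · exact ⟨by omega, c2⟩
    · exact absurd hxW hxj
    · exact absurd hxW hxi
    · exact absurd hxW hxj)
  refine ⟨_, _, cc.mono ?_⟩
  intro x hx
  by_cases hxQ : x ∈ Q
  · right
    have hxP : x ∉ P := disjoint_right.1 hPQ hxQ
    refine ⟨hub x ?_, hxP⟩
    rcases hx with h | h
    · by_contra hno
      refine hxP (hSP ⟨h, fun h' => hno ?_⟩)
      simpa using h'
    · exact hb.2.1 x h
  · left
    refine ⟨hua x ?_, hxQ⟩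
    rcases hx with h | h
    · exact ha.2.1 x h
    · by_contra hno
      refine hxQ (hTQ ⟨h, fun h' => hno ?_⟩)
      simpa using h'

theorem mkG {A : Set X} (hA : IsClosed A) {ε : ℝ} {n : ℕ} {c : ℕ → Set X} (hc : WC A A (smd ε) n c) :
    ∃ g : X → ℝ, Continuous g ∧ ∀ s : Set X, sm g (1 / 2) s → (s ∩ A).Nonempty → ∃ i < n, s ∩ A ⊆ c i := by
  have hU : ∀ k : ℕ, ∃ f : C(X, ℝ), (∀ x ∈ A, (∀ l, k < l → l < n → x ∉ c l) → f x = 0) ∧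
      (∀ x ∈ A, (∀ l, l ≤ k → l < n → x ∉ c l) → f x = 1) ∧ ∀ x, f x ∈ Icc (0 : ℝ) 1 := by
    intro k
    obtain ⟨f, h1, h2, h3⟩ := exists_continuous_zero_one_of_isClosed
      (s := A ∩ (⋃ l ∈ Ioo k n, c l)ᶜ) (t := A ∩ (⋃ l ∈ {l | l ≤ k ∧ l < n}, c l)ᶜ)
      (hA.inter (isOpen_biUnion fun i _ => hc.1 i).isClosed_compl)
      (hA.inter (isOpen_biUnion fun i _ => hc.1 i).isClosed_compl) (by
        rw [disjoint_left]
        rintro x ⟨hx, hx1⟩ ⟨-, hx2⟩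
        obtain ⟨i, hi, hxi⟩ := hc.2.1 x hx
        by_cases h : i ≤ k
        · exact hx2 (mem_biUnion (show i ∈ {l | l ≤ k ∧ l < n} from ⟨h, hi⟩) hxi)
        · exact hx1 (mem_biUnion (show i ∈ Ioo k n from ⟨by omega, hi⟩) hxi))
    refine ⟨f, fun x hx h => h1 ⟨hx, ?_⟩, fun x hx h => h2 ⟨hx, ?_⟩, h3⟩
    · intro h'
      simp only [mem_iUnion, exists_prop] at h'
      obtain ⟨l, hl, hxl⟩ := h'
      exact h l hl.1 hl.2 hxl
    · intro h'
      simp only [mem_iUnion, exists_prop] at h'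
      obtain ⟨l, hl, hxl⟩ := h'
      exact h l hl.1 hl.2 hxl
  choose h h0 h1 h01 using hU
  let g : X → ℝ := fun x => ∑ k ∈ Finset.range n, h k x
  have hgc : Continuous g := continuous_finsetSum _ fun k _ => (h k).continuous
  have hg0 : ∀ x, 0 ≤ g x := fun x => Finset.sum_nonneg fun k _ => (h01 k x).1
  have c1 : ∀ x ∈ A, ∀ i, i + 1 ≤ n → (∀ l, i + 1 ≤ l → l < n → x ∉ c l) → g x ≤ i := by
    intro x hx i hi hl
    have : g x = ∑ k ∈ Finset.range i, h k x := by
      symm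
      apply Finset.sum_subset
      · intro k hk; simp only [Finset.mem_range] at *; omega
      · intro k hk hk'
        simp only [Finset.mem_range, not_lt] at *
        exact h0 k x hx fun l h1 h2 => hl l (by omega) h2
    rw [this]
    calc ∑ k ∈ Finset.range i, h k x ≤ ∑ k ∈ Finset.range i, (1 : ℝ) := Finset.sum_le_sum fun k _ => (h01 k x).2
      _ = i := by simp
  have c2 : ∀ x ∈ A, ∀ i, i < n → (∀ l, l ≤ i → l < n → x ∉ c l) → (i : ℝ) + 1 ≤ g x := by
    intro x hx i hi hl
    calc (i : ℝ) + 1 = ∑ k ∈ Finset.range (i + 1), (1 : ℝ) := by simp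
      _ = ∑ k ∈ Finset.range (i + 1), h k x := by
          apply Finset.sum_congr rfl
          intro k hk
          simp only [Finset.mem_range] at hk
          exact (h1 k x hx fun l h1 h2 => hl l (by omega) h2).symm
      _ ≤ g x := Finset.sum_le_sum_of_subset_of_nonneg
          (by intro k hk; simp only [Finset.mem_range] at *; omega) (fun k _ _ => (h01 k x).1)
  have key : ∀ x ∈ A, ∀ i < n, |g x - i| < 1 → x ∈ c i := by
    intro x hx i hi hgi
    by_contra hxi
    rw [abs_lt] at hgi
    obtain ⟨j, hj, hxj⟩ := hc.2.1 x hx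
    have hne : j ≠ i := by rintro rfl; exact hxi hxj
    rcases lt_or_gt_of_ne hne with hji | hji
    · have := c1 x hx (i - 1) (by omega) (by
        intro l h1 h2 hxl
        rcases Nat.eq_or_lt_of_le h1 with h | h
        · have : l = i := by omega
          subst this; exact hxi hxl
        · exact hc.2.2.2 j l (by omega) h2 x hx hxj hxl)
      rw [Nat.cast_sub (by omega)] at this
      push_cast at this
      linarith [hgi.1]
    · have := c2 x hx i hi (by
        intro l h1 h2 hxl
        rcases Nat.eq_or_lt_of_le h1 with h | h
        · subst h; exact hxi hxl
        · exact hc.2.2.2 l j (by omega) hj x hx hxl hxj)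
      linarith [hgi.2]
  refine ⟨g, hgc, ?_⟩
  rintro s hs ⟨x0, hx0, hx0A⟩
  have hn : 0 < n := by
    obtain ⟨j, hj, -⟩ := hc.2.1 x0 hx0A
    omega
  have hup := c1 x0 hx0A (n - 1) (by omega) (by intro l h1 h2; omega)
  rw [Nat.cast_sub (by omega)] at hup
  push_cast at hup
  have f1 := Nat.floor_le (show 0 ≤ g x0 + 1 / 2 by linarith [hg0 x0])
  have f2 := Nat.lt_floor_add_one (g x0 + 1 / 2)
  have hi : ⌊g x0 + 1 / 2⌋₊ < n := by
    have : ((⌊g x0 + 1 / 2⌋₊ : ℕ) : ℝ) < n := by linarith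
    exact_mod_cast this
  refine ⟨_, hi, ?_⟩
  rintro x ⟨hx, hxA⟩
  apply key x hxA _ hi
  have := abs_lt.1 (hs x hx x0 hx0)
  rw [abs_lt]
  constructor <;> linarith [this.1, this.2]

theorem refineEnd (hH : Nice H) (hHc : IsCompact H) {A : Set X} {p : X} (hA : IsSubcontinuum A) (hAH : A ⊆ H)
    (hp : EndP p A) {ε : ℝ} {n : ℕ} {c : ℕ → Set X} (hc : WC A A (smd ε) n c) :
    ∃ m d, WC A univ (smd ε) m d ∧ 0 < m ∧ p ∈ d 0 := by
  obtain ⟨g, hg, hgs⟩ := mkG hA.1.isClosed hc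
  obtain ⟨m, d, hd, hm, hpd, -⟩ := FL hH hHc hg (δ := 1 / 2) (by norm_num) hA hAH hp
  have hn : 0 < n := by
    obtain ⟨j, hj, -⟩ := hc.2.1 p hp.1
    omega
  have : ∀ t, ∃ i < n, t < m → d t ∩ A ⊆ c i := by
    intro t
    by_cases ht : t < m ∧ (d t ∩ A).Nonempty
    · obtain ⟨i, hi, h⟩ := hgs (d t) (hd.2.2.1 t ht.1) ht.2
      exact ⟨i, hi, fun _ => h⟩
    · refine ⟨0, hn, fun htm => ?_⟩
      have : ¬ (d t ∩ A).Nonempty := fun h => ht ⟨htm, h⟩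
      rw [not_nonempty_iff_eq_empty] at this
      rw [this]; exact empty_subset _
  choose i hin hi using this
  refine ⟨m, fun t => d t ∩ c (i t), ⟨fun t => (hd.1 t).inter (hc.1 _), ?_, ?_, ?_⟩, hm, hpd, hi 0 hm ⟨hpd, hp.1⟩⟩
  · intro x hx
    obtain ⟨t, ht, hxt⟩ := hd.2.1 x hx
    exact ⟨t, ht, hxt, hi t ht ⟨hxt, hx⟩⟩
  · intro t _
    exact smd_mono _ _ _ inter_subset_right (hc.2.2.1 _ (hin t))
  · intro t t' h1 h2 x hx h3 h4
    exact hd.2.2.2 t t' h1 h2 x hx h3.1 h4.1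

theorem weak_chain (hH : Nice H) (hHc : IsSubcontinuum H) {ε : ℝ} (hε : 0 < ε) :
    ∃ n c, WC H H (smd ε) n c := by
  by_contra hbad
  obtain ⟨K, hK⟩ := zorn_superset {K | IsSubcontinuum K ∧ K ⊆ H ∧ ¬ ∃ n c, WC K K (smd ε) n c} (by
    intro c hc hch
    rcases c.eq_empty_or_nonempty with rfl | hne
    · exact ⟨H, ⟨hHc, le_rfl, hbad⟩, by simp⟩
    · refine ⟨⋂₀ c, ⟨chain_inter hne hch fun s hs => (hc hs).1, ?_, ?_⟩, fun s hs => sInter_subset_of_mem hs⟩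
      · obtain ⟨s0, hs0⟩ := hne
        exact (sInter_subset_of_mem hs0).trans (hc hs0).2.1
      · rintro ⟨n, d, hd⟩
        obtain ⟨d', hd', -⟩ := normalize (smd_mono ε) hd
        obtain ⟨s, hs, hsV⟩ := chain_subset_open hne hch (fun s hs => (hc hs).1.1)
          (V := ⋃ i ∈ Iio n, d' i) (isOpen_biUnion fun i _ => hd'.1 i) (by
            intro x hx
            obtain ⟨i, hi, hxi⟩ := hd'.2.1 x hx
            exact mem_biUnion (show i ∈ Iio n from hi) hxi)
        refine (hc hs).2.2 ⟨n, d', hd'.1, ?_, hd'.2.2.1, fun i j h1 h2 x _ => hd'.2.2.2 i j h1 h2 x trivial⟩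
        intro x hx
        simpa using hsV hx)
  obtain ⟨⟨hKc, hKH, hKbad⟩, hmin⟩ := hK
  have hnt : K.Nontrivial := by
    by_contra hh
    rw [not_nontrivial_iff] at hh
    obtain ⟨p, hp⟩ := hKc.2.1
    apply hKbad
    refine ⟨1, _, single (U := ball p (ε / 2)) isOpen_ball ?_ ?_⟩
    · intro x hx y hy
      have := dist_triangle_right x y p
      rw [mem_ball] at hx hy
      linarith
    · intro x hx
      rw [hh hx hp]
      exact mem_ball_self (by linarith)
  obtain ⟨A, B, p, hA, hB, hAK, hBK, hA', hB', hAB, hpA, hpB⟩ := cutPoint hH hKc hKH hnt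
  have cA : ∃ n c, WC A A (smd ε) n c := by
    by_contra h
    exact hA' (hmin ⟨hA, hAK.trans hKH, h⟩ hAK)
  have cB : ∃ n c, WC B B (smd ε) n c := by
    by_contra h
    exact hB' (hmin ⟨hB, hBK.trans hKH, h⟩ hBK)
  obtain ⟨n, c, hc⟩ := cA
  obtain ⟨n', c', hc'⟩ := cB
  obtain ⟨m, d, hd, hm, hpd⟩ := refineEnd hH hHc.1 hA (hAK.trans hKH) hpA hc
  obtain ⟨m', d', hd', hm', hpd'⟩ := refineEnd hH hHc.1 hB (hBK.trans hKH) hpB hc'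
  apply hKbad
  rw [← hAB]
  exact glue hH hA hB (hAK.trans hKH) (hBK.trans hKH) hpA.1 hpB.1 hd hm hpd hd' hm' hpd'

theorem chainable (hH : Nice H) (hHc : IsSubcontinuum H) : Chainable ↥H := by
  classical
  intro ε hε
  have hex : ∃ n, ∃ c, WC H H (smd (ε / 2)) n c := weak_chain hH hHc (by linarith)
  obtain ⟨n, ⟨c, hc⟩, hmin⟩ : ∃ n, (∃ c, WC H H (smd (ε / 2)) n c) ∧ ∀ k < n, ¬ ∃ c, WC H H (smd (ε / 2)) k c :=
    ⟨Nat.find hex, Nat.find_spec hex, fun l hl => Nat.find_min hex hl⟩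
  obtain ⟨x0, hx0⟩ := hHc.2.1
  have hn : 0 < n := by
    obtain ⟨j, hj, -⟩ := hc.2.1 x0 hx0
    omega
  have hcons : ∀ i, i + 1 < n → ∃ x ∈ H, x ∈ c i ∧ x ∈ c (i + 1) := by
    intro i hi
    by_contra hno
    push Not at hno
    have hpre := isPreconnected_iff_subset_of_disjoint.1 hHc.2.2 (⋃ l ∈ Iic i, c l) (⋃ l ∈ Ioo i n, c l)
      (isOpen_biUnion fun l _ => hc.1 l) (isOpen_biUnion fun l _ => hc.1 l) (by
        intro x hx
        obtain ⟨j, hj, hxj⟩ := hc.2.1 x hx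
        by_cases h : j ≤ i
        · exact Or.inl (mem_biUnion (show j ∈ Iic i from h) hxj)
        · exact Or.inr (mem_biUnion (show j ∈ Ioo i n from ⟨by omega, hj⟩) hxj)) (by
        rw [eq_empty_iff_forall_notMem]
        rintro x ⟨hx, hx1, hx2⟩
        simp only [mem_iUnion, exists_prop] at hx1 hx2
        obtain ⟨l, hl, hxl⟩ := hx1
        obtain ⟨l', hl', hxl'⟩ := hx2
        simp only [mem_Iic, mem_Ioo] at hl hl'
        by_cases h : l + 2 ≤ l'
        · exact hc.2.2.2 l l' h hl'.2 x hx hxl hxl'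
        · have e1 : l = i := by omega
          have e2 : l' = i + 1 := by omega
          subst e1; subst e2
          exact hno x hx hxl hxl')
    rcases hpre with h | h
    · refine hmin (i + 1) hi ⟨c, hc.1, ?_, fun l hl => hc.2.2.1 l (by omega),
        fun l l' h1 h2 => hc.2.2.2 l l' h1 (by omega)⟩
      intro x hx
      have := h hx
      simp only [mem_iUnion, exists_prop] at this
      obtain ⟨l, hl, hxl⟩ := this
      simp only [mem_Iic] at hl
      exact ⟨l, by omega, hxl⟩
    · refine hmin (n - (i + 1)) (by omega) ⟨fun l => c (i + 1 + l), fun l => hc.1 _, ?_,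
        fun l hl => hc.2.2.1 _ (by omega),
        fun l l' h1 h2 => hc.2.2.2 _ _ (by omega) (by omega)⟩
      intro x hx
      have := h hx
      simp only [mem_iUnion, exists_prop] at this
      obtain ⟨l, hl, hxl⟩ := this
      simp only [mem_Ioo] at hl
      refine ⟨l - (i + 1), by omega, ?_⟩
      have e : i + 1 + (l - (i + 1)) = l := by omega
      simpa only [e] using hxl
  have hne : ∀ i < n, ∃ x ∈ H, x ∈ c i := by
    intro i hi
    by_cases h : i + 1 < n
    · obtain ⟨x, hx, hxi, -⟩ := hcons i h
      exact ⟨x, hx, hxi⟩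
    by_cases h' : 0 < i
    · obtain ⟨x, hx, -, hxi⟩ := hcons (i - 1) (by omega)
      have e : i - 1 + 1 = i := by omega
      rw [e] at hxi
      exact ⟨x, hx, hxi⟩
    · obtain ⟨j, hj, hxj⟩ := hc.2.1 x0 hx0
      have e : j = i := by omega
      subst e
      exact ⟨x0, hx0, hxj⟩
  obtain ⟨k, rfl⟩ : ∃ k, n = k + 1 := ⟨n - 1, by omega⟩
  refine ⟨k, fun i => Subtype.val ⁻¹' (c i), fun i => (hc.1 i).preimage continuous_subtype_val, ?_, ?_, ?_⟩
  · rw [eq_univ_iff_forall]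
    rintro ⟨x, hx⟩
    obtain ⟨j, hj, hxj⟩ := hc.2.1 x hx
    exact mem_iUnion.2 ⟨⟨j, hj⟩, hxj⟩
  · intro i
    refine lt_of_le_of_lt (Metric.diam_le_of_forall_dist_le (C := ε / 2) (by linarith) ?_) (by linarith)
    intro x hx y hy
    exact (hc.2.2.1 i i.2 x hx y hy).le
  · have sym : ∀ i j : ℕ, i < k + 1 → j < k + 1 → i ≤ j →
        ((∃ x ∈ H, x ∈ c i ∧ x ∈ c j) ↔ |(i : ℤ) - (j : ℤ)| ≤ 1) := by
      intro i j hi hj hij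
      constructor
      · rintro ⟨x, hx, hxi, hxj⟩
        by_contra h
        have : i + 2 ≤ j := by
          by_contra h'
          apply h
          rw [abs_le]; constructor <;> omega
        exact hc.2.2.2 i j this hj x hx hxi hxj
      · intro h
        rw [abs_le] at h
        have : j = i ∨ j = i + 1 := by omega
        rcases this with rfl | rfl
        · obtain ⟨x, hx, hxi⟩ := hne j hi
          exact ⟨x, hx, hxi, hxi⟩
        · exact hcons i hj
    intro i j
    have conv : ∀ i j : Fin (k + 1), ((Subtype.val ⁻¹' (c i) ∩ Subtype.val ⁻¹' (c j) : Set H).Nonempty ↔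
        ∃ x ∈ H, x ∈ c i ∧ x ∈ c j) := by
      intro i j
      constructor
      · rintro ⟨⟨x, hx⟩, h1, h2⟩; exact ⟨x, hx, h1, h2⟩
      · rintro ⟨x, hx, h1, h2⟩; exact ⟨⟨x, hx⟩, h1, h2⟩
    rcases le_total (i : ℕ) (j : ℕ) with h | h
    · rw [conv, sym i j i.2 j.2 h]
    · rw [inter_comm, conv, sym j i j.2 i.2 h, abs_sub_comm]

end fin
end Bing

theorem stmt0 (X : Type*) [MetricSpace X] [CompactSpace X] [ConnectedSpace X]
    (H : Set X) (hH : IsSubcontinuum H) (hnd : H.Nontrivial)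
    (hdec : ∀ K : Set X, K ⊆ H → IsSubcontinuum K → K.Nontrivial → SetDecomposable K)
    (huni : ∀ K : Set X, K ⊆ H → IsSubcontinuum K → SetUnicoherent K)
    (hatr : ∀ T : Set X, T ⊆ H → ¬ IsTriod T) :
    Chainable ↥H := by
  exact Bing.chainable ⟨hdec, huni, hatr⟩ hH
end

section
/- Every almost chainable metric continuum is not a triod. -/
open Metric Set Function

theorem aux_conn {M : Type*} [TopologicalSpace M] [ConnectedSpace M] (Z B D P Q : Set M)
    (hZ : IsPreconnected Z) (hB : IsOpen B) (hD : IsOpen D) (hBD : B ∩ D = ∅)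
    (hU : ∀ x, x ∈ Z ∨ x ∈ B ∨ x ∈ D) (hZB : Z ∩ B = ∅)
    (hP : IsOpen P) (hQ : IsOpen Q) (hPQ : P ∩ Q = ∅) (hc : ∀ x, x ∉ B → x ∈ P ∨ x ∈ Q)
    (p : M) (hp : p ∈ D ∩ P) (q : M) (hq : q ∈ D ∩ Q) : False := by
  have key : ∀ P Q : Set M, IsOpen P → IsOpen Q → P ∩ Q = ∅ → (∀ x, x ∉ B → x ∈ P ∨ x ∈ Q) →
      (D ∩ P).Nonempty → (D ∩ Q).Nonempty → Z ⊆ P → False := by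
    intro P Q hP hQ hPQ hc ⟨p, hp⟩ ⟨q, hq⟩ hZP
    have := isPreconnected_univ (α := M) (Q ∩ D) (B ∪ P) (hQ.inter hD) (hB.union hP)
      (by
        intro x _
        by_cases hxB : x ∈ B
        · exact Or.inr (Or.inl hxB)
        · rcases hU x with h | h | h
          · exact Or.inr (Or.inr (hZP h))
          · exact Or.inr (Or.inl h)
          · rcases hc x hxB with h' | h'
            · exact Or.inr (Or.inr h')
            · exact Or.inl ⟨h', h⟩)
      ⟨q, mem_univ _, hq.2, hq.1⟩ ⟨p, mem_univ _, Or.inr hp.2⟩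
    obtain ⟨x, _, ⟨hxQ, hxD⟩, h | h⟩ := this
    · exact (hBD ▸ (⟨h, hxD⟩ : x ∈ B ∩ D) : x ∈ (∅ : Set M))
    · exact (hPQ ▸ (⟨h, hxQ⟩ : x ∈ P ∩ Q) : x ∈ (∅ : Set M))
  have hZPQ : Z ⊆ P ∪ Q := fun x hx => hc x fun hxB =>
    (hZB ▸ (⟨hx, hxB⟩ : x ∈ Z ∩ B) : x ∈ (∅ : Set M))
  rcases isPreconnected_iff_subset_of_disjoint.1 hZ P Q hP hQ hZPQ (by rw [hPQ]; simp) with h | h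
  · exact key P Q hP hQ hPQ hc ⟨p, hp⟩ ⟨q, hq⟩ h
  · exact key Q P hQ hP (by rw [inter_comm, hPQ]) (fun x hx => (hc x hx).symm) ⟨q, hq⟩ ⟨p, hp⟩ h

theorem aux_split {M : Type*} [TopologicalSpace M] (V : Set M) (hV : IsOpen V)
    (h : ¬ IsPreconnected V) : ∃ A B : Set M, IsOpen A ∧ IsOpen B ∧ A.Nonempty ∧ B.Nonempty ∧
      A ∩ B = ∅ ∧ A ∪ B = V := by
  unfold IsPreconnected at h
  push Not at h
  obtain ⟨u, v, hu, hv, huv, h1, h2, h3⟩ := h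
  refine ⟨V ∩ u, V ∩ v, hV.inter hu, hV.inter hv, h1, h2, ?_, ?_⟩
  · rw [← h3]; ext x; simp; tauto
  · rw [← inter_union_distrib_left]; exact inter_eq_left.2 huv

theorem aux_three {M : Type*} [TopologicalSpace M] (U : Set M) (hU : IsOpen U) (x y z : M)
    (hx : x ∈ U) (hy : y ∈ U) (hz : z ∈ U)
    (hxy : connectedComponentIn U x ≠ connectedComponentIn U y)
    (hxz : connectedComponentIn U x ≠ connectedComponentIn U z)
    (hyz : connectedComponentIn U y ≠ connectedComponentIn U z) :
    ∃ A B C : Set M, IsOpen A ∧ IsOpen B ∧ IsOpen C ∧ A.Nonempty ∧ B.Nonempty ∧ C.Nonempty ∧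
      A ∩ B = ∅ ∧ A ∩ C = ∅ ∧ B ∩ C = ∅ ∧ A ∪ B ∪ C = U := by
  have np : ∀ V ⊆ U, ∀ a ∈ V, ∀ b ∈ V, connectedComponentIn U a ≠ connectedComponentIn U b →
      ¬ IsPreconnected V := by
    intro V hVU a ha b hb hab hpre
    exact hab (connectedComponentIn_eq (hpre.subset_connectedComponentIn ha hVU hb))
  obtain ⟨V, W, hV, hW, nV, nW, hd, hu⟩ := aux_split U hU (np U le_rfl x hx y hy hxy)
  have key : ∀ V W : Set M, IsOpen V → IsOpen W → W.Nonempty → V ∩ W = ∅ → V ∪ W = U →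
      ¬ IsPreconnected V → ∃ A B C : Set M, IsOpen A ∧ IsOpen B ∧ IsOpen C ∧ A.Nonempty ∧
      B.Nonempty ∧ C.Nonempty ∧
      A ∩ B = ∅ ∧ A ∩ C = ∅ ∧ B ∩ C = ∅ ∧ A ∪ B ∪ C = U := by
    intro V W hV hW nW hd hu h
    obtain ⟨A, B, hA, hB, nA, nB, hd', hu'⟩ := aux_split V hV h
    refine ⟨A, B, W, hA, hB, hW, nA, nB, nW, hd', ?_, ?_, by rw [hu', hu]⟩
    · exact subset_empty_iff.1 (hd ▸ inter_subset_inter_left W (hu' ▸ subset_union_left))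
    · exact subset_empty_iff.1 (hd ▸ inter_subset_inter_left W (hu' ▸ subset_union_right))
  have k1 : ¬ IsPreconnected V ∨ ¬ IsPreconnected W := by
    have sV : V ⊆ U := hu ▸ subset_union_left
    have sW : W ⊆ U := hu ▸ subset_union_right
    have hx' := hu.symm ▸ hx
    have hy' := hu.symm ▸ hy
    have hz' := hu.symm ▸ hz
    rcases hx' with h1 | h1 <;> rcases hy' with h2 | h2
    · exact Or.inl (np V sV x h1 y h2 hxy)
    · rcases hz' with h3 | h3
      · exact Or.inl (np V sV x h1 z h3 hxz)
      · exact Or.inr (np W sW y h2 z h3 hyz)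
    · rcases hz' with h3 | h3
      · exact Or.inl (np V sV y h2 z h3 hyz)
      · exact Or.inr (np W sW x h1 z h3 hxz)
    · exact Or.inr (np W sW x h1 y h2 hxy)
  rcases k1 with h | h
  · exact key V W hV hW nW hd hu h
  · exact key W V hW hV nV (by rw [inter_comm, hd]) (by rw [union_comm, hu]) h

theorem aux_order {M : Type*} [TopologicalSpace M] [ConnectedSpace M]
    (Z : Set M) (hZ : IsPreconnected Z) (G : Set (Set M)) (n : ℕ) (L : Fin (n + 1) → Set M)
    (hGo : ∀ U ∈ G, IsOpen U) (hG : ⋃₀ G = Set.univ) (hL : ∀ i, L i ∈ G)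
    (hch : ∀ i j, (L i ∩ L j).Nonempty ↔ |(i : ℤ) - (j : ℤ)| ≤ 1)
    (hs : ∀ i : Fin (n + 1), (i : ℕ) < n → ∀ U ∈ G, U ∉ Set.range L → L i ∩ U = ∅)
    (A B C : Set M) (hA : IsOpen A) (hB : IsOpen B) (hC : IsOpen C)
    (hAB : A ∩ B = ∅) (hBC : B ∩ C = ∅)
    (hU : ∀ x, x ∉ Z ↔ x ∈ A ∨ x ∈ B ∨ x ∈ C)
    (i j k : Fin (n + 1)) (hij : i < j) (hjk : j < k) (hiA : L i ⊆ A) (hjB : L j ⊆ B)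
    (hkC : L k ⊆ C) : False := by
  have ne : ∀ i, (L i).Nonempty := fun i => by
    have := (hch i i).2 (by simp)
    simpa using this
  have disj : ∀ a b : Fin (n + 1), a < j → j < b → ∀ x, x ∈ L a → x ∈ L b → False := by
    intro a b ha hb x hxa hxb
    have := (hch a b).1 ⟨x, hxa, hxb⟩
    rw [abs_le] at this
    have h1 : (a : ℕ) < j := ha
    have h2 : (j : ℕ) < b := hb
    omega
  have hkn : (k : ℕ) < n + 1 := k.2
  have hjk' : (j : ℕ) < k := hjk
  obtain ⟨p, hp⟩ := ne i
  obtain ⟨q, hq⟩ := ne k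
  refine aux_conn Z B (A ∪ C) (⋃ a : {a : Fin (n+1) // a < j}, L a)
    ((⋃ b : {b : Fin (n+1) // j < b}, L b) ∪ ⋃₀ {U | U ∈ G ∧ U ∉ Set.range L})
    hZ hB (hA.union hC) ?_ ?_ ?_ ?_ ?_ ?_ ?_ p ⟨Or.inl (hiA hp), ?_⟩ q ⟨Or.inr (hkC hq), ?_⟩
  · rw [inter_union_distrib_left, inter_comm, hAB, hBC, union_empty]
  · intro x
    have := hU x
    simp only [mem_union]
    tauto
  · ext x
    have := hU x
    simp only [mem_inter_iff, mem_empty_iff_false, iff_false]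
    tauto
  · exact isOpen_iUnion fun a => hGo _ (hL _)
  · exact (isOpen_iUnion fun a => hGo _ (hL _)).union (isOpen_sUnion fun U h => hGo U h.1)
  · rw [eq_empty_iff_forall_notMem]
    rintro x ⟨h1, h2 | h2⟩
    · obtain ⟨⟨a, ha⟩, hxa⟩ := mem_iUnion.1 h1
      obtain ⟨⟨b, hb⟩, hxb⟩ := mem_iUnion.1 h2
      exact disj a b ha hb x hxa hxb
    · obtain ⟨⟨a, ha⟩, hxa⟩ := mem_iUnion.1 h1
      obtain ⟨U, ⟨hUG, hUL⟩, hxU⟩ := h2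
      have ha' : (a : ℕ) < j := ha
      have := hs a (by omega) U hUG hUL
      exact (eq_empty_iff_forall_notMem.1 this) x ⟨hxa, hxU⟩
  · intro x hx
    obtain ⟨U, hUG, hxU⟩ : x ∈ ⋃₀ G := hG ▸ mem_univ x
    by_cases hUL : U ∈ Set.range L
    · obtain ⟨a, rfl⟩ := hUL
      rcases lt_trichotomy a j with h | h | h
      · exact Or.inl (mem_iUnion.2 ⟨⟨a, h⟩, hxU⟩)
      · subst h; exact absurd (hjB hxU) hx
      · exact Or.inr (Or.inl (mem_iUnion.2 ⟨⟨a, h⟩, hxU⟩))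
    · exact Or.inr (Or.inr ⟨U, ⟨hUG, hUL⟩, hxU⟩)
  · exact mem_iUnion.2 ⟨⟨i, hij⟩, hp⟩
  · exact Or.inl (mem_iUnion.2 ⟨⟨k, hjk⟩, hq⟩)

theorem aux_disj {M : Type*} (A B : Set M) (h : A ∩ B = ∅) (S : Set M) (hS : S.Nonempty)
    (h1 : S ⊆ A) (h2 : S ⊆ B) : False := by
  obtain ⟨x, hx⟩ := hS
  exact eq_empty_iff_forall_notMem.1 h x ⟨h1 hx, h2 hx⟩

theorem stmt6 (M : Type*) [MetricSpace M] [CompactSpace M] [ConnectedSpace M]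
    (hM : AlmostChainable M) : ¬ IsTriod (Set.univ : Set M) := by
  rintro ⟨-, Z, ⟨hZc, hZ⟩, -, x, hx, y, hy, z, hz, hxy, hxz, hyz⟩
  have hUo : IsOpen (univ \ Z) := isOpen_univ.sdiff hZc.isClosed
  obtain ⟨A, B, C, hA, hB, hC, ⟨a, ha⟩, ⟨b, hb⟩, ⟨c, hc⟩, hAB, hAC, hBC, hU⟩ :=
    aux_three _ hUo x y z hx hy hz hxy hxz hyz
  have hU' : ∀ x, x ∉ Z ↔ x ∈ A ∨ x ∈ B ∨ x ∈ C := by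
    intro x
    have : x ∈ A ∪ B ∪ C ↔ x ∈ univ \ Z := by rw [hU]
    simp only [mem_union, mem_diff, mem_univ, true_and] at this
    tauto
  obtain ⟨ea, ea0, hea⟩ := Metric.isOpen_iff.1 hA a ha
  obtain ⟨eb, eb0, heb⟩ := Metric.isOpen_iff.1 hB b hb
  obtain ⟨ec, ec0, hec⟩ := Metric.isOpen_iff.1 hC c hc
  set e := min ea (min eb ec) with he
  have e0 : 0 < e := lt_min ea0 (lt_min eb0 ec0)
  have e1 : e ≤ ea := min_le_left _ _
  have e2 : e ≤ eb := (min_le_right _ _).trans (min_le_left _ _)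
  have e3 : e ≤ ec := (min_le_right _ _).trans (min_le_right _ _)
  obtain ⟨G, n, L, hG, hcov, hL, hch, hs, hd⟩ := hM (e / 2) (by linarith)
  have near : ∀ x : M, ∃ i, L i ⊆ Metric.ball x e := by
    intro x
    obtain ⟨i, y, hy, hxy⟩ := hd x
    refine ⟨i, fun w hw => ?_⟩
    have h1 : dist w y ≤ Metric.diam (L i) :=
      Metric.dist_le_diam_of_mem (Metric.isBounded_of_compactSpace) hw hy
    have h2 := (hG _ (hL i)).2
    have h3 := dist_triangle w y x
    rw [dist_comm y x] at h3
    rw [Metric.mem_ball]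
    linarith
  obtain ⟨i, hi⟩ := near a
  obtain ⟨j, hj⟩ := near b
  obtain ⟨k, hk⟩ := near c
  replace hi : L i ⊆ A := hi.trans ((Metric.ball_subset_ball e1).trans hea)
  replace hj : L j ⊆ B := hj.trans ((Metric.ball_subset_ball e2).trans heb)
  replace hk : L k ⊆ C := hk.trans ((Metric.ball_subset_ball e3).trans hec)
  have ne : ∀ i, (L i).Nonempty := fun i => by
    have := (hch i i).2 (by simp)
    simpa using this
  have ij : i ≠ j := by rintro rfl; exact aux_disj A B hAB _ (ne _) hi hj
  have ik : i ≠ k := by rintro rfl; exact aux_disj A C hAC _ (ne _) hi hk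
  have jk : j ≠ k := by rintro rfl; exact aux_disj B C hBC _ (ne _) hj hk
  have main := aux_order Z hZ.isPreconnected G n L (fun U h => (hG U h).1) hcov hL hch hs
  have hBA := (inter_comm B A).trans hAB
  have hCA := (inter_comm C A).trans hAC
  have hCB := (inter_comm C B).trans hBC
  rcases lt_or_gt_of_ne ij with h1 | h1 <;> rcases lt_or_gt_of_ne ik with h2 | h2 <;>
    rcases lt_or_gt_of_ne jk with h3 | h3
  · exact main A B C hA hB hC hAB hBC hU' i j k h1 h3 hi hj hk
  · exact main A C B hA hC hB hAC hCB (fun x => (hU' x).trans (by tauto)) i k j h2 h3 hi hk hj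
  · exact absurd (h1.trans h3) h2.asymm
  · exact main C A B hC hA hB hCA hAB (fun x => (hU' x).trans (by tauto)) k i j h2 h1 hk hi hj
  · exact main B A C hB hA hC hBA hAC (fun x => (hU' x).trans (by tauto)) j i k h1 h2 hj hi hk
  · exact absurd (h3.trans h1) h2.asymm
  · exact main B C A hB hC hA hBC hCA (fun x => (hU' x).trans (by tauto)) j k i h3 h2 hj hk hi
  · exact main C B A hC hB hA hCB hBA (fun x => (hU' x).trans (by tauto)) k j i h3 h1 hk hj hi
end

section
/- Every almost chainable metric continuum is irreducible between some two of its points. -/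
open Metric Set Function

theorem aux_dirInter {X ι : Type*} [MetricSpace X] [Nonempty ι] {V : ι → Set X}
    (hV : Directed (· ⊇ ·) V) (hc : ∀ i, IsCompact (V i)) (hcon : ∀ i, IsPreconnected (V i)) :
    IsPreconnected (⋂ i, V i) := by
  rw [isPreconnected_iff_subset_of_fully_disjoint_closed
    (isClosed_iInter fun i => (hc i).isClosed)]
  intro u v hu hv hs hd
  obtain ⟨U, W, hU, hW, huU, hvW, hUW⟩ := normal_separation hu hv hd
  obtain ⟨i, hi⟩ := exists_subset_nhds_of_isCompact (U := U ∪ W) hV hc (fun x hx =>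
    (hU.union hW).mem_nhds (union_subset_union huU hvW (hs hx)))
  rcases IsPreconnected.subset_or_subset hU hW hUW hi (hcon i) with h | h
  · left
    intro x hx
    rcases hs hx with h1 | h1
    · exact h1
    · exact absurd (hvW h1) (disjoint_left.1 hUW (h (mem_iInter.1 hx i)))
  · right
    intro x hx
    rcases hs hx with h1 | h1
    · exact absurd (h (mem_iInter.1 hx i)) (disjoint_left.1 hUW (huU h1))
    · exact h1

/-- If `D` is connected, `P`, `Q` open disjoint sets partitioning the complement of `D`, then
the complement of `Q` is connected. -/
theorem aux_compl {X : Type*} [TopologicalSpace X] [ConnectedSpace X] {D P Q : Set X}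
    (hD : IsConnected D) (hP : IsOpen P) (hQ : IsOpen Q) (hPQ : Disjoint P Q)
    (h : Dᶜ = P ∪ Q) : IsConnected Qᶜ := by
  have hDQ : D ⊆ Qᶜ := by
    intro x hx hxQ
    have : x ∈ Dᶜ := h ▸ Or.inr hxQ
    exact this hx
  have hDP : D ⊆ Pᶜ := by
    intro x hx hxQ
    have : x ∈ Dᶜ := h ▸ Or.inl hxQ
    exact this hx
  refine ⟨hD.nonempty.mono hDQ, ?_⟩
  -- key
  have key : ∀ u v : Set X, IsClosed u → IsClosed v → Qᶜ ⊆ u ∪ v → Disjoint u v → D ⊆ u →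
      Qᶜ ⊆ u := by
    intro u v hu hv hs hd hDu
    have hcl : IsClosed (v ∩ Qᶜ) := hv.inter hQ.isClosed_compl
    have hop : IsOpen (v ∩ Qᶜ) := by
      have : v ∩ Qᶜ = uᶜ ∩ P := by
        ext x
        constructor
        · rintro ⟨h1, h2⟩
          refine ⟨fun h3 => disjoint_left.1 hd h3 h1, ?_⟩
          have : x ∈ Dᶜ := fun h3 => disjoint_left.1 hd (hDu h3) h1
          rw [h] at this
          exact this.resolve_right h2
        · rintro ⟨h1, h2⟩
          have h3 : x ∈ Qᶜ := fun h3 => disjoint_left.1 hPQ h2 h3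
          exact ⟨(hs h3).resolve_left h1, h3⟩
      rw [this]
      exact hu.isOpen_compl.inter hP
    rcases isClopen_iff.1 ⟨hcl, hop⟩ with h0 | h0
    · intro x hx
      rcases hs hx with h1 | h1
      · exact h1
      · have : x ∈ v ∩ Qᶜ := ⟨h1, hx⟩
        rw [h0] at this
        exact this.elim
    · obtain ⟨d, hd'⟩ := hD.nonempty
      have : d ∈ v ∩ Qᶜ := h0 ▸ mem_univ d
      exact absurd this.1 (disjoint_left.1 hd (hDu hd'))
  rw [isPreconnected_iff_subset_of_fully_disjoint_closed hQ.isClosed_compl]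
  intro u v hu hv hs hd
  have := (isPreconnected_iff_subset_of_disjoint_closed.1 hD.isPreconnected) u v hu hv
    (hDQ.trans hs) (by rw [hd.inter_eq, inter_empty])
  rcases this with h1 | h1
  · exact Or.inl (key u v hu hv hs hd h1)
  · exact Or.inr (key v u hv hu (by rwa [union_comm]) hd.symm h1)

theorem aux_claim {M : Type*} [MetricSpace M] [CompactSpace M] [ConnectedSpace M] {A : Set M}
    (hA : IsSubcontinuum A)
    (hstar : ∀ K₁ K₂ : Set M, IsSubcontinuum K₁ → IsSubcontinuum K₂ → A ⊆ K₁ → A ⊆ K₂ →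
      K₁ ∪ K₂ = univ → K₁ = univ ∨ K₂ = univ) :
    ∃ q : M, ∀ K : Set M, IsSubcontinuum K → A ⊆ K → q ∈ K → K = univ := by
  by_contra! hcon
  obtain ⟨a, ha⟩ := hA.2.nonempty
  -- the family of proper continua containing A
  let ι := {K : Set M // IsSubcontinuum K ∧ A ⊆ K ∧ K ≠ univ}
  have hsup : ∀ i j : ι, ∃ k : ι, i.1 ⊆ k.1 ∧ j.1 ⊆ k.1 := by
    rintro ⟨K, hK, hAK, hKu⟩ ⟨L, hL, hAL, hLu⟩
    refine ⟨⟨K ∪ L, ⟨hK.1.union hL.1, hK.2.union ⟨a, hAK ha, hAL ha⟩ hL.2⟩,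
      hAK.trans subset_union_left, ?_⟩, subset_union_left, subset_union_right⟩
    intro h
    rcases hstar K L hK hL hAK hAL h with h | h
    · exact hKu h
    · exact hLu h
  haveI : Nonempty ι := by
    obtain ⟨K, h1, h2, h3, h4⟩ := hcon a
    exact ⟨⟨K, h1, h2, h4⟩⟩
  let V : ι → Set M := fun i => closure (i.1)ᶜ
  have hVc : ∀ i, IsCompact (V i) := fun i => isClosed_closure.isCompact
  have hVne : ∀ i, (V i).Nonempty := fun i =>
    (nonempty_compl.2 i.2.2.2).mono subset_closure
  have hVd : Directed (· ⊇ ·) V := by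
    intro i j
    obtain ⟨k, h1, h2⟩ := hsup i j
    exact ⟨k, closure_mono (compl_subset_compl.2 h1), closure_mono (compl_subset_compl.2 h2)⟩
  have hVcon : ∀ i, IsPreconnected (V i) := by
    rintro ⟨K, hK, hAK, hKu⟩
    apply IsPreconnected.closure
    change IsPreconnected Kᶜ
    intro u v hu hv hs hu' hv'
    by_contra hne
    rw [not_nonempty_iff_eq_empty] at hne
    have hop : IsOpen Kᶜ := hK.1.isClosed.isOpen_compl
    have hdis : Disjoint (Kᶜ ∩ u) (Kᶜ ∩ v) := by
      rw [disjoint_left]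
      rintro x ⟨h1, h2⟩ ⟨_, h3⟩
      have : x ∈ Kᶜ ∩ (u ∩ v) := ⟨h1, h2, h3⟩
      rw [hne] at this
      exact this
    have heq : Kᶜ = (Kᶜ ∩ u) ∪ (Kᶜ ∩ v) := by
      rw [← inter_union_distrib_left, inter_eq_left.2 hs]
    have c1 := aux_compl hK.2 (hop.inter hu) (hop.inter hv) hdis heq
    have c2 := aux_compl hK.2 (hop.inter hv) (hop.inter hu) hdis.symm (by rwa [union_comm])
    have s1 : ∀ w : Set M, A ⊆ (Kᶜ ∩ w)ᶜ := fun w x hx h => h.1 (hAK hx)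
    rcases hstar _ _ ⟨(hop.inter hv).isClosed_compl.isCompact, c1⟩
      ⟨(hop.inter hu).isClosed_compl.isCompact, c2⟩ (s1 v) (s1 u)
      (by rw [← compl_inter, hdis.symm.inter_eq, compl_empty]) with h | h
    · rw [compl_univ_iff] at h
      exact hv'.ne_empty h
    · rw [compl_univ_iff] at h
      exact hu'.ne_empty h
  have hRcon : IsPreconnected (⋂ i, V i) := aux_dirInter hVd hVc hVcon
  obtain ⟨q, hq⟩ : (⋂ i, V i).Nonempty :=
    IsCompact.nonempty_iInter_of_directed_nonempty_isCompact_isClosed V hVd hVne hVc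
      (fun i => (hVc i).isClosed)
  have hRcl : IsClosed (⋂ i, V i) := isClosed_iInter fun i => isClosed_closure
  obtain ⟨K, hK, hAK, hqK, hKu⟩ := hcon q
  have hDcon : IsSubcontinuum (K ∪ ⋂ i, V i) :=
    ⟨hK.1.union hRcl.isCompact, hK.2.union ⟨q, hqK, hq⟩ ⟨⟨q, hq⟩, hRcon⟩⟩
  by_cases hDu : (K ∪ ⋂ i, V i) = univ
  · -- R has nonempty interior
    let C : Set M → Set M := fun b => closure (connectedComponentIn bᶜ a)
    have hcb := TopologicalSpace.countable_countableBasis M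
    let S : Set (Set M) := {b ∈ TopologicalSpace.countableBasis M | A ⊆ bᶜ}
    have hSc : S.Countable := hcb.mono (fun b hb => hb.1)
    have hSb : ∀ b ∈ S, IsSubcontinuum (C b) ∧ A ⊆ C b ∧ C b ≠ univ := by
      rintro b ⟨hb, hAb⟩
      have hbo := TopologicalSpace.isOpen_of_mem_countableBasis hb
      have hbn := TopologicalSpace.nonempty_of_mem_countableBasis hb
      have hsub : C b ⊆ bᶜ :=
        closure_minimal (connectedComponentIn_subset _ _) hbo.isClosed_compl
      refine ⟨⟨isClosed_closure.isCompact,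
        (isConnected_connectedComponentIn_iff.2 (hAb ha)).closure⟩,
        (hA.2.isPreconnected.subset_connectedComponentIn ha hAb).trans subset_closure, ?_⟩
      intro h
      obtain ⟨x, hx⟩ := hbn
      exact hsub (h ▸ mem_univ x) hx
    have hcov : ⋃ b ∈ S, C b = univ := by
      rw [eq_univ_iff_forall]
      intro x
      obtain ⟨L, hL, hAL, hxL, hLu⟩ := hcon x
      obtain ⟨y, hy⟩ := nonempty_compl.2 hLu
      obtain ⟨b, hb, hyb, hbL⟩ := (TopologicalSpace.isBasis_countableBasis M).exists_subset_of_mem_open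
        hy hL.1.isClosed.isOpen_compl
      have hLb : L ⊆ bᶜ := fun z hz hzb => hbL hzb hz
      refine mem_biUnion (x := b) ⟨hb, hAL.trans hLb⟩ (subset_closure ?_)
      exact hL.2.isPreconnected.subset_connectedComponentIn (hAL ha) hLb hxL
    have hdense := dense_biUnion_interior_of_closed (fun b _ => isClosed_closure) hSc hcov
    obtain ⟨x, hxK, hx⟩ := hdense.inter_open_nonempty Kᶜ hK.1.isClosed.isOpen_compl
      (nonempty_compl.2 hKu)
    simp only [mem_iUnion] at hx
    obtain ⟨b, hb, hxb⟩ := hx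
    have hxR : x ∈ ⋂ i, V i := by
      have : x ∈ K ∪ ⋂ i, V i := hDu ▸ mem_univ x
      exact this.resolve_left hxK
    have hxV : x ∈ closure (C b)ᶜ := mem_iInter.1 hxR ⟨C b, hSb b hb⟩
    rw [closure_compl] at hxV
    exact hxV hxb
  · obtain ⟨x, hx⟩ := nonempty_compl.2 hDu
    have hxR : x ∉ ⋂ i, V i := fun h => hx (Or.inr h)
    simp only [mem_iInter, not_forall] at hxR
    obtain ⟨i, hi⟩ := hxR
    have hK' : IsSubcontinuum (K ∪ V i) :=
      ⟨hK.1.union (hVc i), hK.2.union ⟨q, hqK, mem_iInter.1 hq i⟩ ⟨hVne i, hVcon i⟩⟩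
    rcases hstar i.1 (K ∪ V i) i.2.1 hK' i.2.2.1 (hAK.trans subset_union_left) (by
      rw [eq_univ_iff_forall]
      intro y
      by_cases hy : y ∈ i.1
      · exact Or.inl hy
      · exact Or.inr (Or.inr (subset_closure hy))) with h | h
    · exact i.2.2.2 h
    · have : x ∈ K ∪ V i := h ▸ mem_univ x
      rcases this with h | h
      · exact hx (Or.inl h)
      · exact hi h

theorem aux_scale {M : Type*} [MetricSpace M] [CompactSpace M] [ConnectedSpace M]
    (hM : AlmostChainable M) (ε : ℝ) (hε : 0 < ε) :
    ∃ P Q : Set M, P.Nonempty ∧ Q.Nonempty ∧ ∀ K : Set M, IsPreconnected K →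
      (K ∩ P).Nonempty → (K ∩ Q).Nonempty → ∀ x, ∃ z ∈ K, dist x z < 2 * ε := by
  obtain ⟨G, n, L, hG, hcov, hLG, hL, hLU, hd⟩ := hM ε hε
  have hne : ∀ i, (L i).Nonempty := fun i => by
    have := (hL i i).2 (by simp)
    rwa [inter_self] at this
  refine ⟨L 0, L (Fin.last n), hne _, hne _, ?_⟩
  intro K hK h0 h1
  have hit : ∀ j, (K ∩ L j).Nonempty := by
    intro j
    by_contra hj
    have hj0 : j ≠ 0 := fun h => hj (h ▸ h0)
    have hjn : j ≠ Fin.last n := fun h => hj (h ▸ h1)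
    have hjlt : (j : ℕ) < n := by
      have := Fin.val_ne_of_ne hjn
      have := j.2
      simp at *
      omega
    have hjpos : 0 < (j : ℕ) := by
      have := Fin.val_ne_of_ne hj0
      simp at this
      exact Nat.pos_of_ne_zero (by simpa using hj0)
    let u : Set M := ⋃ i : {i : Fin (n+1) // i < j}, L i
    let v : Set M := ⋃₀ {U ∈ G | ∀ i, U = L i → j < i}
    have hu : IsOpen u := isOpen_iUnion fun i => (hG _ (hLG _)).1
    have hv : IsOpen v := isOpen_sUnion fun U hU => (hG _ hU.1).1
    have hdis : ∀ x, x ∈ u → x ∈ v → False := by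
      intro x hx hx'
      obtain ⟨⟨i, hi⟩, hxi⟩ := mem_iUnion.1 hx
      obtain ⟨U, ⟨hUG, hU⟩, hxU⟩ := hx'
      have hi' : (i : ℕ) < j := hi
      by_cases hr : U ∈ range L
      · obtain ⟨k, rfl⟩ := hr
        have hk : (j : ℕ) < k := hU k rfl
        have := (hL i k).1 ⟨x, hxi, hxU⟩
        rw [abs_le] at this
        omega
      · have := hLU i (by omega) U hUG hr
        have hx2 : x ∈ L i ∩ U := ⟨hxi, hxU⟩
        rw [this] at hx2
        exact hx2
    have hsub : K ⊆ u ∪ v := by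
      intro x hx
      by_contra hxn
      obtain ⟨U, hUG, hxU⟩ : x ∈ ⋃₀ G := hcov ▸ mem_univ x
      apply hxn
      right
      refine ⟨U, ⟨hUG, ?_⟩, hxU⟩
      rintro i rfl
      rcases lt_trichotomy i j with h | h | h
      · exact absurd (Or.inl (mem_iUnion.2 ⟨⟨i, h⟩, hxU⟩)) hxn
      · exact absurd ⟨x, hx, h ▸ hxU⟩ hj
      · exact h
    obtain ⟨x, hxK, hx⟩ := h0
    obtain ⟨y, hyK, hy⟩ := h1
    have hyv : y ∈ v := by
      refine ⟨_, ⟨hLG (Fin.last n), ?_⟩, hy⟩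
      intro i hi
      by_contra hij
      have h2 : (L i ∩ L (Fin.last n)).Nonempty := ⟨y, hi ▸ hy, hy⟩
      have h3 := (hL _ _).1 h2
      have h4 : (i : ℕ) ≤ j := not_lt.1 hij
      -- L i = L last, so i meets last; use first link
      by_cases hi0 : (i : ℕ) = 0
      · simp [abs_le] at h3
        omega
      · have hlt : (i : ℕ) - 1 < n + 1 := by omega
        have h5 : (L ⟨(i : ℕ) - 1, hlt⟩ ∩ L i).Nonempty := by
          rw [hL, abs_le]
          constructor <;> simp <;> omega
        rw [← hi, hL, abs_le] at h5
        simp at h5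
        omega
    obtain ⟨z, _, hz1, hz2⟩ := hK u v hu hv hsub
      ⟨x, hxK, mem_iUnion.2 ⟨⟨0, hjpos⟩, hx⟩⟩ ⟨y, hyK, hyv⟩
    exact hdis z hz1 hz2
  intro x
  obtain ⟨i, y, hy, hxy⟩ := hd x
  obtain ⟨z, hzK, hz⟩ := hit i
  refine ⟨z, hzK, ?_⟩
  have h1 : dist y z ≤ Metric.diam (L i) :=
    Metric.dist_le_diam_of_mem (Metric.isBounded_of_compactSpace) hy hz
  have h2 := (hG _ (hLG i)).2
  have := dist_triangle x y z
  linarith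

theorem aux_fin {M : Type*} [MetricSpace M] [CompactSpace M] [ConnectedSpace M]
    (F : Filter ℕ) [F.NeBot] (P Q : ℕ → Set M) (hP : ∀ k, (P k).Nonempty)
    (hQ : ∀ k, (Q k).Nonempty)
    (hbig : ∀ K : Set M, IsSubcontinuum K → K ≠ univ →
      ∀ᶠ k in F, ¬ ((K ∩ P k).Nonempty ∧ (K ∩ Q k).Nonempty))
    (A B : Set M) (hA : IsSubcontinuum A) (hB : IsSubcontinuum B) (hAu : A ≠ univ)
    (hBu : B ≠ univ) (hAB : A ∪ B = univ) (hAP : ∀ᶠ k in F, (A ∩ P k).Nonempty) :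
    ∃ p q : M, ∀ K : Set M, IsSubcontinuum K → p ∈ K → q ∈ K → K = Set.univ := by
  have hit : ∀ (C D S : Set M), C ∪ D = univ → S.Nonempty → ¬ (C ∩ S).Nonempty →
      (D ∩ S).Nonempty := by
    rintro C D S hCD ⟨x, hx⟩ hn
    have : x ∈ C ∪ D := hCD ▸ mem_univ x
    rcases this with h | h
    · exact absurd ⟨x, h, hx⟩ hn
    · exact ⟨x, h, hx⟩
  have hAQ : ∀ᶠ k in F, ¬ (A ∩ Q k).Nonempty := by
    filter_upwards [hAP, hbig A hA hAu] with k h1 h2 h3 using h2 ⟨h1, h3⟩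
  have hBQ : ∀ᶠ k in F, (B ∩ Q k).Nonempty := by
    filter_upwards [hAQ] with k h1 using hit A B _ hAB (hQ k) h1
  have hBP : ∀ᶠ k in F, ¬ (B ∩ P k).Nonempty := by
    filter_upwards [hBQ, hbig B hB hBu] with k h1 h2 h3 using h2 ⟨h3, h1⟩
  obtain ⟨q, hq⟩ := aux_claim hA (by
    intro K₁ K₂ h1 h2 hA1 hA2 hu
    by_contra! hn
    have : ∀ᶠ k in F, False := by
      filter_upwards [hAP, hbig K₁ h1 hn.1, hbig K₂ h2 hn.2] with k a b c
      have b' : ¬ (K₁ ∩ Q k).Nonempty := fun h => b ⟨a.mono (inter_subset_inter_left _ hA1), h⟩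
      exact c ⟨a.mono (inter_subset_inter_left _ hA2), hit _ _ _ hu (hQ k) b'⟩
    exact this.exists.elim fun _ h => h)
  obtain ⟨p, hp⟩ := aux_claim hB (by
    intro K₁ K₂ h1 h2 hA1 hA2 hu
    by_contra! hn
    have : ∀ᶠ k in F, False := by
      filter_upwards [hBQ, hbig K₁ h1 hn.1, hbig K₂ h2 hn.2] with k a b c
      have b' : ¬ (K₁ ∩ P k).Nonempty := fun h => b ⟨h, a.mono (inter_subset_inter_left _ hA1)⟩
      exact c ⟨hit _ _ _ hu (hP k) b', a.mono (inter_subset_inter_left _ hA2)⟩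
    exact this.exists.elim fun _ h => h)
  refine ⟨p, q, fun K hK hpK hqK => ?_⟩
  by_contra hKu
  have hqB : q ∈ B := by
    have : q ∈ A ∪ B := hAB ▸ mem_univ q
    exact this.resolve_left fun h => hAu (hq A hA subset_rfl h)
  have hpA : p ∈ A := by
    have : p ∈ A ∪ B := hAB ▸ mem_univ p
    exact this.resolve_right fun h => hBu (hp B hB subset_rfl h)
  have e1 : A ∪ K = univ := hq _ ⟨hA.1.union hK.1, hA.2.union ⟨p, hpA, hpK⟩ hK.2⟩
    subset_union_left (Or.inr hqK)
  have e2 : B ∪ K = univ := hp _ ⟨hB.1.union hK.1, hB.2.union ⟨q, hqB, hqK⟩ hK.2⟩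
    subset_union_left (Or.inr hpK)
  have : ∀ᶠ k in F, False := by
    filter_upwards [hAQ, hBP, hbig K hK hKu] with k a b c
    exact c ⟨hit _ _ _ e2 (hP k) b, hit _ _ _ e1 (hQ k) a⟩
  exact this.exists.elim fun _ h => h

theorem stmt8 (M : Type*) [MetricSpace M] [CompactSpace M] [ConnectedSpace M]
    (hM : AlmostChainable M) :
    ∃ p q : M, ∀ K : Set M, IsSubcontinuum K → p ∈ K → q ∈ K → K = Set.univ := by
  by_cases hdec : ∃ A B : Set M, IsSubcontinuum A ∧ IsSubcontinuum B ∧ A ≠ univ ∧ B ≠ univ ∧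
      A ∪ B = univ
  · obtain ⟨A, B, hA, hB, hAu, hBu, hAB⟩ := hdec
    choose P Q hP hQ hPQ using fun k : ℕ => aux_scale hM (1 / ((k : ℝ) + 1)) (by positivity)
    let F : Ultrafilter ℕ := Filter.hyperfilter ℕ
    have hbig : ∀ K : Set M, IsSubcontinuum K → K ≠ univ →
        ∀ᶠ k in (F : Filter ℕ), ¬ ((K ∩ P k).Nonempty ∧ (K ∩ Q k).Nonempty) := by
      intro K hK hKu
      obtain ⟨x, hx⟩ := nonempty_compl.2 hKu
      obtain ⟨δ, hδ, hball⟩ := Metric.isOpen_iff.1 hK.1.isClosed.isOpen_compl x hx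
      have hev : ∀ᶠ k : ℕ in (F : Filter ℕ), 1 / ((k : ℝ) + 1) < δ / 2 := by
        have := (tendsto_one_div_add_atTop_nhds_zero_nat (𝕜 := ℝ)).eventually
          (gt_mem_nhds (half_pos hδ))
        exact Nat.hyperfilter_le_atTop this
      filter_upwards [hev] with k hk
      rintro ⟨h1, h2⟩
      obtain ⟨z, hz, hxz⟩ := hPQ k K hK.2.isPreconnected h1 h2 x
      refine hball (a := z) ?_ hz
      rw [Metric.mem_ball, dist_comm]
      linarith
    by_cases h : ∀ᶠ k in (F : Filter ℕ), (A ∩ P k).Nonempty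
    · exact aux_fin F P Q hP hQ hbig A B hA hB hAu hBu hAB h
    · rw [← Ultrafilter.eventually_not] at h
      refine aux_fin F P Q hP hQ hbig B A hB hA hBu hAu (by rwa [union_comm]) ?_
      filter_upwards [h] with k hk
      obtain ⟨x, hx⟩ := hP k
      have : x ∈ A ∪ B := hAB ▸ mem_univ x
      rcases this with h | h
      · exact absurd ⟨x, h, hx⟩ hk
      · exact ⟨x, h, hx⟩
  · push Not at hdec
    obtain ⟨p⟩ := (inferInstance : Nonempty M)
    obtain ⟨q, hq⟩ := aux_claim (A := {p}) ⟨isCompact_singleton, isConnected_singleton⟩ (by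
      intro K₁ K₂ h1 h2 _ _ hu
      by_contra! hn
      exact hdec K₁ K₂ h1 h2 hn.1 hn.2 hu)
    exact ⟨p, q, fun K hK hp hq' => hq K hK (singleton_subset_iff.2 hp) hq'⟩
end

section
/- Every π-like metric continuum X is homeomorphic to the inverse limit of an inverse sequence {Pᵢ; π_{ij}} with surjective bonding maps π_{ij} and with each Pᵢ a polyhedron belonging to π. -/
open Metric Set Function

open Filter Topology in
/-- Local (neighbourhood) retract property. -/
def NR10 {E : Type*} [TopologicalSpace E] (K : Set E) : Prop :=
  ∃ r : E → E, (∀ x ∈ K, r x = x) ∧ ∀ x ∈ K, ∀ᶠ y in 𝓝 x, r y ∈ K ∧ ContinuousAt r y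

open Filter Topology in
lemma nr10_convex {E : Type*} [NormedAddCommGroup E] [InnerProductSpace ℝ E]
    {K : Set E} (hK : IsCompact K) (hc : Convex ℝ K) : NR10 K := by
  rcases K.eq_empty_or_nonempty with rfl | hne
  · exact ⟨id, by simp, by simp⟩
  choose r hr hr' using exists_norm_eq_iInf_of_complete_convex hne hK.isComplete hc
  have hin : ∀ u, ∀ w ∈ K, inner ℝ (u - r u) (w - r u) ≤ 0 := fun u =>
    (norm_eq_iInf_iff_real_inner_le_zero hc (hr u)).1 (hr' u)
  have hlip : LipschitzWith 1 r := by
    refine LipschitzWith.of_dist_le_mul fun x y => ?_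
    have h1 := hin x (r y) (hr y)
    have h2 := hin y (r x) (hr x)
    have h3 : inner ℝ (r x - r y) (r x - r y) ≤ inner ℝ (x - y) (r x - r y) := by
      simp only [inner_sub_left, inner_sub_right] at *
      linarith
    have h4 := real_inner_le_norm (x - y) (r x - r y)
    rw [real_inner_self_eq_norm_sq] at h3
    rw [dist_eq_norm, dist_eq_norm]
    by_contra! h
    simp only [NNReal.coe_one, one_mul] at h
    nlinarith [norm_nonneg (x - y)]
  refine ⟨r, fun x hx => ?_, fun x hx => Eventually.of_forall fun y => ⟨hr y, hlip.continuous.continuousAt⟩⟩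
  have := hin x x hx
  have h0 := real_inner_self_nonpos.1 this
  exact (sub_eq_zero.1 h0).symm

open Filter Topology in
lemma cont_glue10 {E F : Type*} [TopologicalSpace E] [TopologicalSpace F] {a b : E → ℝ}
    (ha : Continuous a) (hb : Continuous b) {f g : E → F} {y : E}
    (hf : ContinuousAt f y) (hg : ContinuousAt g y) (h : a y = b y → f y = g y) :
    ContinuousAt (fun z => if a z ≤ b z then f z else g z) y := by
  rcases lt_trichotomy (a y) (b y) with h1 | h1 | h1
  · refine hf.congr ?_
    filter_upwards [ha.continuousAt.eventually_lt hb.continuousAt h1] with z hz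
    simp [hz.le]
  · have e := h h1
    unfold ContinuousAt
    simp only [h1, le_refl, if_true]
    refine Tendsto.if' hf ?_
    rw [e]; exact hg
  · refine hg.congr ?_
    filter_upwards [hb.continuousAt.eventually_lt ha.continuousAt h1] with z hz
    simp [hz]

open Filter Topology in
lemma nr10_ext {E : Type*} [NormedAddCommGroup E] [InnerProductSpace ℝ E]
    [FiniteDimensional ℝ E] {A T : Set E} (hA : IsClosed A) (hT : IsClosed T) {r : E → E}
    (hr : ContinuousOn r T) (h : ∀ x ∈ A ∩ T, r x = x) :
    ∃ k : E → E, Continuous k ∧ (∀ x ∈ A, k x = x) ∧ ∀ x ∈ T, k x = r x := by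
  classical
  let f : E → E := fun x => if x ∈ A then x else r x
  have hfA : ∀ x ∈ A, f x = x := fun x hx => by simp [f, hx]
  have hfT : ∀ x ∈ T, f x = r x := fun x hx => by
    by_cases hxA : x ∈ A
    · simp [f, hxA, h x ⟨hxA, hx⟩]
    · simp [f, hxA]
  have hf : ContinuousOn f (A ∪ T) :=
    ContinuousOn.union_of_isClosed (continuousOn_id.congr hfA) (hr.congr hfT) hA hT
  have : TietzeExtension E := RCLike.instTietzeExtensionTVS (𝕜 := ℝ)
  obtain ⟨g, hg⟩ := ContinuousMap.exists_restrict_eq (hA.union hT)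
    (⟨(A ∪ T).domRestrict f, hf.domRestrict⟩ : C(↥(A ∪ T), E))
  have hg' : ∀ x ∈ A ∪ T, g x = f x := fun x hx => congr($hg ⟨x, hx⟩)
  exact ⟨g, g.continuous, fun x hx => (hg' x (Or.inl hx)).trans (hfA x hx),
    fun x hx => (hg' x (Or.inr hx)).trans (hfT x hx)⟩

open Filter Topology in
lemma nr10_union {E : Type*} [NormedAddCommGroup E] [InnerProductSpace ℝ E]
    [FiniteDimensional ℝ E] {A B : Set E} (hA : IsCompact A) (hB : IsCompact B)
    (nA : NR10 A) (nB : NR10 B) (nC : NR10 (A ∩ B)) : NR10 (A ∪ B) := by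
  rcases A.eq_empty_or_nonempty with rfl | neA
  · simpa using nB
  rcases B.eq_empty_or_nonempty with rfl | neB
  · simpa using nA
  obtain ⟨ra, ra1, ra2⟩ := nA
  obtain ⟨rb, rb1, rb2⟩ := nB
  obtain ⟨rc, rc1, rc2⟩ := nC
  have hmemA : ∀ x, infDist x A = 0 ↔ x ∈ A := fun x =>
    (hA.isClosed.mem_iff_infDist_zero neA).symm
  have hmemB : ∀ x, infDist x B = 0 ↔ x ∈ B := fun x =>
    (hB.isClosed.mem_iff_infDist_zero neB).symm
  have ca : Continuous fun x => infDist x A := continuous_infDist_pt A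
  have cb : Continuous fun x => infDist x B := continuous_infDist_pt B
  -- closed neighbourhood N of A ∩ B
  obtain ⟨δ, hδ, hN⟩ := (hA.inter hB).exists_cthickening_subset_open
    (t := interior {y | rc y ∈ A ∩ B ∧ ContinuousAt rc y}) isOpen_interior
    (fun x hx => mem_interior_iff_mem_nhds.2 (rc2 x hx))
  set N := cthickening δ (A ∩ B) with hNdef
  have hN' : ∀ y ∈ N, rc y ∈ A ∩ B ∧ ContinuousAt rc y := fun y hy => by
    have := interior_subset (hN hy)
    exact this
  set S : Set E := {x | infDist x A = infDist x B} with hS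
  have cS : IsClosed S := isClosed_eq ca cb
  have cSN : IsClosed (S ∩ N) := cS.inter isClosed_cthickening
  have rcon : ContinuousOn rc (S ∩ N) := fun y hy => (hN' y hy.2).2.continuousWithinAt
  obtain ⟨ha, hac, ha1, ha2⟩ := nr10_ext (A := A) hA.isClosed cSN rcon (by
    rintro x ⟨hxA, hxS, hxN⟩
    refine rc1 x ⟨hxA, (hmemB x).1 ?_⟩
    have : infDist x A = infDist x B := hxS
    rw [← this]; exact (hmemA x).2 hxA)
  obtain ⟨hb, hbc, hb1, hb2⟩ := nr10_ext (A := B) hB.isClosed cSN rcon (by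
    rintro x ⟨hxB, hxS, hxN⟩
    refine rc1 x ⟨(hmemA x).1 ?_, hxB⟩
    have : infDist x A = infDist x B := hxS
    rw [this]; exact (hmemB x).2 hxB)
  have evA : ∀ x ∈ A, ∀ᶠ y in 𝓝 x, ra (ha y) ∈ A ∧ ContinuousAt (fun z => ra (ha z)) y := by
    intro x hx
    have h1 : Tendsto ha (𝓝 x) (𝓝 x) := by
      have := hac.tendsto x
      rwa [ha1 x hx] at this
    filter_upwards [h1.eventually (ra2 x hx)] with y hy
    exact ⟨hy.1, ContinuousAt.comp (f := ha) hy.2 hac.continuousAt⟩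
  have evB : ∀ x ∈ B, ∀ᶠ y in 𝓝 x, rb (hb y) ∈ B ∧ ContinuousAt (fun z => rb (hb z)) y := by
    intro x hx
    have h1 : Tendsto hb (𝓝 x) (𝓝 x) := by
      have := hbc.tendsto x
      rwa [hb1 x hx] at this
    filter_upwards [h1.eventually (rb2 x hx)] with y hy
    exact ⟨hy.1, ContinuousAt.comp (f := hb) hy.2 hbc.continuousAt⟩
  refine ⟨fun z => if infDist z A ≤ infDist z B then ra (ha z) else rb (hb z), ?_, ?_⟩
  · intro x hx
    by_cases hxA : x ∈ A
    · have : infDist x A ≤ infDist x B := by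
        rw [(hmemA x).2 hxA]; exact infDist_nonneg
      simp [this, ha1 x hxA, ra1 x hxA]
    · have hxB : x ∈ B := hx.resolve_left hxA
      have h0 : infDist x A ≠ 0 := fun h => hxA ((hmemA x).1 h)
      have : ¬ infDist x A ≤ infDist x B := by
        rw [(hmemB x).2 hxB]
        exact not_le.2 (lt_of_le_of_ne infDist_nonneg h0.symm)
      simp [this, hb1 x hxB, rb1 x hxB]
  · intro x hx
    by_cases hxA : x ∈ A
    · by_cases hxB : x ∈ B
      · have hNn : N ∈ 𝓝 x := mem_of_superset
          ((isOpen_thickening (δ := δ) (E := A ∩ B)).mem_nhds (self_subset_thickening hδ _ ⟨hxA, hxB⟩))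
          (thickening_subset_cthickening _ _)
        filter_upwards [evA x hxA, evB x hxB, hNn] with y hyA hyB hyN
        constructor
        · split_ifs
          · exact Or.inl hyA.1
          · exact Or.inr hyB.1
        · refine cont_glue10 ca cb hyA.2 hyB.2 fun hyS => ?_
          have hC := (hN' y hyN).1
          rw [ha2 y ⟨hyS, hyN⟩, hb2 y ⟨hyS, hyN⟩, ra1 _ hC.1, rb1 _ hC.2]
      · have hlt : infDist x A < infDist x B := by
          rw [(hmemA x).2 hxA]
          exact lt_of_le_of_ne infDist_nonneg fun h => hxB ((hmemB x).1 h.symm)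
        have hev := ca.continuousAt.eventually_lt cb.continuousAt hlt
        filter_upwards [hev.eventually_nhds, evA x hxA] with y hy hyA
        constructor
        · rw [if_pos hy.self_of_nhds.le]; exact Or.inl hyA.1
        · refine hyA.2.congr ?_
          filter_upwards [hy] with z hz
          rw [if_pos hz.le]
    · have hxB : x ∈ B := hx.resolve_left hxA
      have hlt : infDist x B < infDist x A := by
        rw [(hmemB x).2 hxB]
        exact lt_of_le_of_ne infDist_nonneg fun h => hxA ((hmemA x).1 h.symm)
      have hev := cb.continuousAt.eventually_lt ca.continuousAt hlt
      filter_upwards [hev.eventually_nhds, evB x hxB] with y hy hyB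
      constructor
      · rw [if_neg (not_le.2 hy.self_of_nhds)]; exact Or.inr hyB.1
      · refine hyB.2.congr ?_
        filter_upwards [hy] with z hz
        rw [if_neg (not_le.2 hz)]

lemma nr10_biUnion {E κ : Type*} [NormedAddCommGroup E] [InnerProductSpace ℝ E]
    [FiniteDimensional ℝ E] (S : Finset κ) : ∀ A : κ → Set E,
    (∀ i, IsCompact (A i)) → (∀ i, Convex ℝ (A i)) → NR10 (⋃ i ∈ S, A i) := by
  classical
  induction S using Finset.induction_on with
  | empty => intro A _ _; exact ⟨id, by simp, by simp⟩
  | insert a s ha ih =>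
    intro A hA hc
    rw [Finset.set_biUnion_insert]
    refine nr10_union (hA a) (s.isCompact_biUnion fun i _ => hA i) (nr10_convex (hA a) (hc a))
      (ih A hA hc) ?_
    rw [inter_iUnion₂]
    exact ih (fun i => A a ∩ A i) (fun i => (hA a).inter (hA i)) fun i => (hc a).inter (hc i)

open Filter Topology in
lemma nr10_unif {E : Type*} [MetricSpace E] {K : Set E} (hK : IsCompact K) (h : NR10 K) :
    ∃ r : E → E, (∀ x ∈ K, r x = x) ∧ ∀ ε > 0, ∃ η > 0, ∀ k ∈ K, ∀ y, dist y k < η →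
      r y ∈ K ∧ ContinuousAt r y ∧ dist (r y) y < ε := by
  obtain ⟨r, r1, r2⟩ := h
  refine ⟨r, r1, fun ε hε => ?_⟩
  obtain ⟨δ, hδ, hN⟩ := hK.exists_thickening_subset_open
    (t := interior {y | r y ∈ K ∧ ContinuousAt r y ∧ dist (r y) y < ε}) isOpen_interior
    (fun x hx => mem_interior_iff_mem_nhds.2 (by
      have h1 : Tendsto (fun y => dist (r y) y) (𝓝 x) (𝓝 (dist (r x) x)) :=
        (r2 x hx).self_of_nhds.2.dist continuousAt_id
      rw [r1 x hx, dist_self] at h1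
      filter_upwards [r2 x hx, h1.eventually (gt_mem_nhds hε)] with y h2 h3
      exact ⟨h2.1, h2.2, h3⟩))
  exact ⟨δ, hδ, fun k hk y hy => by
    have := interior_subset (hN (mem_thickening_iff.2 ⟨k, hk, hy⟩))
    exact this⟩
open Filter Topology in
lemma cantor_in10 {Q : Type*} [MetricSpace Q] [CompactSpace Q] [ConnectedSpace Q] [Nontrivial Q]
    (q : Q) {r : ℝ} (hr : 0 < r) :
    ∃ c : (ℕ → Bool) → Q, Continuous c ∧ Injective c ∧ ∀ b, dist (c b) q < r := by
  have h1 : Preperfect (ball q (r / 2) ∩ univ) :=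
    Preperfect.open_inter (PerfectSpace.univ_preperfect) isOpen_ball
  rw [inter_univ] at h1
  obtain ⟨c, hc, hc1, hc2⟩ := h1.perfect_closure.exists_nat_bool_injection
    ⟨q, subset_closure (mem_ball_self (half_pos hr))⟩
  refine ⟨c, hc1, hc2, fun b => ?_⟩
  have := closure_ball_subset_closedBall (hc ⟨b, rfl⟩)
  have := mem_closedBall.1 this
  linarith

open Filter Topology in
lemma approx10 {X E Q : Type*} [MetricSpace X] [CompactSpace X] [NormedAddCommGroup E]
    [NormedSpace ℝ E] [MetricSpace Q] {F : X → E} (hF : Continuous F)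
    {g : X → Q} (hg : Continuous g) (hs : Surjective g) {ε : ℝ} 
    (h : ∀ x y, g x = g y → dist (F x) (F y) < ε) :
    ∃ φ : Q → E, Continuous φ ∧ ∀ x, dist (φ (g x)) (F x) < ε := by
  obtain ⟨φ, hφ⟩ := exists_continuous_forall_mem_convex_of_local_const
    (t := fun q : Q => ⋂ x ∈ g ⁻¹' {q}, ball (F x) ε)
    (fun q => convex_iInter₂ fun x _ => convex_ball _ _) (fun q => by
      obtain ⟨x0, rfl⟩ := hs q
      refine ⟨F x0, ?_⟩
      have := (hg.isClosedMap).eventually_nhds_fiber (p := fun x => F x0 ∈ ball (F x) ε) (g x0)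
        (fun x hx => by
          have h1 : dist (F x0) (F x) < ε := h x0 x (by simpa using hx.symm)
          have h2 : Continuous fun z => dist (F x0) (F z) := by fun_prop
          filter_upwards [h2.continuousAt.eventually (gt_mem_nhds h1)] with z hz using hz)
      filter_upwards [this] with q hq
      simpa using hq)
  refine ⟨φ, φ.continuous, fun x => ?_⟩
  have := hφ (g x)
  simp only [mem_iInter] at this
  exact this x rfl

open Filter Topology in
/-- perturb a map so that its image covers `K`. -/
lemma perturb10 {E Q κ : Type*} [NormedAddCommGroup E] [InnerProductSpace ℝ E]
    [FiniteDimensional ℝ E] [MetricSpace Q] [CompactSpace Q] [ConnectedSpace Q] [Nontrivial Q]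
    [Finite κ] {K : Set E} (hK : IsCompact K) {ε : ℝ} (hε : 0 < ε) (p : κ → E)
    (hpK : ∀ j, p j ∈ K) (hcov : ∀ k ∈ K, ∃ j, dist k (p j) ≤ ε)
    (q : κ → Q) (hq : Injective q) {φ : Q → E} (hφ : Continuous φ)
    (hφq : ∀ j, dist (φ (q j)) (p j) < ε) :
    ∃ ψ : Q → E, Continuous ψ ∧ (∀ x, dist (ψ x) (φ x) ≤ 3 * ε) ∧ K ⊆ range ψ := by
  classical
  cases nonempty_fintype κ
  have hr1 : ∃ r > 0, ∀ i j, i ≠ j → 2 * r ≤ dist (q i) (q j) := by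
    have hev : ∀ᶠ r in 𝓝[>] (0:ℝ), ∀ ij : κ × κ, ij.1 ≠ ij.2 → 2 * r ≤ dist (q ij.1) (q ij.2) := by
      rw [eventually_all]
      rintro ⟨i, j⟩
      by_cases hij : i = j
      · simp [hij]
      · have h0 : 0 < dist (q i) (q j) / 2 := half_pos (dist_pos.2 (hq.ne hij))
        filter_upwards [nhdsWithin_le_nhds (gt_mem_nhds h0)] with r hr _
        linarith
    obtain ⟨r, h1, h2⟩ := (hev.and self_mem_nhdsWithin).exists
    exact ⟨r, h2, fun i j hij => h1 (i, j) hij⟩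
  obtain ⟨r1, r1p, hr1⟩ := hr1
  obtain ⟨r2, r2p, hr2⟩ := Metric.uniformContinuous_iff.1
    (CompactSpace.uniformContinuous_of_continuous hφ) ε hε
  choose c hc1 hc2 hc3 using fun j => cantor_in10 (q j) (lt_min r1p r2p)
  have hsur : ∀ j, ∃ s : (ℕ → Bool) → E, Continuous s ∧ range s = K ∩ closedBall (p j) ε := by
    intro j
    have : CompactSpace ↥(K ∩ closedBall (p j) ε) :=
      isCompact_iff_compactSpace.1 (hK.inter_right isClosed_closedBall)
    have : Nonempty ↥(K ∩ closedBall (p j) ε) := ⟨⟨p j, hpK j, mem_closedBall_self hε.le⟩⟩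
    obtain ⟨s, s1, s2⟩ := exists_nat_bool_continuous_surjective_of_compact ↥(K ∩ closedBall (p j) ε)
    refine ⟨fun b => s b, continuous_subtype_val.comp s1, ?_⟩
    have := s2.range_comp (Subtype.val : ↥(K ∩ closedBall (p j) ε) → E)
    rw [Subtype.range_coe] at this
    exact this
  choose s hs1 hs2 using hsur
  let e : (Σ _ : κ, (ℕ → Bool)) → Q := fun z => c z.1 z.2
  have he : Continuous e := continuous_sigma hc1
  have hei : Injective e := by
    rintro ⟨i, a⟩ ⟨j, b⟩ hab
    have hab' : c i a = c j b := hab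
    by_cases hij : i = j
    · subst hij
      rw [hc2 i hab']
    · exfalso
      have h1 := hr1 i j hij
      have h2 := (hc3 i a).trans_le (min_le_left _ _)
      have h3 := (hc3 j b).trans_le (min_le_left _ _)
      have h4 := dist_triangle_left (q i) (q j) (c i a)
      rw [← hab'] at h3
      linarith
  have hce : IsClosedEmbedding e := he.isClosedEmbedding hei
  let d : C((Σ _ : κ, (ℕ → Bool)), E) := ⟨fun z => s z.1 z.2 - φ (e z),
    (continuous_sigma hs1).sub (hφ.comp he)⟩
  have hd : ∀ z, d z ∈ closedBall (0:E) (3 * ε) := by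
    rintro ⟨j, b⟩
    have h1 : s j b ∈ K ∩ closedBall (p j) ε := by rw [← hs2 j]; exact ⟨b, rfl⟩
    have h2 := mem_closedBall.1 h1.2
    have h3 := hφq j
    have h4 : dist (φ (c j b)) (φ (q j)) < ε := hr2 ((hc3 j b).trans_le (min_le_right _ _))
    rw [mem_closedBall, dist_zero_right]
    change ‖s j b - φ (c j b)‖ ≤ _
    rw [← dist_eq_norm]
    have h5 := dist_triangle_right (s j b) (φ (c j b)) (p j)
    have h6 := dist_triangle (φ (c j b)) (φ (q j)) (p j)
    linarith
  have : TietzeExtension (closedBall (0:E) (3 * ε)) :=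
    Metric.instTietzeExtensionClosedBall ℝ _ (by positivity)
  obtain ⟨D, hD1, hD2⟩ := d.exists_extension_forall_mem hce hd
  refine ⟨fun x => φ x + D x, hφ.add D.continuous, fun x => ?_, fun k hk => ?_⟩
  · have := hD1 x
    rw [mem_closedBall, dist_zero_right] at this
    simpa [dist_eq_norm] using this
  · obtain ⟨j, hj⟩ := hcov k hk
    have : k ∈ range (s j) := by rw [hs2 j]; exact ⟨hk, hj⟩
    obtain ⟨b, hb⟩ := this
    refine ⟨c j b, ?_⟩
    have h1 : D (c j b) = s j b - φ (c j b) := congr($hD2 ⟨j, b⟩)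
    simp only [h1, hb]
    abel

open Filter Topology in
lemma key10 {X E : Type*} [MetricSpace X] [CompactSpace X] [ConnectedSpace X]
    [NormedAddCommGroup E] [InnerProductSpace ℝ E]
    [FiniteDimensional ℝ E] {K : Set E} (hK : IsCompact K) (hN : NR10 K)
    {F : X → E} (hF : Continuous F) (hFK : range F = K) {ε : ℝ} (hε : 0 < ε) :
    ∃ δ > 0, ∀ (Q : Type*) [MetricSpace Q] [CompactSpace Q] (g : X → Q), Continuous g →
      Surjective g → (∀ q, diam (g ⁻¹' {q}) < δ) →
      ∃ φ : Q → E, Continuous φ ∧ range φ = K ∧ ∀ x, dist (φ (g x)) (F x) < ε := by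
  classical
  by_cases hsub : K.Subsingleton
  · refine ⟨1, one_pos, fun Q _ _ g hg hs _ => ?_⟩
    obtain ⟨x0⟩ : Nonempty X := inferInstance
    have hx0 : F x0 ∈ K := hFK ▸ ⟨x0, rfl⟩
    refine ⟨fun _ => F x0, continuous_const, ?_, fun x => ?_⟩
    · have : Nonempty Q := ⟨g x0⟩
      rw [range_const]
      exact (hsub.eq_singleton_of_mem hx0).symm
    · rw [hsub hx0 (hFK ▸ ⟨x, rfl⟩ : F x ∈ K), dist_self]; exact hε
  obtain ⟨a, ha, b, hb, hab⟩ := not_subsingleton_iff.1 hsub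
  obtain ⟨r, r1, r2⟩ := nr10_unif hK hN
  obtain ⟨η, hη, hr⟩ := r2 (ε / 2) (half_pos hε)
  -- the working tolerance
  obtain ⟨ε', hε', h1, h2⟩ : ∃ ε' > 0, 4 * ε' ≤ η ∧ 4 * ε' ≤ ε / 2 :=
    ⟨min η (ε / 2) / 4, by positivity, by linarith [min_le_left η (ε / 2)],
      by linarith [min_le_right η (ε / 2)]⟩
  obtain ⟨t0, ht0, ht0f, ht0c⟩ := hK.finite_cover_balls hε'
  let t : Set E := insert a (insert b t0)
  have htf : t.Finite := (ht0f.insert b).insert a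
  have htK : ∀ p ∈ t, p ∈ K := by
    rintro p (rfl | rfl | hp)
    exacts [ha, hb, ht0 hp]
  have : Finite t := htf
  have hx : ∀ p : t, ∃ x, F x = p := fun p => by
    have := htK p p.2
    rwa [← hFK] at this
  choose x hx using hx
  -- separation of `t`
  have hsep : ∃ σ > 0, ∀ p p' : t, p ≠ p' → σ ≤ dist (p : E) p' := by
    have hev : ∀ᶠ r in 𝓝[>] (0:ℝ), ∀ ij : t × t, ij.1 ≠ ij.2 → r ≤ dist (ij.1 : E) ij.2 := by
      rw [eventually_all]
      rintro ⟨i, j⟩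
      by_cases hij : i = j
      · simp [hij]
      · have h0 : 0 < dist (i : E) j := dist_pos.2 (fun h => hij (Subtype.ext h))
        filter_upwards [nhdsWithin_le_nhds (gt_mem_nhds h0)] with r hr _
        exact le_of_lt hr
    obtain ⟨r, h1, h2⟩ := (hev.and self_mem_nhdsWithin).exists
    exact ⟨r, h2, fun i j hij => h1 (i, j) hij⟩
  obtain ⟨σ, hσ, hsep⟩ := hsep
  obtain ⟨δ, hδ, hδF⟩ := Metric.uniformContinuous_iff.1
    (CompactSpace.uniformContinuous_of_continuous hF) (min ε' σ) (lt_min hε' hσ)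
  refine ⟨δ, hδ, fun Q _ _ g hg hs hdiam => ?_⟩
  have hfib : ∀ x y, g x = g y → dist (F x) (F y) < min ε' σ := fun x y hxy =>
    hδF ((dist_le_diam_of_mem (isCompact_univ.isBounded.subset (subset_univ _))
      (by exact hxy) (by exact rfl)).trans_lt (hdiam (g y)))
  obtain ⟨φ, hφ, hφ'⟩ := approx10 hF hg hs (ε := ε')
    (fun x y h => (hfib x y h).trans_le (min_le_left _ _))
  have hinj : Injective fun p : t => g (x p) := by
    intro p p' hpp
    by_contra hne
    have h3 := (hfib _ _ hpp).trans_le (min_le_right _ _)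
    rw [hx, hx] at h3
    exact absurd (hsep p p' hne) (not_le.2 h3)
  have : ConnectedSpace Q := hs.connectedSpace hg
  have : Nontrivial Q := by
    refine ⟨⟨g (x ⟨a, by simp [t]⟩), g (x ⟨b, by simp [t]⟩), fun h => hab ?_⟩⟩
    simpa using hinj h
  obtain ⟨ψ, hψ, hψ1, hψ2⟩ := perturb10 hK hε' (fun p : t => (p : E)) (fun p => htK p p.2)
    (fun k hk => by
      have := ht0c hk
      simp only [mem_iUnion] at this
      obtain ⟨p, hp, hkp⟩ := this
      exact ⟨⟨p, by simp [t, hp]⟩, (mem_ball.1 hkp).le⟩)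
    (fun p : t => g (x p)) hinj hφ (fun p => by have := hφ' (x p); rwa [hx] at this)
  have hclose : ∀ y, dist (ψ (g y)) (F y) < 4 * ε' := fun y => by
    have h3 := dist_triangle (ψ (g y)) (φ (g y)) (F y)
    linarith [hψ1 (g y), hφ' y]
  have hFm : ∀ y, F y ∈ K := fun y => hFK ▸ ⟨y, rfl⟩
  have hrr : ∀ y, r (ψ (g y)) ∈ K ∧ ContinuousAt r (ψ (g y)) ∧
      dist (r (ψ (g y))) (ψ (g y)) < ε / 2 := fun y =>
    hr (F y) (hFm y) _ ((hclose y).trans_le h1)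
  refine ⟨fun q => r (ψ q), ?_, ?_, fun y => ?_⟩
  · rw [continuous_iff_continuousAt]
    intro q
    obtain ⟨y, rfl⟩ := hs q
    exact ContinuousAt.comp (f := ψ) (hrr y).2.1 hψ.continuousAt
  · apply Subset.antisymm
    · rintro _ ⟨q, rfl⟩
      obtain ⟨y, rfl⟩ := hs q
      exact (hrr y).1
    · intro k hk
      obtain ⟨q, rfl⟩ := hψ2 hk
      exact ⟨q, r1 _ hk⟩
  · have h3 := dist_triangle (r (ψ (g y))) (ψ (g y)) (F y)
    linarith [hclose y, (hrr y).2.2]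

lemma keyP10 {X P : Type*} [MetricSpace X] [CompactSpace X] [ConnectedSpace X]
    [MetricSpace P] [CompactSpace P] 
    (hP : ∃ (n : ℕ) (S : Finset (Finset (EuclideanSpace ℝ (Fin n)))),
      Nonempty (P ≃ₜ ↥(⋃ s ∈ S, convexHull ℝ (s : Set (EuclideanSpace ℝ (Fin n))))))
    {f : X → P} (hf : Continuous f) (hfs : Surjective f) {ε : ℝ} (hε : 0 < ε) :
    ∃ δ > 0, ∀ (Q : Type*) [MetricSpace Q] [CompactSpace Q] (g : X → Q), Continuous g →
      Surjective g → (∀ q, diam (g ⁻¹' {q}) < δ) →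
      ∃ φ : Q → P, Continuous φ ∧ Surjective φ ∧ ∀ x, dist (φ (g x)) (f x) < ε := by
  obtain ⟨n, S, ⟨e⟩⟩ := hP
  have hcomp : ∀ s : Finset (EuclideanSpace ℝ (Fin n)),
    IsCompact (convexHull ℝ (s : Set (EuclideanSpace ℝ (Fin n)))) := fun s =>
      s.finite_toSet.isCompact_convexHull ℝ
  have hN := nr10_biUnion S (fun s => convexHull ℝ (s : Set (EuclideanSpace ℝ (Fin n)))) hcomp
    (fun s => convex_convexHull ℝ _)
  have hK := S.isCompact_biUnion (fun s _ => hcomp s)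
  set K := ⋃ s ∈ S, convexHull ℝ (s : Set (EuclideanSpace ℝ (Fin n)))
  have : CompactSpace K := isCompact_iff_compactSpace.1 hK
  obtain ⟨ε1, hε1, he⟩ := Metric.uniformContinuous_iff.1
    (CompactSpace.uniformContinuous_of_continuous e.symm.continuous) ε hε
  obtain ⟨δ, hδ, H⟩ := key10 hK hN (F := fun x => (e (f x) : EuclideanSpace ℝ (Fin n)))
    (by fun_prop) (by
      have h1 : Surjective fun x => e (f x) := e.surjective.comp hfs
      have := h1.range_comp (Subtype.val : K → _)
      rw [Subtype.range_coe] at this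
      exact this) hε1
  refine ⟨δ, hδ, fun Q _ _ g hg hs hd => ?_⟩
  obtain ⟨φ, h1, h2, h3⟩ := H Q g hg hs hd
  have hm : ∀ q, φ q ∈ K := fun q => h2 ▸ ⟨q, rfl⟩
  refine ⟨fun q => e.symm ⟨φ q, hm q⟩, e.symm.continuous.comp (h1.subtype_mk hm), fun p => ?_,
    fun x => ?_⟩
  · have : (e p : EuclideanSpace ℝ (Fin n)) ∈ range φ := by rw [h2]; exact (e p).2
    obtain ⟨q, hq⟩ := this
    refine ⟨q, ?_⟩
    have : (⟨φ q, hm q⟩ : K) = e p := Subtype.ext hq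
    simp only [this, e.symm_apply_apply]
  · have := he (a := ⟨φ (g x), hm _⟩) (b := e (f x)) (h3 x)
    simpa using this
/-- iterated approximations `φ_{m,m+k} ∘ F_{m+k}` -/
def W10 {X : Type*} {Y : ℕ → Type*} (f : ∀ n, Y (n + 1) → Y n) (F : ∀ n, X → Y n) :
    ℕ → ∀ m, X → Y m
  | 0, m => F m
  | k + 1, m => fun x => f m (W10 f F k (m + 1) x)

open Filter Topology in
lemma lim10 {X : Type*} [MetricSpace X] [CompactSpace X] (Y : ℕ → Type*)
    [∀ n, MetricSpace (Y n)] [∀ n, CompactSpace (Y n)] (f : ∀ n, Y (n + 1) → Y n)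
    (hf : ∀ n, Continuous (f n)) (F : ∀ n, X → Y n) (hF : ∀ n, Continuous (F n))
    (hFs : ∀ n, Surjective (F n)) (ρ : ∀ n, Y n → Y n → ℝ) (η ν : ℕ → ℝ)
    (hρd : ∀ n p q, dist p q ≤ ρ n p q)
    (hρf : ∀ n p q, ρ n (f n p) (f n q) ≤ ρ (n + 1) p q)
    (hclose : ∀ n x, ρ n (f n (F (n + 1) x)) (F n x) ≤ η n)
    (hη : ∀ n, η (n + 1) ≤ η n / 2)
    (hsep : ∀ n x y, dist (F n x) (F n y) ≤ 4 * η n → dist x y ≤ ν n)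
    (hν : Tendsto ν atTop (𝓝 0)) :
    Nonempty (X ≃ₜ ↥(InverseLimit Y f)) := by
  have hW : ∀ k m x, ρ m (W10 f F (k + 1) m x) (W10 f F k m x) ≤ η m / 2 ^ k := by
    intro k
    induction k with
    | zero => intro m x; simpa [W10] using hclose m x
    | succ k ih =>
      intro m x
      refine (hρf m _ _).trans ((ih (m + 1) x).trans ?_)
      rw [pow_succ', ← div_div]
      exact div_le_div_of_nonneg_right (hη m) (by positivity)
  have hWd : ∀ m x k, dist (W10 f F k m x) (W10 f F (k + 1) m x) ≤ 2 * η m / 2 / 2 ^ k := by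
    intro m x k
    rw [dist_comm]
    refine (hρd _ _ _).trans ((hW k m x).trans (le_of_eq ?_))
    ring
  have hex : ∀ m x, ∃ a, Tendsto (fun k => W10 f F k m x) atTop (𝓝 a) := fun m x =>
    cauchySeq_tendsto_of_complete (cauchySeq_of_le_geometric_two (hWd m x))
  choose h hh using hex
  have hb : ∀ m x k, dist (W10 f F k m x) (h m x) ≤ 2 * η m / 2 ^ k := fun m x k =>
    dist_le_of_le_geometric_two_of_tendsto (hWd m x) (hh m x) k
  have hWc : ∀ k m, Continuous (W10 f F k m) := by
    intro k
    induction k with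
    | zero => exact hF
    | succ k ih => intro m; exact (hf m).comp (ih (m + 1))
  have hgeo : ∀ m, Tendsto (fun k : ℕ => 2 * η m / 2 ^ k) atTop (𝓝 0) := fun m =>
    tendsto_const_nhds.div_atTop (tendsto_pow_atTop_atTop_of_one_lt one_lt_two)
  have hc : ∀ m, Continuous (h m) := by
    intro m
    have : TendstoUniformly (fun k => W10 f F k m) (h m) atTop := by
      rw [Metric.tendstoUniformly_iff]
      intro ε hε
      filter_upwards [(hgeo m).eventually (gt_mem_nhds hε)] with k hk x
      rw [dist_comm]
      exact (hb m x k).trans_lt hk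
    exact this.continuous (Frequently.of_forall fun k => hWc k m)
  have hcomm : ∀ m x, f m (h (m + 1) x) = h m x := by
    intro m x
    have h1 := ((hf m).tendsto _).comp (hh (m + 1) x)
    have h2 := (hh m x).comp (tendsto_add_atTop_nat 1)
    exact tendsto_nhds_unique h1 h2
  let H : X → ↥(InverseLimit Y f) := fun x => ⟨fun m => h m x, fun m => hcomm m x⟩
  have Hc : Continuous H := (continuous_pi hc).subtype_mk _
  have Hi : Injective H := by
    intro x y hxy
    have h1 : ∀ m, h m x = h m y := fun m => congrFun (congrArg Subtype.val hxy) m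
    have h2 : ∀ m, dist x y ≤ ν m := by
      intro m
      apply hsep
      have e1 := hb m x 0
      have e2 := hb m y 0
      have e3 := dist_triangle_right (F m x) (F m y) (h m x)
      simp only [W10, pow_zero, div_one] at e1 e2
      rw [← h1] at e2
      linarith
    have h3 : dist x y ≤ 0 := ge_of_tendsto' hν h2
    exact dist_le_zero.1 h3
  have Hs : Surjective H := by
    rintro ⟨p, hp⟩
    have hp' : ∀ n, f n (p (n + 1)) = p n := hp
    have key : ∀ k m x, (∀ n, n = m + k → F n x = p n) → W10 f F k m x = p m := by
      intro k
      induction k with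
      | zero => intro m x hx; exact hx m rfl
      | succ k ih =>
        intro m x hx
        have := ih (m + 1) x (fun n hn => hx n (by omega))
        simp only [W10]
        rw [this, hp']
    choose xs hxs using fun n => hFs n (p n)
    obtain ⟨x, θ, hθ, hx⟩ := CompactSpace.tendsto_subseq xs
    refine ⟨x, Subtype.ext (funext fun m => ?_)⟩
    change h m x = p m
    have h1 : Tendsto (fun n => h m (xs (θ n))) atTop (𝓝 (h m x)) :=
      ((hc m).tendsto x).comp hx
    have h2 : Tendsto (fun n => h m (xs (n + m))) atTop (𝓝 (p m)) := by
      rw [tendsto_iff_dist_tendsto_zero]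
      refine squeeze_zero (fun _ => dist_nonneg) (fun k => ?_) (hgeo m)
      have := hb m (xs (k + m)) k
      rw [key k m _ (fun n hn => by
        have : k + m = n := by omega
        rw [this]; exact hxs n)] at this
      rwa [dist_comm]
    have h3 : Tendsto (fun n => h m (xs n)) atTop (𝓝 (p m)) :=
      (tendsto_add_atTop_iff_nat (f := fun n => h m (xs n)) m).1 h2
    exact tendsto_nhds_unique h1 (h3.comp hθ.tendsto_atTop)
  exact ⟨Hc.homeoOfEquivCompactToT2 (f := Equiv.ofBijective H ⟨Hi, Hs⟩)⟩

lemma sep10 {X Y : Type*} [MetricSpace X] [CompactSpace X] [MetricSpace Y] {g : X → Y}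
    (hg : Continuous g) {ν : ℝ} (h : ∀ q, diam (g ⁻¹' {q}) < ν) :
    ∃ η > 0, ∀ x y, dist (g x) (g y) ≤ 4 * η → dist x y ≤ ν := by
  have hc : IsCompact {z : X × X | ν ≤ dist z.1 z.2} :=
    (isClosed_le continuous_const continuous_dist).isCompact
  rcases Set.eq_empty_or_nonempty {z : X × X | ν ≤ dist z.1 z.2} with he | hne
  · refine ⟨1, one_pos, fun x y _ => ?_⟩
    by_contra! hlt
    have : (x, y) ∈ {z : X × X | ν ≤ dist z.1 z.2} := hlt.le
    rw [he] at this
    exact this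
  · obtain ⟨⟨a, b⟩, hab, hmin⟩ := hc.exists_isMinOn hne
      (f := fun z : X × X => dist (g z.1) (g z.2)) (by fun_prop)
    have hpos : 0 < dist (g a) (g b) := by
      rw [dist_pos]
      intro hgab
      have h1 := dist_le_diam_of_mem (s := g ⁻¹' {g b})
        (isCompact_univ.isBounded.subset (subset_univ _)) (x := a) (y := b) hgab rfl
      have h2 : ν ≤ dist a b := hab
      linarith [h (g b)]
    refine ⟨dist (g a) (g b) / 8, by positivity, fun x y hxy => ?_⟩
    by_contra! hlt
    have h3 : dist (g a) (g b) ≤ dist (g x) (g y) := hmin (a := (x, y)) hlt.le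
    linarith

structure St10 {ι : Type*} (P : ι → Type*) [∀ i, MetricSpace (P i)] (X : Type*)
    [MetricSpace X] where
  i : ι
  f : X → P i
  hf : Continuous f
  hfs : Surjective f
  ρ : P i → P i → ℝ
  hρc : Continuous fun z : P i × P i => ρ z.1 z.2
  hρ0 : ∀ p, ρ p p = 0
  hρd : ∀ p q, dist p q ≤ ρ p q
  η : ℝ
  hη : 0 < η
  ν : ℝ
  hν : 0 < ν
  hsep : ∀ x y, dist (f x) (f y) ≤ 4 * η → dist x y ≤ ν

lemma step10 {ι : Type*} (P : ι → Type*) [∀ i, MetricSpace (P i)]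
    [∀ i, CompactSpace (P i)] (hP : ∀ i, IsPolyhedron (P i))
    (X : Type*) [MetricSpace X] [CompactSpace X] [ConnectedSpace X]
    (hlike : ∀ ε : ℝ, 0 < ε → ∃ i : ι, ∃ f : X → P i, Continuous f ∧
      Function.Surjective f ∧ ∀ p : P i, Metric.diam (f ⁻¹' {p}) < ε) (s : St10 P X) :
    ∃ s' : St10 P X, ∃ φ : P s'.i → P s.i, Continuous φ ∧ Surjective φ ∧
      (∀ p q, s.ρ (φ p) (φ q) ≤ s'.ρ p q) ∧ (∀ x, s.ρ (φ (s'.f x)) (s.f x) ≤ s.η) ∧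
      s'.η ≤ s.η / 2 ∧ s'.ν ≤ s.ν / 2 := by
  obtain ⟨ε, hε, hεη⟩ := Metric.uniformContinuous_iff.1
    (CompactSpace.uniformContinuous_of_continuous s.hρc) s.η s.hη
  obtain ⟨δ, hδ, H⟩ := keyP10 (hP s.i) s.hf s.hfs hε
  obtain ⟨i, g, hg, hgs, hgd⟩ := hlike (min δ (s.ν / 2)) (lt_min hδ (half_pos s.hν))
  obtain ⟨φ, h1, h2, h3⟩ := H (P i) g hg hgs fun q => (hgd q).trans_le (min_le_left _ _)
  obtain ⟨η, hη, hsep⟩ := sep10 hg fun q => (hgd q).trans_le (min_le_right _ _)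
  have hρc := s.hρc
  refine ⟨⟨i, g, hg, hgs, fun p q => dist p q + s.ρ (φ p) (φ q), ?_, ?_, ?_, min η (s.η / 2),
    lt_min hη (half_pos s.hη), s.ν / 2, half_pos s.hν, ?_⟩, φ, h1, h2, ?_, ?_, ?_, ?_⟩
  · exact continuous_dist.add (hρc.comp
      ((h1.comp continuous_fst).prodMk (h1.comp continuous_snd)))
  · intro p; simp [s.hρ0]
  · intro p q
    linarith [dist_nonneg.trans (s.hρd (φ p) (φ q))]
  · intro x y hxy
    refine hsep x y (hxy.trans ?_)
    linarith [min_le_left η (s.η / 2)]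
  · intro p q
    simp
  · intro x
    have := hεη (a := (φ (g x), s.f x)) (b := (s.f x, s.f x)) (by
      rw [Prod.dist_eq]
      simpa using h3 x)
    rw [s.hρ0, Real.dist_eq, sub_zero] at this
    exact (le_abs_self _).trans this.le
  · exact min_le_right _ _
  · exact le_rfl

theorem stmt10 {ι : Type*} (P : ι → Type*) [∀ i, MetricSpace (P i)]
    [∀ i, CompactSpace (P i)] (hP : ∀ i, IsPolyhedron (P i))
    (X : Type*) [MetricSpace X] [CompactSpace X] [ConnectedSpace X]
    (hlike : ∀ ε : ℝ, 0 < ε → ∃ i : ι, ∃ f : X → P i, Continuous f ∧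
      Function.Surjective f ∧ ∀ p : P i, Metric.diam (f ⁻¹' {p}) < ε) :
    ∃ (g : ℕ → ι) (f : ∀ n : ℕ, P (g (n + 1)) → P (g n)),
      (∀ n, Continuous (f n) ∧ Function.Surjective (f n)) ∧
      Nonempty (X ≃ₜ ↥(InverseLimit (fun n => P (g n)) f)) := by
  obtain ⟨i0, f0, hf0, hfs0, hd0⟩ := hlike 1 one_pos
  obtain ⟨η0, hη0, hsep0⟩ := sep10 hf0 hd0
  let s0 : St10 P X := ⟨i0, f0, hf0, hfs0, dist, continuous_dist, dist_self, fun _ _ => le_rfl,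
    η0, hη0, 1, one_pos, hsep0⟩
  choose nx φ h1 h2 h3 h4 h5 h6 using step10 P hP X hlike
  let s : ℕ → St10 P X := fun n => Nat.rec s0 (fun _ t => nx t) n
  have hs : ∀ n, s (n + 1) = nx (s n) := fun _ => rfl
  refine ⟨fun n => (s n).i, fun n => φ (s n), fun n => ⟨h1 _, h2 _⟩, ?_⟩
  refine lim10 (fun n => P (s n).i) (fun n => φ (s n)) (fun n => h1 _) (fun n => (s n).f)
    (fun n => (s n).hf) (fun n => (s n).hfs) (fun n => (s n).ρ) (fun n => (s n).η)
    (fun n => (s n).ν) (fun n => (s n).hρd) (fun n => h3 (s n)) (fun n => h4 (s n))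
    (fun n => h5 (s n)) (fun n => (s n).hsep) ?_
  have hle : ∀ n, (s n).ν ≤ (1 / 2) ^ n := by
    intro n
    induction n with
    | zero => simp [s, s0]
    | succ n ih =>
      have := h6 (s n)
      rw [hs, pow_succ]
      linarith
  exact squeeze_zero (fun n => (s n).hν.le) hle
    (tendsto_pow_atTop_nhds_zero_of_lt_one (by norm_num) (by norm_num))
end
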